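/- Let u be a viscosity solution of λ (det D²u)^p ≤ u_t ≤ Λ (det D²u)^p in Ω × [−T,0] with 0 ∈ Ω, and assume that for some h > 0 and d ≥ 1 there is a section of u(·,0) at 0 at height h which is d-balanced with respect to 0 and has compact closure contained in Ω. Then: (a) if for some β > 0 and some unit vector e the function u(·,−T) is C^{1,β} at 0 in the direction e, then u(·,0) is C^{1,α} at 0 in the direction e, where α > 0 depends only on β, d, n, p, λ, Λ; (b) if u(0,0) > u(0,−T), then u(·,0) is C^{1,α} at 0, where α > 0 depends only on d, n, p, λ, Λ. -/

import Mathlib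

open Set Metric MeasureTheory
open scoped RealInnerProductSpace

noncomputable section

abbrev E (n : ℕ) := EuclideanSpace ℝ (Fin n)

variable {n : ℕ}

/-- The time derivative `∂ₜφ(x,t)`. -/
noncomputable def timeDeriv (φ : E n → ℝ → ℝ) (x : E n) (t : ℝ) : ℝ :=
  deriv (φ x) t

/-- The spatial Hessian matrix `D²φ(x,t)` (in the standard coordinates). -/
noncomputable def hessMatrix (φ : E n → ℝ → ℝ) (x : E n) (t : ℝ) :
    Matrix (Fin n) (Fin n) ℝ :=
  Matrix.of fun i j =>
    fderiv ℝ (fun y => fderiv ℝ (fun z => φ z t) y (EuclideanSpace.single j (1:ℝ))) x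
      (EuclideanSpace.single i (1:ℝ))

/-- `φ` is an admissible test function near `(x₀,t₀)`: C² in `x` and C¹ in `t` nearby. -/
def IsTestAt (φ : E n → ℝ → ℝ) (x₀ : E n) (t₀ : ℝ) : Prop :=
  ∃ ε > (0:ℝ),
    (∀ t ∈ ball t₀ ε, ContDiffOn ℝ 2 (fun x => φ x t) (ball x₀ ε)) ∧
    (∀ x ∈ ball x₀ ε, ContDiffOn ℝ 1 (fun t => φ x t) (ball t₀ ε))

/-- `u - φ` attains a local maximum at `(x₀,t₀)` among times `t ≤ t₀`,
relative to `closure Ω × [t₁,t₂]`. -/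
def LocalMaxBelow (Ω : Set (E n)) (t₁ t₂ : ℝ) (u φ : E n → ℝ → ℝ)
    (x₀ : E n) (t₀ : ℝ) : Prop :=
  ∃ ε > (0:ℝ), ∀ x ∈ closure Ω, ∀ t ∈ Icc t₁ t₂, t ≤ t₀ →
    dist x x₀ < ε → dist t t₀ < ε →
    u x t - φ x t ≤ u x₀ t₀ - φ x₀ t₀

/-- `u - φ` attains a local minimum at `(x₀,t₀)` among times `t ≤ t₀`. -/
def LocalMinBelow (Ω : Set (E n)) (t₁ t₂ : ℝ) (u φ : E n → ℝ → ℝ)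
    (x₀ : E n) (t₀ : ℝ) : Prop :=
  ∃ ε > (0:ℝ), ∀ x ∈ closure Ω, ∀ t ∈ Icc t₁ t₂, t ≤ t₀ →
    dist x x₀ < ε → dist t t₀ < ε →
    u x₀ t₀ - φ x₀ t₀ ≤ u x t - φ x t

/-- Viscosity subsolution of `u_t ≤ Λ (det D²u)^p` on `Ω × [t₁,t₂]`. -/
def ViscSubsolution (Lam p : ℝ) (Ω : Set (E n)) (t₁ t₂ : ℝ) (u : E n → ℝ → ℝ) : Prop :=
  ∀ x₀ ∈ Ω, ∀ t₀ ∈ Ioc t₁ t₂, ∀ φ : E n → ℝ → ℝ, IsTestAt φ x₀ t₀ →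
    LocalMaxBelow Ω t₁ t₂ u φ x₀ t₀ →
    timeDeriv φ x₀ t₀ ≤ Lam * max (hessMatrix φ x₀ t₀).det 0 ^ p

/-- Viscosity supersolution of `u_t ≥ λ (det D²u)^p` on `Ω × [t₁,t₂]`. -/
def ViscSupersolution (lam p : ℝ) (Ω : Set (E n)) (t₁ t₂ : ℝ) (u : E n → ℝ → ℝ) : Prop :=
  ∀ x₀ ∈ Ω, ∀ t₀ ∈ Ioc t₁ t₂, ∀ φ : E n → ℝ → ℝ, IsTestAt φ x₀ t₀ →
    LocalMinBelow Ω t₁ t₂ u φ x₀ t₀ →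
    (hessMatrix φ x₀ t₀).PosSemidef →
    lam * (hessMatrix φ x₀ t₀).det ^ p ≤ timeDeriv φ x₀ t₀

/-- The regularity/structure assumptions: continuity on `closure Ω × [t₁,t₂]`,
convexity in `x`, monotonicity in `t`. -/
structure ParabolicRegular (Ω : Set (E n)) (t₁ t₂ : ℝ) (u : E n → ℝ → ℝ) : Prop where
  cont : ContinuousOn (fun q : E n × ℝ => u q.1 q.2) (closure Ω ×ˢ Icc t₁ t₂)
  conv : ∀ t ∈ Icc t₁ t₂, ConvexOn ℝ (closure Ω) (fun x => u x t)
  mono : ∀ x ∈ closure Ω, ∀ s ∈ Icc t₁ t₂, ∀ t ∈ Icc t₁ t₂, s ≤ t → u x s ≤ u x t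

/-- Viscosity solution of `λ (det D²u)^p ≤ u_t ≤ Λ (det D²u)^p` on `Ω × [t₁,t₂]`. -/
def ViscositySolution (lam Lam p : ℝ) (Ω : Set (E n)) (t₁ t₂ : ℝ) (u : E n → ℝ → ℝ) : Prop :=
  ParabolicRegular Ω t₁ t₂ u ∧ ViscSubsolution Lam p Ω t₁ t₂ u ∧
    ViscSupersolution lam p Ω t₁ t₂ u

/-- `w` is `C^{1,α}` at `x₀` (relative to the set `D`) with some finite constant. -/
def C1AlphaAt (w : E n → ℝ) (D : Set (E n)) (α : ℝ) (x₀ : E n) : Prop :=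
  ∃ C a : ℝ, ∃ q : E n, ∀ x ∈ D, |w x - (a + ⟪q, x - x₀⟫)| ≤ C * ‖x - x₀‖ ^ (1 + α)

/-- `w` is `C^{1,α}` at `x₀` in the direction `e` (relative to the set `D`). -/
def C1AlphaDirAt (w : E n → ℝ) (D : Set (E n)) (α : ℝ) (x₀ e : E n) : Prop :=
  ∃ C a q : ℝ, ∀ s : ℝ, x₀ + s • e ∈ D →
    |w (x₀ + s • e) - (a + q * s)| ≤ C * |s| ^ (1 + α)

/-- A convex set `S` is `d`-balanced with respect to `x₀`. -/
def DBalanced (d : ℝ) (S : Set (E n)) (x₀ : E n) : Prop :=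
  ∃ A : E n →ₗ[ℝ] E n, Function.Bijective A ∧
    ball (0 : E n) 1 ⊆ A '' ((fun y => y - x₀) '' S) ∧
    A '' ((fun y => y - x₀) '' S) ⊆ ball (0 : E n) d

/-- `x₀` is an extremal point of the convex set `D`. -/
def ExtremalPoint (D : Set (E n)) (x₀ : E n) : Prop :=
  ¬ ∃ y ∈ closure D, ∃ z ∈ closure D, ∃ t : ℝ,
      0 < t ∧ t < 1 ∧ y ≠ z ∧ x₀ = t • y + (1 - t) • z

/-- A function which is an affine function plus a diagonal quadratic form in the affine coordinates
`c i x - b i`, moving in time with constant speed `κ`. -/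
def barrier (A : ℝ) (q : E n) (m : Fin n → ℝ) (c : Fin n → E n →L[ℝ] ℝ) (b : Fin n → ℝ)
    (κ τ : ℝ) (x : E n) (s : ℝ) : ℝ :=
  A + ⟪q, x⟫ + ∑ i, m i * (c i x - b i) ^ 2 + κ * (s - τ)

/-- The matrix of a family of linear functionals. -/
def coordMatrix (c : Fin n → E n →L[ℝ] ℝ) : Matrix (Fin n) (Fin n) ℝ :=
  Matrix.of fun i j => c i (EuclideanSpace.single j (1 : ℝ))

lemma continuous_barrier (A : ℝ) (q : E n) (m : Fin n → ℝ) (c : Fin n → E n →L[ℝ] ℝ)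
    (b : Fin n → ℝ) (κ τ : ℝ) :
    Continuous (fun z : E n × ℝ => barrier A q m c b κ τ z.1 z.2) := by
  unfold barrier
  fun_prop

lemma isTestAt_barrier (A : ℝ) (q : E n) (m : Fin n → ℝ) (c : Fin n → E n →L[ℝ] ℝ)
    (b : Fin n → ℝ) (κ τ : ℝ) (x₀ : E n) (t₀ : ℝ) :
    IsTestAt (barrier A q m c b κ τ) x₀ t₀ := by
  refine ⟨1, one_pos, fun t _ => ContDiff.contDiffOn ?_, fun x _ => ContDiff.contDiffOn ?_⟩
  · change ContDiff ℝ 2 fun x => A + innerSL ℝ q x + ∑ i, m i * (c i x - b i) ^ 2 + κ * (t - τ)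
    fun_prop
  · unfold barrier
    fun_prop

lemma timeDeriv_barrier (A : ℝ) (q : E n) (m : Fin n → ℝ) (c : Fin n → E n →L[ℝ] ℝ)
    (b : Fin n → ℝ) (κ τ : ℝ) (x₀ : E n) (t₀ : ℝ) :
    timeDeriv (barrier A q m c b κ τ) x₀ t₀ = κ := by
  have : HasDerivAt (fun s => barrier A q m c b κ τ x₀ s) (κ * 1) t₀ :=
    (((hasDerivAt_id t₀).sub_const τ).const_mul κ).const_add _
  simpa [timeDeriv] using this.deriv

lemma fderiv_barrier (A : ℝ) (q : E n) (m : Fin n → ℝ) (c : Fin n → E n →L[ℝ] ℝ)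
    (b : Fin n → ℝ) (κ τ : ℝ) (x w : E n) (t : ℝ) :
    fderiv ℝ (fun z => barrier A q m c b κ τ z t) x w
      = ⟪q, w⟫ + ∑ i, m i * (2 * (c i x - b i) * c i w) := by
  have h1 : ∀ i, HasFDerivAt (fun z => m i * (c i z - b i) ^ 2)
      (m i • ((2 * (c i x - b i)) • c i)) x := by
    intro i
    have := (((c i).hasFDerivAt (x := x)).sub_const (b i)).pow 2
    have := this.const_mul (m i)
    simpa [nsmul_eq_mul] using this
  have h2 : HasFDerivAt (fun z : E n => ⟪q, z⟫) (innerSL ℝ q) x := (innerSL ℝ q).hasFDerivAt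
  have h3 := ((h2.const_add A).add
    (HasFDerivAt.fun_sum (u := Finset.univ) fun i _ => h1 i)).add_const (κ * (t - τ))
  have h4 : (fun z => barrier A q m c b κ τ z t) = fun z => (A + ⟪q, z⟫ +
      ∑ i, m i * (c i z - b i) ^ 2) + κ * (t - τ) := rfl
  rw [h4]
  have h5 := h3.fderiv
  erw [h5]
  simp

lemma hessMatrix_barrier (A : ℝ) (q : E n) (m : Fin n → ℝ) (c : Fin n → E n →L[ℝ] ℝ)
    (b : Fin n → ℝ) (κ τ : ℝ) (x₀ : E n) (t₀ : ℝ) :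
    hessMatrix (barrier A q m c b κ τ) x₀ t₀
      = (coordMatrix c).transpose * Matrix.diagonal (fun i => 2 * m i) * coordMatrix c := by
  ext i j
  have h1 : (fun y => fderiv ℝ (fun z => barrier A q m c b κ τ z t₀) y
      (EuclideanSpace.single j (1 : ℝ))) = fun y => ⟪q, EuclideanSpace.single j (1 : ℝ)⟫ +
        ∑ i, m i * (2 * (c i y - b i) * c i (EuclideanSpace.single j (1 : ℝ))) := by
    ext y
    exact fderiv_barrier ..
  have h2 : ∀ k, HasFDerivAt (fun y => m k * (2 * (c k y - b k) *
      c k (EuclideanSpace.single j (1 : ℝ))))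
      ((m k * 2 * c k (EuclideanSpace.single j (1 : ℝ))) • c k) x₀ := by
    intro k
    have := (((c k).hasFDerivAt (x := x₀)).sub_const (b k)).const_mul
      (m k * 2 * c k (EuclideanSpace.single j (1 : ℝ)))
    exact this.congr_of_eventuallyEq (.of_forall fun y => by ring)
  have h3 := (HasFDerivAt.fun_sum (u := Finset.univ) fun i _ => h2 i).const_add
    ⟪q, EuclideanSpace.single j (1 : ℝ)⟫
  simp only [hessMatrix, Matrix.of_apply, h1]
  rw [h3.fderiv, Matrix.mul_apply]
  simp only [sum_apply, Matrix.mul_diagonal, Matrix.transpose_apply,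
    coordMatrix, Matrix.of_apply, smul_eq_mul, smul_apply]
  exact Finset.sum_congr rfl fun k _ => by ring

lemma det_hessMatrix_barrier (A : ℝ) (q : E n) (m : Fin n → ℝ) (c : Fin n → E n →L[ℝ] ℝ)
    (b : Fin n → ℝ) (κ τ : ℝ) (x₀ : E n) (t₀ : ℝ) :
    (hessMatrix (barrier A q m c b κ τ) x₀ t₀).det
      = (∏ i, 2 * m i) * (coordMatrix c).det ^ 2 := by
  rw [hessMatrix_barrier, Matrix.det_mul, Matrix.det_mul, Matrix.det_transpose,
    Matrix.det_diagonal]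
  ring

lemma posSemidef_hessMatrix_barrier (A : ℝ) (q : E n) {m : Fin n → ℝ} (hm : ∀ i, 0 ≤ m i)
    (c : Fin n → E n →L[ℝ] ℝ) (b : Fin n → ℝ) (κ τ : ℝ) (x₀ : E n) (t₀ : ℝ) :
    (hessMatrix (barrier A q m c b κ τ) x₀ t₀).PosSemidef := by
  rw [hessMatrix_barrier]
  have := (Matrix.PosSemidef.diagonal (d := fun i => 2 * m i)
    (fun i => mul_nonneg zero_le_two (hm i))).conjTranspose_mul_mul_same (coordMatrix c)
  simpa [Matrix.conjTranspose_eq_transpose_of_trivial] using this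

lemma le_barrier_of_viscSubsolution {Lam p T : ℝ} {Ω : Set (E n)} {u : E n → ℝ → ℝ}
    (hsub : ViscSubsolution Lam p Ω (-T) 0 u)
    (hcont : ContinuousOn (fun q : E n × ℝ => u q.1 q.2) (closure Ω ×ˢ Icc (-T) 0))
    {N : Set (E n)} (hN : IsCompact N) (hNΩ : N ⊆ Ω) {t₁ t₂ : ℝ} (h1 : -T ≤ t₁)
    (h12 : t₁ ≤ t₂) (h2 : t₂ ≤ 0)
    {A : ℝ} {q : E n} {m : Fin n → ℝ} {c : Fin n → E n →L[ℝ] ℝ} {b : Fin n → ℝ} {κ τ : ℝ}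
    (hm : ∀ i, 0 ≤ m i)
    (hκ : Lam * ((∏ i, 2 * m i) * (coordMatrix c).det ^ 2) ^ p < κ)
    (hinit : ∀ x ∈ N, u x t₁ ≤ barrier A q m c b κ τ x t₁)
    (hbdry : ∀ x ∈ N, x ∉ interior N → ∀ t ∈ Icc t₁ t₂, u x t ≤ barrier A q m c b κ τ x t) :
    ∀ x ∈ N, u x t₂ ≤ barrier A q m c b κ τ x t₂ := by
  intro x hx
  by_contra! hlt
  have hsubset : N ×ˢ Icc t₁ t₂ ⊆ closure Ω ×ˢ Icc (-T) 0 :=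
    prod_mono (hNΩ.trans subset_closure) (Icc_subset_Icc h1 h2)
  have hc : ContinuousOn (fun z : E n × ℝ => u z.1 z.2 - barrier A q m c b κ τ z.1 z.2)
      (N ×ˢ Icc t₁ t₂) :=
    (hcont.mono hsubset).sub (continuous_barrier A q m c b κ τ).continuousOn
  obtain ⟨⟨x₀, t₀⟩, ⟨hx₀, ht₀⟩, hmax⟩ := (hN.prod isCompact_Icc).exists_isMaxOn
    ⟨(x, t₂), hx, right_mem_Icc.2 h12⟩ hc
  simp only at hx₀ ht₀
  have hpos : 0 < u x₀ t₀ - barrier A q m c b κ τ x₀ t₀ := by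
    have := hmax (show (x, t₂) ∈ N ×ˢ Icc t₁ t₂ from ⟨hx, right_mem_Icc.2 h12⟩)
    simp only [mem_ofPred_eq] at this
    linarith
  have ht : t₁ < t₀ := by
    refine lt_of_le_of_ne ht₀.1 fun h => ?_
    subst h
    linarith [hinit x₀ hx₀]
  have h_int : x₀ ∈ interior N := by
    by_contra h
    linarith [hbdry x₀ hx₀ h t₀ ht₀]
  obtain ⟨ε, hε, hball⟩ := Metric.isOpen_iff.1 isOpen_interior x₀ h_int
  have hloc : LocalMaxBelow Ω (-T) 0 u (barrier A q m c b κ τ) x₀ t₀ := by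
    refine ⟨min ε (t₀ - t₁), lt_min hε (sub_pos.2 ht), fun y _ t _ htt hd hdt => ?_⟩
    have hy : y ∈ N := interior_subset (hball (lt_of_lt_of_le hd (min_le_left _ _)))
    have htd : t₀ - t < t₀ - t₁ := by
      have := lt_of_lt_of_le hdt (min_le_right _ _)
      rw [Real.dist_eq, abs_sub_comm] at this
      exact lt_of_le_of_lt (le_abs_self _) this
    exact hmax (show (y, t) ∈ N ×ˢ Icc t₁ t₂ from ⟨hy, by linarith, htt.trans ht₀.2⟩)
  have := hsub x₀ (hNΩ hx₀) t₀ ⟨by linarith, by linarith [ht₀.2]⟩ _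
    (isTestAt_barrier A q m c b κ τ x₀ t₀) hloc
  rw [timeDeriv_barrier, det_hessMatrix_barrier, max_eq_left] at this
  · linarith
  · exact mul_nonneg (Finset.prod_nonneg fun i _ => mul_nonneg zero_le_two (hm i)) (sq_nonneg _)

lemma barrier_le_of_viscSupersolution {lam p T : ℝ} {Ω : Set (E n)} {u : E n → ℝ → ℝ}
    (hsup : ViscSupersolution lam p Ω (-T) 0 u)
    (hcont : ContinuousOn (fun q : E n × ℝ => u q.1 q.2) (closure Ω ×ˢ Icc (-T) 0))
    {N : Set (E n)} (hN : IsCompact N) (hNΩ : N ⊆ Ω) {t₁ t₂ : ℝ} (h1 : -T ≤ t₁)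
    (h12 : t₁ ≤ t₂) (h2 : t₂ ≤ 0)
    {A : ℝ} {q : E n} {m : Fin n → ℝ} {c : Fin n → E n →L[ℝ] ℝ} {b : Fin n → ℝ} {κ τ : ℝ}
    (hm : ∀ i, 0 ≤ m i)
    (hκ : κ < lam * ((∏ i, 2 * m i) * (coordMatrix c).det ^ 2) ^ p)
    (hinit : ∀ x ∈ N, barrier A q m c b κ τ x t₁ ≤ u x t₁)
    (hbdry : ∀ x ∈ N, x ∉ interior N → ∀ t ∈ Icc t₁ t₂, barrier A q m c b κ τ x t ≤ u x t) :
    ∀ x ∈ N, barrier A q m c b κ τ x t₂ ≤ u x t₂ := by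
  intro x hx
  by_contra! hlt
  have hsubset : N ×ˢ Icc t₁ t₂ ⊆ closure Ω ×ˢ Icc (-T) 0 :=
    prod_mono (hNΩ.trans subset_closure) (Icc_subset_Icc h1 h2)
  have hc : ContinuousOn (fun z : E n × ℝ => u z.1 z.2 - barrier A q m c b κ τ z.1 z.2)
      (N ×ˢ Icc t₁ t₂) :=
    (hcont.mono hsubset).sub (continuous_barrier A q m c b κ τ).continuousOn
  obtain ⟨⟨x₀, t₀⟩, ⟨hx₀, ht₀⟩, hmin⟩ := (hN.prod isCompact_Icc).exists_isMinOn
    ⟨(x, t₂), hx, right_mem_Icc.2 h12⟩ hc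
  simp only at hx₀ ht₀
  have hneg : u x₀ t₀ - barrier A q m c b κ τ x₀ t₀ < 0 := by
    have := hmin (show (x, t₂) ∈ N ×ˢ Icc t₁ t₂ from ⟨hx, right_mem_Icc.2 h12⟩)
    simp only [mem_ofPred_eq] at this
    linarith
  have ht : t₁ < t₀ := by
    refine lt_of_le_of_ne ht₀.1 fun h => ?_
    subst h
    linarith [hinit x₀ hx₀]
  have h_int : x₀ ∈ interior N := by
    by_contra h
    linarith [hbdry x₀ hx₀ h t₀ ht₀]
  obtain ⟨ε, hε, hball⟩ := Metric.isOpen_iff.1 isOpen_interior x₀ h_int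
  have hloc : LocalMinBelow Ω (-T) 0 u (barrier A q m c b κ τ) x₀ t₀ := by
    refine ⟨min ε (t₀ - t₁), lt_min hε (sub_pos.2 ht), fun y _ t _ htt hd hdt => ?_⟩
    have hy : y ∈ N := interior_subset (hball (lt_of_lt_of_le hd (min_le_left _ _)))
    have htd : t₀ - t < t₀ - t₁ := by
      have := lt_of_lt_of_le hdt (min_le_right _ _)
      rw [Real.dist_eq, abs_sub_comm] at this
      exact lt_of_le_of_lt (le_abs_self _) this
    exact hmin (show (y, t) ∈ N ×ˢ Icc t₁ t₂ from ⟨hy, by linarith, htt.trans ht₀.2⟩)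
  have := hsup x₀ (hNΩ hx₀) t₀ ⟨by linarith, by linarith [ht₀.2]⟩ _
    (isTestAt_barrier A q m c b κ τ x₀ t₀) hloc
    (posSemidef_hessMatrix_barrier A q hm c b κ τ x₀ t₀)
  rw [timeDeriv_barrier, det_hessMatrix_barrier] at this
  linarith

/-- A normalised solution on a compact convex section `S` of height `h₀` of its final time slice,
which is balanced around the origin; the equation enters through comparison with barriers. -/
structure NormalizedSolution (lam Lam p d : ℝ) (S : Set (E n)) (T h₀ : ℝ) (v : E n → ℝ → ℝ) :
    Prop where
  T_pos : 0 < T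
  h₀_pos : 0 < h₀
  compact : IsCompact S
  convex : Convex ℝ S
  zero_mem : (0 : E n) ∈ interior S
  cont : ContinuousOn (fun z : E n × ℝ => v z.1 z.2) (S ×ˢ Icc (-T) 0)
  convexOn : ∀ t ∈ Icc (-T) 0, ConvexOn ℝ S (fun x => v x t)
  mono : ∀ x ∈ S, ∀ s ∈ Icc (-T) 0, ∀ t ∈ Icc (-T) 0, s ≤ t → v x s ≤ v x t
  zero : v 0 0 = 0
  le_height : ∀ x ∈ S, v x 0 ≤ h₀
  height_le : ∀ x ∈ S, x ∉ interior S → h₀ ≤ v x 0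
  balanced : ∀ x ∈ S, (-(1 / d)) • x ∈ S
  upper : ∀ (N : Set (E n)), IsCompact N → N ⊆ S → ∀ t₁ t₂ : ℝ, -T ≤ t₁ → t₁ ≤ t₂ → t₂ ≤ 0 →
    ∀ (A : ℝ) (q : E n) (m : Fin n → ℝ) (c : Fin n → E n →L[ℝ] ℝ) (b : Fin n → ℝ) (κ τ : ℝ),
    (∀ i, 0 ≤ m i) → Lam * ((∏ i, 2 * m i) * (coordMatrix c).det ^ 2) ^ p < κ →
    (∀ x ∈ N, v x t₁ ≤ barrier A q m c b κ τ x t₁) →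
    (∀ x ∈ N, x ∉ interior N → ∀ t ∈ Icc t₁ t₂, v x t ≤ barrier A q m c b κ τ x t) →
    ∀ x ∈ N, v x t₂ ≤ barrier A q m c b κ τ x t₂
  lower : ∀ (N : Set (E n)), IsCompact N → N ⊆ S → ∀ t₁ t₂ : ℝ, -T ≤ t₁ → t₁ ≤ t₂ → t₂ ≤ 0 →
    ∀ (A : ℝ) (q : E n) (m : Fin n → ℝ) (c : Fin n → E n →L[ℝ] ℝ) (b : Fin n → ℝ) (κ τ : ℝ),
    (∀ i, 0 ≤ m i) → κ < lam * ((∏ i, 2 * m i) * (coordMatrix c).det ^ 2) ^ p →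
    (∀ x ∈ N, barrier A q m c b κ τ x t₁ ≤ v x t₁) →
    (∀ x ∈ N, x ∉ interior N → ∀ t ∈ Icc t₁ t₂, barrier A q m c b κ τ x t ≤ v x t) →
    ∀ x ∈ N, barrier A q m c b κ τ x t₂ ≤ v x t₂

/-- The positive part of `h + ⟪q, x⟫ - f x`. -/
def excess (f : E n → ℝ) (h : ℝ) (q x : E n) : ℝ := max (h + ⟪q, x⟫ - f x) 0

/-- The squared `L²` norm over `S` of the excess of `h + ⟪q, x⟫` over `f`. -/
def potential (S : Set (E n)) (f : E n → ℝ) (h : ℝ) (q : E n) : ℝ :=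
  ∫ x in S, excess f h q x ^ 2

/-- The least potential over all slopes. -/
def minPotential (S : Set (E n)) (f : E n → ℝ) (h : ℝ) : ℝ := ⨅ q, potential S f h q

lemma excess_nonneg (f : E n → ℝ) (h : ℝ) (q x : E n) : 0 ≤ excess f h q x := le_max_right _ _

lemma le_excess (f : E n → ℝ) (h : ℝ) (q x : E n) : h + ⟪q, x⟫ - f x ≤ excess f h q x :=
  le_max_left _ _

lemma continuousOn_excess {S : Set (E n)} {f : E n → ℝ} (hf : ContinuousOn f S) (h : ℝ)
    (q : E n) : ContinuousOn (excess f h q) S := by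
  unfold excess
  have : ContinuousOn (fun x : E n => h + ⟪q, x⟫) S := by fun_prop
  exact (this.sub hf).sup continuousOn_const

lemma integrableOn_excess_sq {S : Set (E n)} (hS : IsCompact S) {f : E n → ℝ}
    (hf : ContinuousOn f S) (h : ℝ) (q : E n) :
    IntegrableOn (fun x => excess f h q x ^ 2) S :=
  ((continuousOn_excess hf h q).pow 2).integrableOn_compact hS

lemma potential_nonneg (S : Set (E n)) (f : E n → ℝ) (h : ℝ) (q : E n) :
    0 ≤ potential S f h q := integral_nonneg fun _ => sq_nonneg _

lemma bddBelow_potential (S : Set (E n)) (f : E n → ℝ) (h : ℝ) :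
    BddBelow (range fun q => potential S f h q) :=
  ⟨0, by rintro _ ⟨q, rfl⟩; exact potential_nonneg S f h q⟩

lemma minPotential_le (S : Set (E n)) (f : E n → ℝ) (h : ℝ) (q : E n) :
    minPotential S f h ≤ potential S f h q := ciInf_le (bddBelow_potential S f h) q

lemma potential_mono {S : Set (E n)} (hS : IsCompact S) {f g : E n → ℝ} (hf : ContinuousOn f S)
    (hg : ContinuousOn g S) {h h' : ℝ} {q q' : E n}
    (hle : ∀ x ∈ S, excess f h q x ≤ excess g h' q' x) :
    potential S f h q ≤ potential S g h' q' :=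
  setIntegral_mono_on (integrableOn_excess_sq hS hf h q) (integrableOn_excess_sq hS hg h' q')
    hS.measurableSet fun x hx => pow_le_pow_left₀ (excess_nonneg ..) (hle x hx) 2

lemma minPotential_mono {S : Set (E n)} (hS : IsCompact S) {f g : E n → ℝ}
    (hf : ContinuousOn f S) (hg : ContinuousOn g S) {h h' : ℝ} (hh : h ≤ h')
    (hle : ∀ x ∈ S, g x ≤ f x) : minPotential S f h ≤ minPotential S g h' :=
  ciInf_mono (bddBelow_potential S f h) fun q => potential_mono hS hf hg fun x hx =>
    max_le_max (by linarith [hle x hx]) le_rfl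

lemma continuous_potential {S : Set (E n)} (hS : IsCompact S) {f : E n → ℝ}
    (hf : ContinuousOn f S) (h : ℝ) : Continuous (potential S f h) := by
  obtain ⟨R, hR⟩ := hS.isBounded.exists_norm_le
  obtain ⟨M, hM⟩ := (hS.image_of_continuousOn hf).isBounded.exists_norm_le
  refine continuous_iff_continuousAt.2 fun q₀ => ?_
  refine continuousAt_of_dominated (bound := fun _ => (|h| + (‖q₀‖ + 1) * R + M) ^ 2) ?_ ?_ ?_ ?_
  · exact .of_forall fun q => (integrableOn_excess_sq hS hf h q).aestronglyMeasurable
  · filter_upwards [ball_mem_nhds q₀ one_pos] with q hq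
    filter_upwards [ae_restrict_mem hS.measurableSet] with x hx
    have hq' : ‖q‖ ≤ ‖q₀‖ + 1 := by
      have h1 : ‖q - q₀‖ < 1 := by simpa [dist_eq_norm] using hq
      have h2 := norm_add_le q₀ (q - q₀)
      rw [add_sub_cancel] at h2
      linarith
    have h1 : |⟪q, x⟫| ≤ (‖q₀‖ + 1) * R :=
      (abs_real_inner_le_norm q x).trans (mul_le_mul hq' (hR x hx) (norm_nonneg _) (by positivity))
    have h2 : |f x| ≤ M := hM _ (mem_image_of_mem f hx)
    rw [Real.norm_of_nonneg (sq_nonneg _)]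
    refine pow_le_pow_left₀ (excess_nonneg ..) (max_le ?_ ?_) 2
    · linarith [le_abs_self h, le_abs_self ⟪q, x⟫, neg_abs_le (f x)]
    · linarith [abs_nonneg h, abs_nonneg ⟪q, x⟫, abs_nonneg (f x)]
  · exact (continuousOn_const (s := S)).integrableOn_compact hS
  · refine .of_forall fun x => ?_
    unfold excess
    fun_prop

lemma tendsto_potential {S : Set (E n)} (hS : IsCompact S) (h0 : (0 : E n) ∈ interior S)
    {f : E n → ℝ} (hf : ContinuousOn f S) (h : ℝ) :
    Filter.Tendsto (potential S f h) (Filter.cocompact (E n)) Filter.atTop := by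
  obtain ⟨ρ, hρ, hball⟩ := Metric.isOpen_iff.1 isOpen_interior 0 h0
  obtain ⟨M, hM⟩ := (hS.image_of_continuousOn hf).isBounded.exists_norm_le
  set V := volume.real (ball (0 : E n) (ρ / 4)) with hV
  have hVpos : 0 < V := ENNReal.toReal_pos (measure_ball_pos _ _ (by positivity)).ne'
    measure_ball_lt_top.ne
  have key : ∀ q : E n, q ≠ 0 → 0 ≤ h - M + ρ / 4 * ‖q‖ →
      V * (h - M + ρ / 4 * ‖q‖) ^ 2 ≤ potential S f h q := by
    intro q hq hnn
    have hqn : 0 < ‖q‖ := norm_pos_iff.2 hq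
    set y : E n := (ρ / 2 / ‖q‖) • q
    have hy : ‖y‖ = ρ / 2 := by
      rw [norm_smul, Real.norm_of_nonneg (by positivity)]
      field_simp
    have hsub : ball y (ρ / 4) ⊆ S := fun x hx => interior_subset <| hball <| by
      rw [mem_ball, dist_eq_norm] at hx
      rw [mem_ball_zero_iff]
      have := norm_add_le (x - y) y
      rw [sub_add_cancel] at this
      linarith
    have hVy : volume.real (ball y (ρ / 4)) = V := by
      rw [hV, Measure.real, Measure.real, Measure.addHaar_ball_center]
    calc V * (h - M + ρ / 4 * ‖q‖) ^ 2
        = ∫ x in ball y (ρ / 4), (h - M + ρ / 4 * ‖q‖) ^ 2 := by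
          rw [setIntegral_const, hVy, smul_eq_mul]
      _ ≤ ∫ x in ball y (ρ / 4), excess f h q x ^ 2 := by
          refine setIntegral_mono_on (integrableOn_const measure_ball_lt_top.ne)
            ((integrableOn_excess_sq hS hf h q).mono_set hsub) measurableSet_ball fun x hx => ?_
          refine pow_le_pow_left₀ hnn (le_trans ?_ (le_excess ..)) 2
          have h2 : |f x| ≤ M := hM _ (mem_image_of_mem f (hsub hx))
          have h3 : ⟪q, y⟫ = ρ / 2 * ‖q‖ := by
            rw [inner_smul_right, real_inner_self_eq_norm_sq]
            field_simp
          have h4 : |⟪q, x - y⟫| ≤ ‖q‖ * (ρ / 4) := by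
            rw [mem_ball, dist_eq_norm] at hx
            exact (abs_real_inner_le_norm _ _).trans (by gcongr)
          have h5 : ⟪q, x⟫ = ⟪q, x - y⟫ + ⟪q, y⟫ := by rw [← inner_add_right, sub_add_cancel]
          linarith [neg_abs_le ⟪q, x - y⟫, le_abs_self (f x)]
      _ ≤ potential S f h q := setIntegral_mono_set (integrableOn_excess_sq hS hf h q)
          (.of_forall fun _ => sq_nonneg _) (LE.le.eventuallyLE hsub)
  have hlin : Filter.Tendsto (fun q : E n => h - M + ρ / 4 * ‖q‖) (Filter.cocompact (E n))
      Filter.atTop :=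
    Filter.tendsto_atTop_add_const_left _ _
      ((tendsto_norm_cocompact_atTop (E := E n)).const_mul_atTop (by positivity))
  have hq : Filter.Tendsto (fun q : E n => V * (h - M + ρ / 4 * ‖q‖) ^ 2)
      (Filter.cocompact (E n)) Filter.atTop :=
    ((Filter.tendsto_pow_atTop two_ne_zero).comp hlin).const_mul_atTop hVpos
  refine Filter.tendsto_atTop_mono' _ ?_ hq
  filter_upwards [hlin.eventually_ge_atTop 0,
    (tendsto_norm_cocompact_atTop (E := E n)).eventually_gt_atTop 0] with q h1 h2
  exact key q (norm_pos_iff.1 h2) h1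

lemma exists_potential_eq_minPotential {S : Set (E n)} (hS : IsCompact S)
    (h0 : (0 : E n) ∈ interior S) {f : E n → ℝ} (hf : ContinuousOn f S) (h : ℝ) :
    ∃ q, potential S f h q = minPotential S f h := by
  obtain ⟨q, hq⟩ := (continuous_potential hS hf h).exists_forall_le' 0
    ((tendsto_potential hS h0 hf h).eventually_ge_atTop _)
  exact ⟨q, le_antisymm (le_ciInf hq) (minPotential_le S f h q)⟩

lemma setIntegral_pos_of_continuousOn {S : Set (E n)} (hS : IsCompact S)
    (h0 : (0 : E n) ∈ interior S) {g : E n → ℝ} (hg : ContinuousOn g S) (hg0 : ∀ x, 0 ≤ g x)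
    (hpos : 0 < g 0) : 0 < ∫ x in S, g x := by
  rw [setIntegral_pos_iff_support_of_nonneg_ae (.of_forall hg0) (hg.integrableOn_compact hS)]
  have hmem : Function.support g ∩ S ∈ nhds (0 : E n) := by
    filter_upwards [(hg.continuousAt (mem_interior_iff_mem_nhds.1 h0)).eventually
      (lt_mem_nhds hpos), mem_interior_iff_mem_nhds.1 h0] with x h1 h2
    exact ⟨h1.ne', h2⟩
  exact Measure.measure_pos_of_mem_nhds _ hmem

lemma minPotential_pos {S : Set (E n)} (hS : IsCompact S)
    (h0 : (0 : E n) ∈ interior S) {f : E n → ℝ} (hf : ContinuousOn f S) {h : ℝ} (hh : f 0 < h) :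
    0 < minPotential S f h := by
  obtain ⟨q, hq⟩ := exists_potential_eq_minPotential hS h0 hf h
  rw [← hq]
  exact setIntegral_pos_of_continuousOn hS h0 ((continuousOn_excess hf h q).pow 2)
    (fun _ => sq_nonneg _) (pow_pos (lt_of_lt_of_le (by simpa using hh) (le_excess ..)) 2)

lemma integral_excess_mul_inner_eq_zero {S : Set (E n)} (hS : IsCompact S)
    {f : E n → ℝ} (hf : ContinuousOn f S) {h : ℝ} {q : E n}
    (hq : potential S f h q = minPotential S f h) (w : E n) :
    ∫ x in S, excess f h q x * ⟪w, x⟫ = 0 := by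
  have hi : ContinuousOn (fun x : E n => ⟪w, x⟫) S := by fun_prop
  have i1 := integrableOn_excess_sq hS hf h q
  have i2 : IntegrableOn (fun x => excess f h q x * ⟪w, x⟫) S :=
    ((continuousOn_excess hf h q).mul hi).integrableOn_compact hS
  have i3 : IntegrableOn (fun x => ⟪w, x⟫ ^ 2) S := (hi.pow 2).integrableOn_compact hS
  set B := ∫ x in S, excess f h q x * ⟪w, x⟫
  set C := ∫ x in S, ⟪w, x⟫ ^ 2
  have hC : 0 ≤ C := integral_nonneg fun _ => sq_nonneg _
  have key : ∀ ε : ℝ, 0 ≤ 2 * ε * B + ε ^ 2 * C := by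
    intro ε
    have h1 : potential S f h (q + ε • w) ≤
        ∫ x in S, (excess f h q x ^ 2 + 2 * ε * (excess f h q x * ⟪w, x⟫) +
          ε ^ 2 * ⟪w, x⟫ ^ 2) := by
      refine setIntegral_mono_on (integrableOn_excess_sq hS hf h _)
        ((i1.add (i2.const_mul _)).add (i3.const_mul _)) hS.measurableSet fun x _ => ?_
      have h2 : excess f h q x ^ 2 + 2 * ε * (excess f h q x * ⟪w, x⟫) + ε ^ 2 * ⟪w, x⟫ ^ 2
        = (excess f h q x + ε * ⟪w, x⟫) ^ 2 := by ring
      rw [h2]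
      unfold excess
      rw [inner_add_left, inner_smul_left, RCLike.conj_to_real]
      rcases max_cases (h + (⟪q, x⟫ + ε * ⟪w, x⟫) - f x) 0 with ⟨e1, _⟩ | ⟨e1, _⟩ <;>
      rcases max_cases (h + ⟪q, x⟫ - f x) 0 with ⟨e2, _⟩ | ⟨e2, _⟩ <;> rw [e1, e2] <;> nlinarith
    have e1 := integral_add (i1.add (i2.const_mul (2 * ε))) (i3.const_mul (ε ^ 2))
    have e2 := integral_add i1 (i2.const_mul (2 * ε))
    simp only [Pi.add_apply, integral_const_mul] at e1 e2
    rw [e1, e2] at h1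
    have h3 := minPotential_le S f h (q + ε • w)
    rw [← hq, potential] at h3
    linarith
  by_contra hB
  rcases hC.eq_or_lt with hC | hC
  · have := key (-B)
    rw [← hC] at this
    nlinarith [sq_pos_of_ne_zero hB]
  · have := key (-B / C)
    have h4 : 2 * (-B / C) * B + (-B / C) ^ 2 * C = -(B ^ 2 / C) := by
      field_simp
      ring
    rw [h4] at this
    have : 0 < B ^ 2 / C := by positivity
    linarith

open scoped Pointwise in
lemma setIntegral_homothety_le {S : Set (E n)} (hS : IsCompact S) (hconv : Convex ℝ S)
    {g : E n → ℝ} (hg : ContinuousOn g S) (hg0 : ∀ x ∈ S, 0 ≤ g x) {y : E n} (hy : y ∈ S) {η : ℝ}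
    (hη : 0 < η) (hη1 : η ≤ 1) :
    η ^ n * ∫ x in S, g (η • x + (1 - η) • y) ≤ ∫ x in S, g x := by
  set z := (1 - η) • y
  have h1 : ∫ x in S, g (η • x + z) = (η ^ n)⁻¹ * ∫ x in (fun x => x + z) '' (η • S), g x := by
    have := Measure.setIntegral_comp_smul_of_pos (volume : Measure (E n)) (fun x => g (x + z)) S hη
    rw [this, finrank_euclideanSpace_fin, smul_eq_mul]
    congr 1
    have e := (measurePreserving_add_right (volume : Measure (E n)) z).setIntegral_image_emb
      (MeasurableEquiv.addRight z).measurableEmbedding g (η • S)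
    exact e.symm
  have hsub : (fun x => x + z) '' (η • S) ⊆ S := by
    rintro _ ⟨_, ⟨x, hx, rfl⟩, rfl⟩
    exact hconv hx hy hη.le (by linarith) (by ring)
  rw [h1, ← mul_assoc, mul_inv_cancel₀ (by positivity), one_mul]
  refine setIntegral_mono_set (hg.integrableOn_compact hS) ?_ (LE.le.eventuallyLE hsub)
  filter_upwards [ae_restrict_mem hS.measurableSet] with x hx using hg0 x hx

lemma minPotential_mul_ge {S : Set (E n)} (hS : IsCompact S) (hconv : Convex ℝ S)
    (h0 : (0 : E n) ∈ interior S) {f : E n → ℝ} (hf : ContinuousOn f S) (hfc : ConvexOn ℝ S f)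
    (hf0 : f 0 ≤ 0) (h : ℝ) {η : ℝ} (hη : 0 < η) (hη1 : η ≤ 1) :
    η ^ (n + 2) * minPotential S f h ≤ minPotential S f (η * h) := by
  have h0S : (0 : E n) ∈ S := interior_subset h0
  refine le_ciInf fun q => ?_
  calc η ^ (n + 2) * minPotential S f h ≤ η ^ (n + 2) * potential S f h q := by
        gcongr
        exact minPotential_le S f h q
    _ = η ^ n * ∫ x in S, (η * excess f h q x) ^ 2 := by
        rw [potential, ← integral_const_mul, ← integral_const_mul]
        congr 1
        ext x
        ring
    _ ≤ η ^ n * ∫ x in S, excess f (η * h) q (η • x + (1 - η) • 0) ^ 2 := by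
        refine mul_le_mul_of_nonneg_left ?_ (by positivity)
        have hm : MapsTo (fun x : E n => η • x + (1 - η) • (0 : E n)) S S := fun x hx =>
          hconv hx h0S hη.le (by linarith) (by ring)
        have i1 : IntegrableOn (fun x => (η * excess f h q x) ^ 2) S :=
          ((continuousOn_const.mul (continuousOn_excess hf h q)).pow 2).integrableOn_compact hS
        have i2 : IntegrableOn (fun x => excess f (η * h) q (η • x + (1 - η) • 0) ^ 2) S :=
          (((continuousOn_excess hf (η * h) q).comp (by fun_prop) hm).pow 2).integrableOn_compact hS
        refine setIntegral_mono_on i1 i2 hS.measurableSet fun x hx => ?_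
        refine pow_le_pow_left₀ (mul_nonneg hη.le (excess_nonneg ..)) ?_ 2
        unfold excess
        rw [mul_max_of_nonneg _ _ hη.le, mul_zero]
        refine max_le_max ?_ le_rfl
        have := hfc.2 hx h0S hη.le (sub_nonneg.2 hη1) (by ring)
        simp only [smul_eq_mul] at this
        rw [inner_add_right, inner_smul_right, smul_zero, inner_zero_right]
        rw [smul_zero] at this
        nlinarith
    _ ≤ potential S f (η * h) q :=
        setIntegral_homothety_le hS hconv ((continuousOn_excess hf _ q).pow 2)
          (fun _ _ => sq_nonneg _) h0S hη hη1

/-- The set where the affine function `h + ⟪q, x⟫` lies above `f`. -/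
def contactSet (S : Set (E n)) (f : E n → ℝ) (h : ℝ) (q : E n) : Set (E n) :=
  {x ∈ S | 0 ≤ h + ⟪q, x⟫ - f x}

/-- The balancing constant. -/
def balC (n : ℕ) : ℝ := 1 / (2 ^ (n + 2) + 2)

lemma balC_pos (n : ℕ) : 0 < balC n := by unfold balC; positivity

lemma balC_lt_one (n : ℕ) : balC n < 1 := by
  unfold balC
  rw [div_lt_one (by positivity)]
  have : (0 : ℝ) < 2 ^ (n + 2) := by positivity
  linarith

lemma concaveOn_gap {S : Set (E n)} {f : E n → ℝ} (hfc : ConvexOn ℝ S f) (h : ℝ) (q : E n) :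
    ConcaveOn ℝ S fun x => h + ⟪q, x⟫ - f x := by
  have : ConcaveOn ℝ S fun x : E n => h + ⟪q, x⟫ :=
    (concaveOn_const h hfc.1).add ((innerSL ℝ q).toLinearMap.concaveOn hfc.1)
  exact this.sub hfc

lemma convex_contactSet {S : Set (E n)} {f : E n → ℝ} (hfc : ConvexOn ℝ S f) (h : ℝ) (q : E n) :
    Convex ℝ (contactSet S f h q) := (concaveOn_gap hfc h q).convex_ge 0

lemma isCompact_contactSet {S : Set (E n)} (hS : IsCompact S) {f : E n → ℝ}
    (hf : ContinuousOn f S) (h : ℝ) (q : E n) : IsCompact (contactSet S f h q) := by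
  have hc : ContinuousOn (fun x : E n => h + ⟪q, x⟫ - f x) S := by fun_prop
  exact hS.of_isClosed_subset (hc.preimage_isClosed_of_isClosed hS.isClosed isClosed_Ici)
    (inter_subset_left)

lemma neg_balC_smul_mem_contactSet {S : Set (E n)} (hS : IsCompact S)
    (h0 : (0 : E n) ∈ interior S) {f : E n → ℝ} (hf : ContinuousOn f S) (hfc : ConvexOn ℝ S f)
    {h : ℝ} (hh : f 0 < h) {q : E n} (hq : potential S f h q = minPotential S f h)
    {y : E n} (hy : y ∈ contactSet S f h q) : (-balC n) • y ∈ contactSet S f h q := by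
  by_contra hny
  set K := contactSet S f h q with hK
  have h0S : (0 : E n) ∈ S := interior_subset h0
  have h0K : (0 : E n) ∈ K := ⟨h0S, by rw [inner_zero_right]; linarith⟩
  obtain ⟨g, u, hgu, hug⟩ := geometric_hahn_banach_closed_point (convex_contactSet hfc h q)
    (isCompact_contactSet hS hf h q).isClosed hny
  have hu : 0 < u := by simpa using hgu 0 h0K
  obtain ⟨w, hw⟩ : ∃ w : E n, ∀ x, ⟪w, x⟫ = g x / u := by
    refine ⟨(InnerProductSpace.toDual ℝ (E n)).symm (u⁻¹ • g), fun x => ?_⟩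
    rw [InnerProductSpace.toDual_symm_apply]
    simp [div_eq_inv_mul]
  have hw1 : ∀ x ∈ K, ⟪w, x⟫ < 1 := fun x hx => by
    rw [hw, div_lt_one hu]; exact hgu x hx
  have hwy : ⟪w, y⟫ < -(2 ^ (n + 2) + 2) := by
    have h1 : 1 < ⟪w, (-balC n) • y⟫ := by rw [hw, one_lt_div hu]; exact hug
    rw [inner_smul_right] at h1
    have h2 : balC n * (2 ^ (n + 2) + 2) = 1 := by
      unfold balC; field_simp
    by_contra! h3
    have := mul_le_mul_of_nonneg_left h3 (balC_pos n).le
    nlinarith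
  have hz := integral_excess_mul_inner_eq_zero hS hf hq w
  have hce := continuousOn_excess hf h q
  have hcp : ContinuousOn (fun x => excess f h q x * max ⟪w, x⟫ 0) S :=
    hce.mul (by fun_prop)
  have hcm : ContinuousOn (fun x => excess f h q x * max (-⟪w, x⟫) 0) S :=
    hce.mul (by fun_prop)
  have hip : IntegrableOn (fun x => excess f h q x * max ⟪w, x⟫ 0) S :=
    hcp.integrableOn_compact hS
  have him : IntegrableOn (fun x => excess f h q x * max (-⟪w, x⟫) 0) S :=
    hcm.integrableOn_compact hS
  have hie : IntegrableOn (excess f h q) S := hce.integrableOn_compact hS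
  have hsplit : ∫ x in S, excess f h q x * max ⟪w, x⟫ 0 =
      ∫ x in S, excess f h q x * max (-⟪w, x⟫) 0 := by
    rw [← sub_eq_zero, ← integral_sub hip him]
    refine Eq.trans (congrArg _ ?_) hz
    ext x
    rcases le_total 0 ⟪w, x⟫ with h1 | h1
    · rw [max_eq_left h1, max_eq_right (by linarith)]; ring
    · rw [max_eq_right h1, max_eq_left (by linarith)]; ring
  have hmemK : ∀ x ∈ S, 0 < excess f h q x → x ∈ K := fun x hx hpos => by
    refine ⟨hx, ?_⟩
    rcases lt_max_iff.1 hpos with h1 | h1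
    · exact h1.le
    · exact absurd h1 (lt_irrefl _)
  have hupper : ∫ x in S, excess f h q x * max ⟪w, x⟫ 0 ≤ ∫ x in S, excess f h q x := by
    refine setIntegral_mono_on hip hie hS.measurableSet fun x hx => ?_
    rcases (excess_nonneg f h q x).eq_or_lt with h1 | h1
    · rw [← h1, zero_mul]
    · exact mul_le_of_le_one_right h1.le (max_le (hw1 x (hmemK x hx h1)).le zero_le_one)
  have hm : MapsTo (fun x : E n => (1 / 2 : ℝ) • x + (1 - 1 / 2 : ℝ) • y) S S := fun x hx =>
    hfc.1 hx hy.1 (by norm_num) (by norm_num) (by norm_num)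
  have hi2 : IntegrableOn (fun x : E n => excess f h q ((1 / 2 : ℝ) • x + (1 - 1 / 2 : ℝ) • y) *
      max (-⟪w, (1 / 2 : ℝ) • x + (1 - 1 / 2 : ℝ) • y⟫) 0) S :=
    (hcm.comp (by fun_prop) hm).integrableOn_compact hS
  have hlower : (1 / 2 : ℝ) ^ n * ((2 ^ (n + 2) + 1) / 4 * ∫ x in S, excess f h q x)
      ≤ ∫ x in S, excess f h q x * max (-⟪w, x⟫) 0 := by
    refine le_trans (mul_le_mul_of_nonneg_left ?_ (by positivity))
      (setIntegral_homothety_le hS hfc.1 hcm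
        (fun x _ => mul_nonneg (excess_nonneg ..) (le_max_right _ _)) hy.1
        (η := 1 / 2) (by norm_num) (by norm_num))
    rw [← integral_const_mul]
    refine setIntegral_mono_on (hie.const_mul _) hi2 hS.measurableSet fun x hx => ?_
    rcases (excess_nonneg f h q x).eq_or_lt with h1 | h1
    · rw [← h1, mul_zero]
      exact mul_nonneg (excess_nonneg ..) (le_max_right _ _)
    · have hxK := hmemK x hx h1
      have h2 : excess f h q x / 2 ≤ excess f h q ((1 / 2 : ℝ) • x + (1 - 1 / 2 : ℝ) • y) := by
        refine le_trans ?_ (le_excess ..)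
        have h3 := (concaveOn_gap hfc h q).2 hx hy.1 (by norm_num : (0 : ℝ) ≤ 1 / 2)
          (by norm_num : (0 : ℝ) ≤ 1 - 1 / 2) (by norm_num)
        have h4 : excess f h q x = h + ⟪q, x⟫ - f x := max_eq_left hxK.2
        have h5 := hy.2
        simp only [smul_eq_mul] at h3
        rw [h4]
        linarith
      have h3 : (2 ^ (n + 2) + 1) / 2 ≤ max (-⟪w, (1 / 2 : ℝ) • x + (1 - 1 / 2 : ℝ) • y⟫) 0 := by
        refine le_trans ?_ (le_max_left _ _)
        rw [inner_add_right, inner_smul_right, inner_smul_right]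
        have := hw1 x hxK
        linarith
      calc (2 ^ (n + 2) + 1) / 4 * excess f h q x
          = excess f h q x / 2 * ((2 ^ (n + 2) + 1) / 2) := by ring
        _ ≤ _ := mul_le_mul h2 h3 (by positivity) (excess_nonneg ..)
  have hI : 0 < ∫ x in S, excess f h q x :=
     setIntegral_pos_of_continuousOn hS h0 hce (excess_nonneg f h q)
      (lt_of_lt_of_le (by simpa using hh) (le_excess ..))
  have : (1 / 2 : ℝ) ^ n * ((2 ^ (n + 2) + 1) / 4) > 1 := by
    rw [one_div, inv_pow, pow_add]
    have : (0 : ℝ) < 2 ^ n := by positivity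
    field_simp
    linarith
  nlinarith

lemma gap_le_of_mem_contactSet {S : Set (E n)} (hS : IsCompact S)
    (h0 : (0 : E n) ∈ interior S) {f : E n → ℝ} (hf : ContinuousOn f S) (hfc : ConvexOn ℝ S f)
    {h : ℝ} (hh : f 0 < h) {q : E n} (hq : potential S f h q = minPotential S f h)
    {x : E n} (hx : x ∈ contactSet S f h q) :
    h + ⟪q, x⟫ - f x ≤ (1 + balC n) / balC n * (h - f 0) := by
  have hc := balC_pos n
  obtain ⟨hyS, hy0⟩ := neg_balC_smul_mem_contactSet hS h0 hf hfc hh hq hx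
  have h1 := (concaveOn_gap hfc h q).2 hx.1 hyS
    (by positivity : 0 ≤ balC n / (1 + balC n)) (by positivity : 0 ≤ 1 / (1 + balC n))
    (by field_simp; ring)
  have h2 : (balC n / (1 + balC n)) • x + (1 / (1 + balC n)) • (-balC n) • x = 0 := by
    rw [smul_smul, ← add_smul]
    have : balC n / (1 + balC n) + 1 / (1 + balC n) * -balC n = 0 := by ring
    rw [this, zero_smul]
  simp only [smul_eq_mul, h2, inner_zero_right] at h1
  have h3 : balC n / (1 + balC n) * (h + ⟪q, x⟫ - f x) ≤ h - f 0 := by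
    have := mul_nonneg (by positivity : 0 ≤ 1 / (1 + balC n)) hy0
    linarith
  rw [div_mul_eq_mul_div, le_div_iff₀ hc]
  rw [div_mul_eq_mul_div, div_le_iff₀ (by positivity)] at h3
  linarith

/-- The matrix whose columns are the given vectors. -/
def colMatrix (b : Fin n → E n) : Matrix (Fin n) (Fin n) ℝ := Matrix.of fun i j => b j i

/-- The coordinate functionals with respect to the vectors `b`. -/
def dualCoord (b : Fin n → E n) (k : Fin n) : E n →L[ℝ] ℝ :=
  LinearMap.toContinuousLinearMap
    ((LinearMap.proj k) ∘ₗ (Matrix.toLin' (colMatrix b)⁻¹) ∘ₗ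
      (WithLp.linearEquiv 2 ℝ _).toLinearMap)

lemma dualCoord_apply (b : Fin n → E n) (k : Fin n) (x : E n) :
    dualCoord b k x = ((colMatrix b)⁻¹.mulVec x.ofLp) k := rfl

lemma coordMatrix_dualCoord (b : Fin n → E n) : coordMatrix (dualCoord b) = (colMatrix b)⁻¹ := by
  ext i j
  simp [coordMatrix, dualCoord_apply]

lemma sum_smul_ofLp (b : Fin n → E n) (a : Fin n → ℝ) :
    (∑ i, a i • b i).ofLp = (colMatrix b).mulVec a := by
  ext j
  simp [colMatrix, Matrix.mulVec, dotProduct, mul_comm]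

lemma sum_dualCoord_smul {b : Fin n → E n} (hb : (colMatrix b).det ≠ 0) (x : E n) :
    ∑ i, dualCoord b i x • b i = x := by
  apply (WithLp.ofLp_injective 2)
  rw [sum_smul_ofLp]
  have : (fun i => dualCoord b i x) = (colMatrix b)⁻¹.mulVec x.ofLp := rfl
  rw [this, Matrix.mulVec_mulVec, Matrix.mul_nonsing_inv _ (Ne.isUnit hb), Matrix.one_mulVec]

lemma det_coordMatrix_dualCoord (b : Fin n → E n) :
    (coordMatrix (dualCoord b)).det ^ 2 = (|(colMatrix b).det| ^ 2)⁻¹ := by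
  rw [coordMatrix_dualCoord, Matrix.det_nonsing_inv, Ring.inverse_eq_inv', sq_abs, inv_pow]

lemma volume_dualCoord_box {b : Fin n → E n} (hb : (colMatrix b).det ≠ 0) {r : Fin n → ℝ}
    (hr : ∀ i, 0 ≤ r i) :
    volume.real {x : E n | ∀ i, |dualCoord b i x| ≤ r i} = |(colMatrix b).det| * ∏ i, 2 * r i := by
  have h1 : {x : E n | ∀ i, |dualCoord b i x| ≤ r i} =
      WithLp.ofLp ⁻¹' (Matrix.toLin' (colMatrix b) '' Icc (-r) r) := by
    ext x
    simp only [mem_ofPred_eq, mem_preimage, mem_image, mem_Icc, Pi.le_def, Pi.neg_apply]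
    constructor
    · intro hx
      refine ⟨fun i => dualCoord b i x,
        ⟨fun i => (abs_le.1 (hx i)).1, fun i => (abs_le.1 (hx i)).2⟩, ?_⟩
      rw [Matrix.toLin'_apply, ← sum_smul_ofLp, sum_dualCoord_smul hb]
    · rintro ⟨a, ⟨h1, h2⟩, h3⟩ i
      rw [Matrix.toLin'_apply] at h3
      rw [dualCoord_apply, ← h3, Matrix.mulVec_mulVec, Matrix.nonsing_inv_mul _ (Ne.isUnit hb),
        Matrix.one_mulVec]
      exact abs_le.2 ⟨h1 i, h2 i⟩
  have h2 : MeasurableSet (Matrix.toLin' (colMatrix b) '' Icc (-r) r) :=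
    (isCompact_Icc.image (LinearMap.continuous_of_finiteDimensional _)).measurableSet
  rw [h1, Measure.real, (PiLp.volume_preserving_ofLp (Fin n)).measure_preimage h2.nullMeasurableSet,
    Measure.addHaar_image_linearMap, LinearMap.det_toLin', ENNReal.toReal_mul,
    ENNReal.toReal_ofReal (abs_nonneg _), Real.volume_Icc_pi_toReal (fun i => by
      simpa using (hr i))]
  congr 1
  exact Finset.prod_congr rfl fun i _ => by simp; ring

lemma exists_maximal_frame {K : Fin n → Set (E n)} (hK : ∀ i, IsCompact (K i))
    (hne : ∃ b : Fin n → E n, (∀ i, b i ∈ K i) ∧ (colMatrix b).det ≠ 0) :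
    ∃ b : Fin n → E n, (∀ i, b i ∈ K i) ∧ (colMatrix b).det ≠ 0 ∧
      ∀ i, ∀ y ∈ K i, |dualCoord b i y| ≤ 1 := by
  obtain ⟨b₀, hb₀, hdet₀⟩ := hne
  have hcont : Continuous fun b : Fin n → E n => |(colMatrix b).det| := by
    unfold colMatrix
    refine (Continuous.matrix_det ?_).abs
    refine continuous_matrix fun i j => ?_
    simp only [Matrix.of_apply]
    fun_prop
  obtain ⟨b, hb, hmax⟩ := (isCompact_univ_pi hK).exists_isMaxOn ⟨b₀, fun i _ => hb₀ i⟩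
    hcont.continuousOn
  have hdet : 0 < |(colMatrix b).det| :=
    lt_of_lt_of_le (abs_pos.2 hdet₀) (hmax (fun i _ => hb₀ i))
  refine ⟨b, fun i => hb i (mem_univ i), abs_pos.1 hdet, fun i y hy => ?_⟩
  have hupd : Function.update b i y ∈ univ.pi K := fun j _ => by
    rcases eq_or_ne j i with rfl | hji
    · simpa using hy
    · simpa [hji] using hb j (mem_univ j)
  have h1 : |(colMatrix (Function.update b i y)).det| ≤ |(colMatrix b).det| := hmax hupd
  have h2 : colMatrix (Function.update b i y) = (colMatrix b).updateCol i y.ofLp := by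
    ext k l
    rcases eq_or_ne l i with rfl | hli
    · simp [colMatrix]
    · simp [colMatrix, hli]
  have h3 : (colMatrix (Function.update b i y)).det = (colMatrix b).det * dualCoord b i y := by
    rw [h2, ← Matrix.cramer_apply, dualCoord_apply, Matrix.inv_def,
      Matrix.cramer_eq_adjugate_mulVec,
      Matrix.smul_mulVec, Pi.smul_apply, smul_eq_mul, Ring.inverse_eq_inv',
      mul_inv_cancel_left₀ (abs_pos.1 hdet)]
  rw [h3, abs_mul] at h1
  exact le_of_mul_le_mul_left (by linarith) hdet

lemma contactSet_mem_nhds_zero {S : Set (E n)} (h0 : (0 : E n) ∈ interior S) {f : E n → ℝ}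
    (hf : ContinuousOn f S) {h : ℝ} (hh : f 0 < h) (q : E n) :
    contactSet S f h q ∈ nhds (0 : E n) := by
  have hS := mem_interior_iff_mem_nhds.1 h0
  have hc : ContinuousOn (fun x : E n => h + ⟪q, x⟫ - f x) S := by fun_prop
  filter_upwards [hS, (hc.continuousAt hS).eventually (lt_mem_nhds
    (show (0 : ℝ) < h + ⟪q, (0 : E n)⟫ - f 0 by rw [inner_zero_right]; linarith))] with x h1 h2
  exact ⟨h1, h2.le⟩

lemma exists_single_mem_of_mem_nhds {K : Set (E n)} (hK : K ∈ nhds (0 : E n)) :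
    ∃ ρ : ℝ, 0 < ρ ∧ ∀ i : Fin n, EuclideanSpace.single i ρ ∈ K := by
  obtain ⟨r, hr, hball⟩ := Metric.mem_nhds_iff.1 hK
  refine ⟨r / 2, by positivity, fun i => hball ?_⟩
  rw [mem_ball_zero_iff, PiLp.norm_single, Real.norm_of_nonneg (by positivity)]
  linarith

lemma colMatrix_single (ρ : ℝ) :
    colMatrix (fun i : Fin n => EuclideanSpace.single i ρ) = Matrix.diagonal fun _ => ρ := by
  ext i j
  simp [colMatrix, Matrix.diagonal_apply]

lemma det_colMatrix_single_ne_zero {ρ : ℝ} (hρ : ρ ≠ 0) :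
    (colMatrix (fun i : Fin n => EuclideanSpace.single i ρ)).det ≠ 0 := by
  rw [colMatrix_single, Matrix.det_diagonal]
  simp [hρ]

lemma det_colMatrix_update_single_ne_zero {ρ : ℝ} (hρ : ρ ≠ 0) {w : E n} {i : Fin n}
    (hw : w i ≠ 0) :
    (colMatrix (Function.update (fun i : Fin n => EuclideanSpace.single i ρ) i w)).det ≠ 0 := by
  have h2 : colMatrix (Function.update (fun i : Fin n => EuclideanSpace.single i ρ) i w) =
      (colMatrix (fun i : Fin n => EuclideanSpace.single i ρ)).updateCol i w.ofLp := by
    ext k l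
    rcases eq_or_ne l i with rfl | hli
    · simp [colMatrix]
    · simp [colMatrix, hli]
  have h3 := congrFun (Matrix.mulVec_cramer
    (colMatrix (fun i : Fin n => EuclideanSpace.single i ρ)) w.ofLp) i
  rw [h2, ← Matrix.cramer_apply]
  intro h4
  have hd := det_colMatrix_single_ne_zero (n := n) hρ
  rw [Pi.smul_apply, smul_eq_mul] at h3
  rw [colMatrix_single, Matrix.mulVec_diagonal, ← colMatrix_single, h4, mul_zero] at h3
  exact mul_ne_zero hd hw h3.symm

lemma sum_smul_mem_of_sum_abs_le {K : Set (E n)} (hK : Convex ℝ K) (h0 : (0 : E n) ∈ K)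
    {b : Fin n → E n} {r : ℝ} (hr : 0 < r) (hb : ∀ i, r • b i ∈ K) (hb' : ∀ i, (-r) • b i ∈ K)
    {w : Fin n → ℝ} (hw : ∑ i, |w i| ≤ r) : ∑ i, w i • b i ∈ K := by
  have h1 : ∑ i, w i • b i = ∑ i, (|w i| / r) • ((SignType.sign (w i) : ℝ) * r) • b i := by
    refine Finset.sum_congr rfl fun i _ => ?_
    rw [smul_smul]
    congr 1
    have := sign_mul_abs (w i)
    field_simp
    linarith
  rw [h1]
  have h2 : ∑ i, |w i| / r ≤ 1 := by
    rw [← Finset.sum_div]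
    exact (div_le_one hr).2 hw
  have hmem : ∀ i, ((SignType.sign (w i) : ℝ) * r) • b i ∈ K := fun i => by
    rcases lt_trichotomy (w i) 0 with h | h | h
    · simpa [sign_neg h] using hb' i
    · simpa [h] using h0
    · simpa [sign_pos h] using hb i
  have h3 := hK.sum_mem (t := Finset.univ)
    (w := fun o : Option (Fin n) => o.elim (1 - ∑ i, |w i| / r) fun i => |w i| / r)
    (z := fun o => o.elim 0 fun i => ((SignType.sign (w i) : ℝ) * r) • b i)
    (by
      rintro (_ | i) _
      · exact sub_nonneg.2 h2
      · exact div_nonneg (abs_nonneg _) hr.le)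
    (by simp [Fintype.sum_option])
    (by
      rintro (_ | i) _
      · exact h0
      · exact hmem i)
  simpa [Fintype.sum_option] using h3

/-- The volume constant comparing the determinant of a frame with the potential. -/
def detC (n : ℕ) : ℝ := 4 * ((n + 1) / balC n) ^ n

lemma detC_pos (n : ℕ) : 0 < detC n := by
  have := balC_pos n
  unfold detC
  positivity

lemma abs_det_mul_sq_le_minPotential {S : Set (E n)} (hS : IsCompact S)
    (h0 : (0 : E n) ∈ interior S) {f : E n → ℝ} (hf : ContinuousOn f S) (hfc : ConvexOn ℝ S f)
    (hf0 : f 0 ≤ 0) {h : ℝ} (hh : 0 < h) {q : E n} (hq : potential S f h q = minPotential S f h)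
    {b : Fin n → E n} (hb : ∀ i, b i ∈ contactSet S f h q) (hdet : (colMatrix b).det ≠ 0) :
    |(colMatrix b).det| * h ^ 2 ≤ detC n * minPotential S f h := by
  have hc := balC_pos n
  have hhf : f 0 < h := by linarith
  set K := contactSet S f h q with hKdef
  have hKc : Convex ℝ K := convex_contactSet hfc h q
  have h0K : (0 : E n) ∈ K := mem_of_mem_nhds (contactSet_mem_nhds_zero h0 hf hhf q)
  set ρ : ℝ := balC n / (2 * (n + 1)) with hρ
  have hρpos : 0 < ρ := by positivity
  set B := {x : E n | ∀ i, |dualCoord b i x| ≤ ρ} with hB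
  have hBK : ∀ x ∈ B, (2 : ℝ) • x ∈ K := by
    intro x hx
    rw [← sum_dualCoord_smul hdet ((2 : ℝ) • x)]
    refine sum_smul_mem_of_sum_abs_le hKc h0K hc (fun i => ?_)
      (fun i => neg_balC_smul_mem_contactSet hS h0 hf hfc hhf hq (hb i)) ?_
    · exact (hKc.starConvex h0K).smul_mem (hb i) hc.le (balC_lt_one n).le
    · calc ∑ i, |dualCoord b i ((2 : ℝ) • x)| ≤ ∑ _i : Fin n, 2 * ρ := by
            refine Finset.sum_le_sum fun i _ => ?_
            rw [map_smul, smul_eq_mul, abs_mul, abs_two]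
            linarith [hx i]
        _ = n * (2 * ρ) := by simp
        _ ≤ balC n := by
            rw [hρ]
            field_simp
            linarith
  have hgap : ∀ x ∈ B, x ∈ S ∧ h / 2 ≤ excess f h q x := by
    intro x hx
    have h2x := hBK x hx
    have hx2 : (1 / 2 : ℝ) • (2 : ℝ) • x + (1 / 2 : ℝ) • (0 : E n) = x := by
      rw [smul_smul, smul_zero]
      norm_num
    have h1 := (concaveOn_gap hfc h q).2 h2x.1 h0K.1 (by norm_num : (0 : ℝ) ≤ 1 / 2)
      (by norm_num : (0 : ℝ) ≤ 1 / 2) (by norm_num)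
    rw [hx2] at h1
    simp only [smul_eq_mul, inner_zero_right] at h1
    refine ⟨?_, le_trans ?_ (le_excess ..)⟩
    · rw [← hx2]
      exact hfc.1 h2x.1 h0K.1 (by norm_num) (by norm_num) (by norm_num)
    · have := h2x.2
      linarith
  have hBS : B ⊆ S := fun x hx => (hgap x hx).1
  have hvol : volume.real B = |(colMatrix b).det| * (balC n / (n + 1)) ^ n := by
    rw [hB, volume_dualCoord_box hdet (fun _ => hρpos.le), Finset.prod_const, Finset.card_univ,
      Fintype.card_fin, hρ]
    congr 2
    field_simp
  have hBclosed : IsClosed B := by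
    have : B = ⋂ i, {x : E n | |dualCoord b i x| ≤ ρ} := by ext x; simp [hB]
    rw [this]
    exact isClosed_iInter fun i => isClosed_le (by fun_prop) continuous_const
  have hfin : volume B ≠ ⊤ := (lt_of_le_of_lt (measure_mono hBS) hS.measure_lt_top).ne
  have hmain : |(colMatrix b).det| * (balC n / (n + 1)) ^ n * (h / 2) ^ 2 ≤ minPotential S f h := by
    rw [← hvol, ← hq]
    calc volume.real B * (h / 2) ^ 2 = ∫ x in B, (h / 2) ^ 2 := by
          rw [setIntegral_const, smul_eq_mul]
      _ ≤ ∫ x in B, excess f h q x ^ 2 :=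
          setIntegral_mono_on (integrableOn_const hfin)
            ((integrableOn_excess_sq hS hf h q).mono_set hBS) hBclosed.measurableSet
            fun x hx => pow_le_pow_left₀ (by positivity) (hgap x hx).2 2
      _ ≤ potential S f h q := setIntegral_mono_set (integrableOn_excess_sq hS hf h q)
          (.of_forall fun _ => sq_nonneg _) (LE.le.eventuallyLE hBS)
  have he : detC n * (|(colMatrix b).det| * (balC n / (n + 1)) ^ n * (h / 2) ^ 2) =
      |(colMatrix b).det| * h ^ 2 := by
    have : ((n + 1) / balC n) ^ n * (balC n / (n + 1)) ^ n = 1 := by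
      rw [← mul_pow]
      have : ((n : ℝ) + 1) / balC n * (balC n / (n + 1)) = 1 := by field_simp
      rw [this, one_pow]
    unfold detC
    linear_combination (|(colMatrix b).det| * h ^ 2) * this
  rw [← he]
  exact mul_le_mul_of_nonneg_left hmain (detC_pos n).le

/-- The constant bounding the gap on a contact set by the height. -/
def gapC (n : ℕ) : ℝ := 2 * (1 + balC n) / balC n

lemma gapC_pos (n : ℕ) : 0 < gapC n := by
  have := balC_pos n
  unfold gapC
  positivity

lemma gap_le {S : Set (E n)} (hS : IsCompact S)
    (h0 : (0 : E n) ∈ interior S) {f : E n → ℝ} (hf : ContinuousOn f S) (hfc : ConvexOn ℝ S f)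
    (hf0 : f 0 ≤ 0) {h : ℝ} (hh : 0 < h) (hfh : -h ≤ f 0) {q : E n}
    (hq : potential S f h q = minPotential S f h)
    {x : E n} (hx : x ∈ S) : h + ⟪q, x⟫ - f x ≤ gapC n * h := by
  have hc := balC_pos n
  by_cases hxK : 0 ≤ h + ⟪q, x⟫ - f x
  · refine (gap_le_of_mem_contactSet hS h0 hf hfc (by linarith) hq ⟨hx, hxK⟩).trans ?_
    calc (1 + balC n) / balC n * (h - f 0) ≤ (1 + balC n) / balC n * (2 * h) := by
          gcongr; linarith
      _ = gapC n * h := by unfold gapC; ring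
  · exact (not_le.1 hxK).le.trans (mul_nonneg (gapC_pos n).le hh.le)

/-- The squared size of the coordinates on the domain of the lower barrier. -/
def centerR (n : ℕ) (d : ℝ) : ℝ := (n + 1) * (4 * d * (gapC n + 1) + 2) ^ 2

/-- The depth of the lower barrier. -/
def centerDepth (n : ℕ) (d : ℝ) : ℝ := gapC n + 4 * d * (gapC n + 1)

/-- The constant bounding the time left in terms of the potential. -/
def centerC (n : ℕ) (d p lam : ℝ) : ℝ :=
  (centerDepth n d + 1) / lam * centerR n d ^ (n * p) * detC n ^ (2 * p)

namespace NormalizedSolution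

variable {lam Lam p d : ℝ} {S : Set (E n)} {T h₀ : ℝ} {v : E n → ℝ → ℝ}

lemma continuousOn_slice (H : NormalizedSolution lam Lam p d S T h₀ v) {t : ℝ}
    (ht : t ∈ Icc (-T) 0) : ContinuousOn (fun x => v x t) S :=
  ContinuousOn.comp (g := fun z : E n × ℝ => v z.1 z.2) (f := fun x => (x, t)) H.cont
    (by fun_prop) fun _ hx => ⟨hx, ht⟩

lemma zero_mem' (H : NormalizedSolution lam Lam p d S T h₀ v) : (0 : E n) ∈ S :=
  interior_subset H.zero_mem

lemma le_final (H : NormalizedSolution lam Lam p d S T h₀ v) {x : E n} (hx : x ∈ S) {t : ℝ}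
    (ht : t ∈ Icc (-T) 0) : v x t ≤ v x 0 :=
  H.mono x hx t ht 0 (right_mem_Icc.2 (by linarith [H.T_pos])) ht.2

lemma at_zero_nonpos (H : NormalizedSolution lam Lam p d S T h₀ v) {t : ℝ}
    (ht : t ∈ Icc (-T) 0) : v 0 t ≤ 0 := by
  rw [← H.zero]
  exact H.le_final H.zero_mem' ht

lemma center_barrier (H : NormalizedSolution lam Lam p d S T h₀ v) (hd : 1 ≤ d) {t : ℝ}
    (hT : -T ≤ t) (ht : t < 0)
    (hbd : ∀ x ∈ S, x ∉ interior S → ∀ s ∈ Icc t 0, h₀ / 2 ≤ v x s) {h : ℝ} (hh : 0 < h)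
    (hsmall : 2 * (gapC n + 1) * h ≤ h₀) (hvt : -h ≤ v 0 t) {q : E n}
    (hq : potential S (fun x => v x t) h q = minPotential S (fun x => v x t) h)
    {b : Fin n → E n}
    (hb1 : ∀ i, ∀ y ∈ contactSet S (fun x => v x t) h q, |dualCoord b i y| ≤ 1) :
    lam * ((∏ _i : Fin n, 2 * (h / (2 * centerR n d))) *
      (coordMatrix (dualCoord b)).det ^ 2) ^ p ≤ (centerDepth n d + 1) * h / (-t) := by
  by_contra! hlt
  have hg := gapC_pos n
  have htI : t ∈ Icc (-T) 0 := ⟨hT, ht.le⟩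
  have hf := H.continuousOn_slice htI
  have hfc := H.convexOn t htI
  have hf0 : v 0 t ≤ 0 := H.at_zero_nonpos htI
  set R := centerR n d with hR
  set μ : ℝ := 4 * d * (gapC n + 1) + 1 with hμ
  have hμpos : 0 < μ := by positivity
  have hRμ : R = (n + 1) * (μ + 1) ^ 2 := by rw [hR, centerR, hμ]; ring
  have hRpos : 0 < R := by rw [hRμ]; positivity
  set θ : ℝ := 2 * (gapC n + 1) * h / h₀ with hθ
  have hθ0 : 0 ≤ θ := div_nonneg (by positivity) H.h₀_pos.le
  have hθ1 : θ ≤ 1 := (div_le_one H.h₀_pos).2 hsmall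
  have hθh : θ * h₀ = 2 * (gapC n + 1) * h := by
    rw [hθ, div_mul_cancel₀ _ H.h₀_pos.ne']
  have hlow : ∀ x ∈ S, -(gapC n * h) ≤ v x t - ⟪q, x⟫ := fun x hx => by
    have := gap_le H.compact H.zero_mem hf hfc hf0 hh hvt hq hx
    linarith
  have hqle : ∀ x ∈ S, ⟪q, x⟫ ≤ 2 * h₀ := fun x hx => by
    have h1 := hlow x hx
    have h2 := (H.le_final hx htI).trans (H.le_height x hx)
    nlinarith
  have hqge : ∀ x ∈ S, -(2 * d * h₀) ≤ ⟪q, x⟫ := fun x hx => by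
    have h1 := hqle _ (H.balanced x hx)
    rw [inner_smul_right] at h1
    have h2 : -(1 / d) * ⟪q, x⟫ * d = -⟪q, x⟫ := by field_simp
    nlinarith
  have hθq : ∀ x ∈ S, -(4 * d * (gapC n + 1) * h) ≤ θ * ⟪q, x⟫ := fun x hx => by
    have h1 := mul_le_mul_of_nonneg_left (hqge x hx) hθ0
    have h2 : θ * -(2 * d * h₀) = -(4 * d * (gapC n + 1) * h) := by
      linear_combination (-2 * d) * hθh
    linarith
  set c := dualCoord b with hc
  set N := {x ∈ S | ∑ i, c i x ^ 2 ≤ R} with hN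
  have hNS : N ⊆ S := fun x hx => hx.1
  have hcc : Continuous fun x : E n => ∑ i, c i x ^ 2 := by fun_prop
  have hNc : IsCompact N := H.compact.inter_right (isClosed_le hcc continuous_const)
  set κ := (centerDepth n d + 1) * h / (-t) with hκ
  have hκt : κ * (0 - t) = (centerDepth n d + 1) * h := by
    rw [hκ]; field_simp [ht.ne]; ring
  have hκ0 : 0 ≤ κ := by
    have : 0 < centerDepth n d := by unfold centerDepth; positivity
    exact div_nonneg (by positivity) (by linarith)
  have hbar : ∀ x s, barrier (h * (-centerDepth n d - 1 / 2)) ((1 - θ) • q)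
      (fun _ => h / (2 * R)) c (fun _ => 0) κ t x s = h * (-centerDepth n d - 1 / 2) +
        (1 - θ) * ⟪q, x⟫ + h / (2 * R) * ∑ i, c i x ^ 2 + κ * (s - t) := fun x s => by
    simp [barrier, inner_smul_left, Finset.mul_sum]
  have hquad : ∀ x ∈ N, h / (2 * R) * ∑ i, c i x ^ 2 ≤ h / 2 := fun x hx => by
    calc h / (2 * R) * ∑ i, c i x ^ 2 ≤ h / (2 * R) * R := by gcongr; exact hx.2
      _ = h / 2 := by field_simp
  have key := H.lower N hNc hNS t 0 hT ht.le le_rfl (h * (-centerDepth n d - 1 / 2))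
    ((1 - θ) • q) (fun _ => h / (2 * R)) c (fun _ => 0) κ t (fun _ => by positivity) hlt
    ?_ ?_ 0 ⟨H.zero_mem', by simpa using hRpos.le⟩
  · rw [hbar, hκt, H.zero] at key
    simp only [inner_zero_right, map_zero] at key
    norm_num at key
    nlinarith
  · intro x hx
    rw [hbar, sub_self, mul_zero]
    have h1 := hlow x hx.1
    have h2 := hθq x hx.1
    have h3 := hquad x hx
    unfold centerDepth
    linarith
  · intro x hx hxint s hs
    rw [hbar]
    have hsI : s ∈ Icc (-T) 0 := ⟨hT.trans hs.1, hs.2⟩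
    have h3 := hquad x hx
    have h4 : κ * (s - t) ≤ (centerDepth n d + 1) * h := by
      rw [← hκt]
      gcongr
      exact hs.2
    have hts : v x t ≤ v x s := H.mono x hx.1 t htI s hsI hs.1
    suffices h ≤ v x s - (1 - θ) * ⟪q, x⟫ by linarith
    have h1 := hlow x hx.1
    by_cases hxS : x ∈ interior S
    · have hxR : R ≤ ∑ i, c i x ^ 2 := by
        by_contra! hlt'
        refine hxint (mem_interior.2 ⟨interior S ∩ {x | ∑ i, c i x ^ 2 < R}, ?_, ?_, hxS, hlt'⟩)
        · exact fun y hy => ⟨interior_subset hy.1, (show ∑ i, c i y ^ 2 < R from hy.2).le⟩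
        · exact isOpen_interior.inter (isOpen_lt hcc continuous_const)
      obtain ⟨i, hi⟩ : ∃ i, (μ + 1) ^ 2 < c i x ^ 2 := by
        by_contra! hall
        have h5 := Finset.sum_le_sum fun i (_ : i ∈ Finset.univ) => hall i
        rw [Finset.sum_const, Finset.card_univ, Fintype.card_fin, nsmul_eq_mul] at h5
        rw [hRμ] at hxR
        nlinarith [sq_pos_of_pos (by linarith : 0 < μ + 1)]
      have hi' : μ + 1 < |c i x| := lt_of_pow_lt_pow_left₀ 2 (abs_nonneg _) (by rwa [sq_abs])
      have hfx : μ * h ≤ v x t - ⟪q, x⟫ := by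
        by_contra! hlt'
        have hr : (0 : ℝ) < 1 / (μ + 1) := by positivity
        have hr1 : 1 / (μ + 1) ≤ 1 := (div_le_one (by positivity)).2 (by linarith)
        have h5 := hfc.2 hx.1 H.zero_mem' hr.le (sub_nonneg.2 hr1) (by ring)
        have h6 : (1 / (μ + 1)) • x ∈ S := by
          have := hfc.1 hx.1 H.zero_mem' hr.le (sub_nonneg.2 hr1) (by ring)
          simpa using this
        simp only [smul_zero, add_zero, smul_eq_mul] at h5
        have h7 := hb1 i _ ⟨h6, by
          rw [inner_smul_right]
          have h8 : (1 - 1 / (μ + 1)) * v 0 t ≤ 0 :=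
            mul_nonpos_of_nonneg_of_nonpos (sub_nonneg.2 hr1) hf0
          have h9 : 1 / (μ + 1) * (v x t - ⟪q, x⟫) ≤ 1 / (μ + 1) * (μ * h) := by gcongr
          have h10 : 1 / (μ + 1) * (μ * h) ≤ h := by
            rw [div_mul_eq_mul_div, one_mul, div_le_iff₀ (by positivity)]
            nlinarith
          linarith⟩
        rw [map_smul, smul_eq_mul, abs_mul, abs_of_pos hr, div_mul_eq_mul_div, one_mul,
          div_le_one (by positivity)] at h7
        linarith
      have h5 := hθq x hx.1
      rw [hμ] at hfx
      linarith
    · have h5 := hbd x hx.1 hxS s hs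
      have h6 : θ * (h₀ / 2) ≤ θ * v x s := by gcongr
      have h7 : (1 - θ) * -(gapC n * h) ≤ (1 - θ) * (v x s - ⟪q, x⟫) :=
        mul_le_mul_of_nonneg_left (by linarith) (by linarith)
      have h8 : 0 ≤ θ * (gapC n * h) := by positivity
      linarith

/-- A late time slice with a small value of the potential is close to the final time. -/
lemma neg_time_le (hlam : 0 < lam) (hp : 0 < p) (hd : 1 ≤ d)
    (H : NormalizedSolution lam Lam p d S T h₀ v) {t : ℝ}
    (hT : -T ≤ t) (ht : t < 0)
    (hbd : ∀ x ∈ S, x ∉ interior S → ∀ s ∈ Icc t 0, h₀ / 2 ≤ v x s) {h : ℝ} (hh : 0 < h)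
    (hsmall : 2 * (gapC n + 1) * h ≤ h₀) (hvt : -h ≤ v 0 t) :
    -t ≤ centerC n d p lam * h ^ (1 - n * p) *
      (minPotential S (fun x => v x t) h / h ^ 2) ^ (2 * p) := by
  have htI : t ∈ Icc (-T) 0 := ⟨hT, ht.le⟩
  have hf := H.continuousOn_slice htI
  have hfc := H.convexOn t htI
  have hf0 : v 0 t ≤ 0 := H.at_zero_nonpos htI
  obtain ⟨q, hq⟩ := exists_potential_eq_minPotential H.compact H.zero_mem hf h
  obtain ⟨ρ, hρ, hmem⟩ := exists_single_mem_of_mem_nhds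
    (contactSet_mem_nhds_zero H.zero_mem hf (by linarith : v 0 t < h) q)
  obtain ⟨b, hbK, hdet, hb1⟩ := exists_maximal_frame
    (fun _ : Fin n => isCompact_contactSet H.compact hf h q)
    ⟨_, hmem, det_colMatrix_single_ne_zero hρ.ne'⟩
  have hmain := H.center_barrier hd hT ht hbd hh hsmall hvt hq (fun i => hb1 i)
  have hD := abs_det_mul_sq_le_minPotential H.compact H.zero_mem hf hfc hf0 hh hq hbK hdet
  set W := minPotential S (fun x => v x t) h / h ^ 2 with hW
  set D := |(colMatrix b).det| with hDdef
  have hDpos : 0 < D := abs_pos.2 hdet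
  have hDW : D ≤ detC n * W := by
    rw [hW, mul_div_assoc', le_div_iff₀ (by positivity)]
    exact hD
  have hWpos : 0 < W := pos_of_mul_pos_right (hDpos.trans_le hDW) (detC_pos n).le
  have hg := gapC_pos n
  have hR : 0 < centerR n d := by unfold centerR; positivity
  have hdep : 0 < centerDepth n d := by unfold centerDepth; positivity
  have hdC := detC_pos n
  rw [det_coordMatrix_dualCoord, ← hDdef, Finset.prod_const, Finset.card_univ,
    Fintype.card_fin] at hmain
  have e1 : 2 * (h / (2 * centerR n d)) = h / centerR n d := by field_simp
  have e2 : ((h / centerR n d) ^ n * (D ^ 2)⁻¹) ^ p =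
      h ^ (n * p) / centerR n d ^ (n * p) / D ^ (2 * p) := by
    rw [← div_eq_mul_inv, Real.div_rpow (by positivity) (by positivity), ← Real.rpow_natCast,
      ← Real.rpow_natCast, ← Real.rpow_mul (by positivity), ← Real.rpow_mul (by positivity),
      Real.div_rpow hh.le hR.le]
    norm_num
  rw [e1, e2, le_div_iff₀ (by linarith)] at hmain
  have e3 : h ^ (1 - n * p) = h / h ^ (n * p) := by
    rw [Real.rpow_sub hh, Real.rpow_one]
  have h1 : D ^ (2 * p) ≤ detC n ^ (2 * p) * W ^ (2 * p) := by
    rw [← Real.mul_rpow hdC.le hWpos.le]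
    exact Real.rpow_le_rpow hDpos.le hDW (by positivity)
  have hhp : 0 < h ^ (n * p) := Real.rpow_pos_of_pos hh _
  have hRp : 0 < centerR n d ^ (n * p) := Real.rpow_pos_of_pos hR _
  have hDp : 0 < D ^ (2 * p) := Real.rpow_pos_of_pos hDpos _
  calc -t = lam * (h ^ (n * p) / centerR n d ^ (n * p) / D ^ (2 * p)) * -t *
        (centerR n d ^ (n * p) * D ^ (2 * p) / (lam * h ^ (n * p))) := by field_simp
    _ ≤ (centerDepth n d + 1) * h *
        (centerR n d ^ (n * p) * D ^ (2 * p) / (lam * h ^ (n * p))) := by gcongr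
    _ ≤ (centerDepth n d + 1) * h *
        (centerR n d ^ (n * p) * (detC n ^ (2 * p) * W ^ (2 * p)) / (lam * h ^ (n * p))) := by
        gcongr
    _ = _ := by
        rw [e3, centerC]
        field_simp

end NormalizedSolution

/-- The sum of the values of `w` at the two points at distance `r` from the origin on the line
spanned by `e`. -/
def symSum (w : E n → ℝ) (e : E n) (r : ℝ) : ℝ := w (r • e) + w (-(r • e))

lemma symSum_neg (w : E n → ℝ) (e : E n) (r : ℝ) : symSum w (-e) r = symSum w e r := by
  simp [symSum, add_comm]

lemma smul_dir_mem {S : Set (E n)} (hS : Convex ℝ S) {e : E n} {r₀ : ℝ} (h1 : r₀ • e ∈ S)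
    (h2 : -(r₀ • e) ∈ S) {r : ℝ} (hr : |r| ≤ r₀) : r • e ∈ S := by
  rcases (abs_nonneg r |>.trans hr).eq_or_lt with h0 | h0
  · have : r = 0 := abs_nonpos_iff.1 (h0 ▸ hr)
    rw [this, zero_smul]
    simpa [← h0] using h1
  · have hr' := abs_le.1 hr
    have := hS h1 h2 (a := (r₀ + r) / (2 * r₀)) (b := (r₀ - r) / (2 * r₀))
      (div_nonneg (by linarith) (by linarith)) (div_nonneg (by linarith) (by linarith))
      (by field_simp; ring)
    rw [smul_smul, ← neg_smul, smul_smul, ← add_smul] at this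
    convert this using 2
    field_simp
    ring

lemma leg_mem_contactSet {S : Set (E n)} (hS : IsCompact S)
    (h0 : (0 : E n) ∈ interior S) {f : E n → ℝ} (hf : ContinuousOn f S) (hfc : ConvexOn ℝ S f)
    {h : ℝ} (hh : f 0 < h) (hh0 : 0 ≤ h) {q : E n} (hq : potential S f h q = minPotential S f h)
    {y : E n} (hy : y ∈ S) (hy' : -y ∈ S) (hsum : f y + f (-y) ≤ h) :
    balC n • y ∈ contactSet S f h q ∧ (-balC n) • y ∈ contactSet S f h q := by
  have hK := convex_contactSet hfc h q
  have h0K : (0 : E n) ∈ contactSet S f h q :=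
    mem_of_mem_nhds (contactSet_mem_nhds_zero h0 hf hh q)
  have hstar : ∀ x ∈ contactSet S f h q, balC n • x ∈ contactSet S f h q := fun x hx =>
    (hK.starConvex h0K).smul_mem hx (balC_pos n).le (balC_lt_one n).le
  by_cases h1 : 0 ≤ h + ⟪q, y⟫ - f y
  · exact ⟨hstar y ⟨hy, h1⟩, neg_balC_smul_mem_contactSet hS h0 hf hfc hh hq ⟨hy, h1⟩⟩
  · have h2 : -y ∈ contactSet S f h q := ⟨hy', by rw [inner_neg_right]; linarith⟩
    have h3 := hstar _ h2
    have h4 := neg_balC_smul_mem_contactSet hS h0 hf hfc hh hq h2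
    rw [smul_neg, ← neg_smul] at h3
    rw [smul_neg, neg_smul, neg_neg] at h4
    exact ⟨h4, h3⟩

lemma abs_le_of_smul_mem_contactSet {S : Set (E n)} (hS : IsCompact S)
    (h0 : (0 : E n) ∈ interior S) {f : E n → ℝ} (hf : ContinuousOn f S) (hfc : ConvexOn ℝ S f)
    {h : ℝ} (hh : f 0 < h) {q : E n} (hq : potential S f h q = minPotential S f h)
    {e : E n} {a r₀ : ℝ} (ha : 0 < a) (hr₀ : 0 ≤ r₀)
    (hle : ∀ r ∈ Icc 0 r₀, a * r - symSum f e r ≤ h) (hlong : 3 * h < a * r₀) {ρ : ℝ}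
    (hρ : ρ • e ∈ contactSet S f h q) : |ρ| ≤ 3 * h / (balC n * a) := by
  have hc := balC_pos n
  have hK := convex_contactSet hfc h q
  have h0K : (0 : E n) ∈ contactSet S f h q :=
    mem_of_mem_nhds (contactSet_mem_nhds_zero h0 hf hh q)
  have h1 := neg_balC_smul_mem_contactSet hS h0 hf hfc hh hq hρ
  have h2 := (hK.starConvex h0K).smul_mem hρ hc.le (balC_lt_one n).le
  rw [smul_smul] at h1 h2
  have h3 : (balC n * |ρ|) • e ∈ contactSet S f h q ∧
      -((balC n * |ρ|) • e) ∈ contactSet S f h q := by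
    rcases abs_cases ρ with ⟨h4, _⟩ | ⟨h4, _⟩ <;> rw [h4]
    · exact ⟨h2, by rwa [← neg_smul, ← neg_mul]⟩
    · exact ⟨by rwa [mul_neg, ← neg_mul], by rwa [mul_neg, neg_smul, neg_neg]⟩
  set s := min (balC n * |ρ|) r₀ with hs
  have hs0 : 0 ≤ s := le_min (by positivity) hr₀
  have h4 : s • e ∈ contactSet S f h q ∧ -(s • e) ∈ contactSet S f h q := by
    rcases (by positivity : 0 ≤ balC n * |ρ|).eq_or_lt with h5 | h5
    · have : s = 0 := le_antisymm ((min_le_left _ _).trans h5.ge) hs0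
      simpa [this] using h0K
    · have h6 : s = s / (balC n * |ρ|) * (balC n * |ρ|) := (div_mul_cancel₀ _ h5.ne').symm
      have h7 : s / (balC n * |ρ|) ≤ 1 := (div_le_one h5).2 (min_le_left _ _)
      have h8 : 0 ≤ s / (balC n * |ρ|) := by positivity
      rw [h6, ← smul_smul, ← smul_neg]
      exact ⟨(hK.starConvex h0K).smul_mem h3.1 h8 h7, (hK.starConvex h0K).smul_mem h3.2 h8 h7⟩
  have h5 := hle s ⟨hs0, min_le_right _ _⟩
  have h6 := h4.1.2
  have h7 := h4.2.2
  rw [inner_neg_right] at h7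
  unfold symSum at h5
  have h8 : a * s ≤ 3 * h := by linarith
  rcases min_cases (balC n * |ρ|) r₀ with ⟨h9, _⟩ | ⟨h9, _⟩
  · rw [← hs] at h9
    rw [h9] at h8
    rw [le_div_iff₀ (by positivity)]
    linarith
  · rw [← hs] at h9
    rw [h9] at h8
    linarith

/-- A bound for the coordinates on the contact set in a frame adapted to a given direction. -/
def legB (n : ℕ) : ℝ := 3 * n / balC n ^ 2 + 1

lemma legB_pos (n : ℕ) : 0 < legB n := by
  have := balC_pos n
  unfold legB
  positivity

lemma exists_leg_frame {S : Set (E n)} (hS : IsCompact S)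
    (h0 : (0 : E n) ∈ interior S) {f : E n → ℝ} (hf : ContinuousOn f S) (hfc : ConvexOn ℝ S f)
    (hf0 : f 0 ≤ 0) {h : ℝ} (hh : 0 < h) (hfh : -h ≤ f 0) {q : E n}
    (hq : potential S f h q = minPotential S f h)
    {e : E n} {a r₀ : ℝ} (ha : 0 < a) (hr₀ : 0 ≤ r₀) (he : r₀ • e ∈ S) (he' : -(r₀ • e) ∈ S)
    (hle : ∀ r ∈ Icc 0 r₀, a * r - symSum f e r ≤ h) (hlong : 3 * h < a * r₀)
    (hsum : symSum f e (h / a) ≤ h) {i₀ : Fin n} (hi₀ : e i₀ ≠ 0) :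
    ∃ b : Fin n → E n, b i₀ = (h / a) • e ∧ (colMatrix b).det ≠ 0 ∧
      (∀ i, balC n • b i ∈ contactSet S f h q) ∧ (∀ i, (-balC n) • b i ∈ contactSet S f h q) ∧
      minPotential S f h ≤ (gapC n * h) ^ 2 * (|(colMatrix b).det| * (2 * legB n) ^ n) := by
  have hc := balC_pos n
  have hhf : f 0 < h := by linarith
  have hK := convex_contactSet hfc h q
  have hnhds := contactSet_mem_nhds_zero h0 hf hhf q
  have h0K : (0 : E n) ∈ contactSet S f h q := mem_of_mem_nhds hnhds
  have hstar : ∀ x ∈ contactSet S f h q, balC n • x ∈ contactSet S f h q := fun x hx =>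
    (hK.starConvex h0K).smul_mem hx (balC_pos n).le (balC_lt_one n).le
  have hha : 0 < h / a := by positivity
  have hhar : h / a ≤ r₀ := by rw [div_le_iff₀ ha]; linarith
  have hleg := leg_mem_contactSet hS h0 hf hfc hhf hh.le hq
    (smul_dir_mem hfc.1 he he' (r := h / a) (by rwa [abs_of_pos hha]))
    (by rw [← neg_smul]; exact smul_dir_mem hfc.1 he he' (by rwa [abs_neg, abs_of_pos hha])) hsum
  obtain ⟨ρ, hρ, hmem⟩ := exists_single_mem_of_mem_nhds hnhds
  obtain ⟨b, hbK, hdet, hb1⟩ := exists_maximal_frame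
    (K := Function.update (fun _ : Fin n => contactSet S f h q) i₀ {(h / a) • e})
    (fun i => by
      rcases eq_or_ne i i₀ with rfl | hi
      · simp
      · simpa [hi] using isCompact_contactSet hS hf h q)
    ⟨_, fun i => by
      rcases eq_or_ne i i₀ with rfl | hi
      · simp
      · simpa [hi] using hmem i, det_colMatrix_update_single_ne_zero (i := i₀) hρ.ne'
        (w := (h / a) • e) (by simpa using ⟨⟨hh.ne', ha.ne'⟩, hi₀⟩)⟩
  have hbi : b i₀ = (h / a) • e := by simpa using hbK i₀
  have hbK' : ∀ i, i ≠ i₀ → b i ∈ contactSet S f h q := fun i hi => by simpa [hi] using hbK i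
  have hb1' : ∀ i, i ≠ i₀ → ∀ y ∈ contactSet S f h q, |dualCoord b i y| ≤ 1 := fun i hi y hy =>
    hb1 i y (by simpa [hi] using hy)
  have hbp : ∀ i, balC n • b i ∈ contactSet S f h q := fun i => by
    rcases eq_or_ne i i₀ with rfl | hi
    · rw [hbi]; exact hleg.1
    · exact hstar _ (hbK' i hi)
  have hbm : ∀ i, (-balC n) • b i ∈ contactSet S f h q := fun i => by
    rcases eq_or_ne i i₀ with rfl | hi
    · rw [hbi]; exact hleg.2
    · exact neg_balC_smul_mem_contactSet hS h0 hf hfc hhf hq (hbK' i hi)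
  have hn : (0 : ℝ) < n := by exact_mod_cast i₀.pos
  have hcoord : ∀ y ∈ contactSet S f h q, |dualCoord b i₀ y| ≤ 3 * n / balC n ^ 2 := by
    intro y hy
    have h1 := sum_smul_mem_of_sum_abs_le hK h0K hc (b := Function.update b i₀ y)
      (w := Function.update (fun i => -(balC n / n) * dualCoord b i y) i₀ (balC n / n))
      (fun i => by
        rcases eq_or_ne i i₀ with rfl | hi
        · simpa using hstar y hy
        · simpa [hi] using hbp i)
      (fun i => by
        rcases eq_or_ne i i₀ with rfl | hi
        · simpa using neg_balC_smul_mem_contactSet hS h0 hf hfc hhf hq hy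
        · simpa [hi] using hbm i)
      (by
        calc _ ≤ ∑ _i : Fin n, balC n / n := by
              refine Finset.sum_le_sum fun i _ => ?_
              rcases eq_or_ne i i₀ with rfl | hi
              · rw [Function.update_self, abs_of_pos (by positivity : 0 < balC n / n)]
              · have := hb1' i hi y hy
                simp only [Function.update_of_ne hi]
                rw [abs_mul, abs_neg, abs_of_pos (by positivity : 0 < balC n / n)]
                exact mul_le_of_le_one_right (by positivity) this
          _ = balC n := by simp; field_simp)
    have h2 : ∑ i, Function.update (fun i => -(balC n / n) * dualCoord b i y) i₀ (balC n / n) i •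
        Function.update b i₀ y i = (balC n / n * dualCoord b i₀ y * (h / a)) • e := by
      have h3 : ∀ i, Function.update (fun i => -(balC n / n) * dualCoord b i y) i₀ (balC n / n) i •
          Function.update b i₀ y i = -(balC n / n) • dualCoord b i y • b i +
          (if i = i₀ then (balC n / n) • (y + dualCoord b i₀ y • b i₀) else 0) := fun i => by
        rcases eq_or_ne i i₀ with rfl | hi
        · simp
        · simp [hi, smul_smul]
      rw [Finset.sum_congr rfl fun i _ => h3 i, Finset.sum_add_distrib, ← Finset.smul_sum,
        sum_dualCoord_smul hdet, Finset.sum_ite_eq' Finset.univ i₀]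
      simp only [Finset.mem_univ, if_true, hbi]
      module
    rw [h2] at h1
    have h4 := abs_le_of_smul_mem_contactSet hS h0 hf hfc hhf hq ha hr₀ hle hlong h1
    rw [abs_mul, abs_mul, abs_of_pos hha, abs_of_pos (by positivity : 0 < balC n / n),
      le_div_iff₀ (by positivity)] at h4
    rw [le_div_iff₀ (by positivity)]
    field_simp at h4
    linarith
  refine ⟨b, hbi, hdet, hbp, hbm, ?_⟩
  set B := {x : E n | ∀ i, |dualCoord b i x| ≤ legB n} with hB
  have hKB : contactSet S f h q ⊆ B := fun y hy i => by
    rcases eq_or_ne i i₀ with rfl | hi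
    · exact (hcoord y hy).trans (by unfold legB; linarith)
    · refine (hb1' i hi y hy).trans ?_
      have : 0 ≤ 3 * n / balC n ^ 2 := by positivity
      unfold legB
      linarith
  have hvol : volume.real B = |(colMatrix b).det| * (2 * legB n) ^ n := by
    rw [hB, volume_dualCoord_box hdet (fun _ => (legB_pos n).le), Finset.prod_const,
      Finset.card_univ, Fintype.card_fin]
  have hfin : volume B ≠ ⊤ := by
    intro htop
    rw [Measure.real, htop, ENNReal.toReal_top] at hvol
    have : 0 < |(colMatrix b).det| * (2 * legB n) ^ n :=
      mul_pos (abs_pos.2 hdet) (pow_pos (mul_pos two_pos (legB_pos n)) _)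
    linarith
  rw [← hq, ← hvol, potential]
  have hsplit : ∀ x ∈ S, excess f h q x ^ 2 ≤
      (contactSet S f h q).indicator (fun _ => (gapC n * h) ^ 2) x := by
    intro x hx
    by_cases hxK : x ∈ contactSet S f h q
    · rw [indicator_of_mem hxK]
      refine pow_le_pow_left₀ (excess_nonneg ..) (max_le ?_ ?_) 2
      · exact gap_le hS h0 hf hfc hf0 hh hfh hq hx
      · exact mul_nonneg (gapC_pos n).le hh.le
    · rw [indicator_of_notMem hxK]
      have : h + ⟪q, x⟫ - f x ≤ 0 := by
        by_contra! hlt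
        exact hxK ⟨hx, hlt.le⟩
      simp [excess, max_eq_right this]
  have hKm : MeasurableSet (contactSet S f h q) := (isCompact_contactSet hS hf h q).measurableSet
  have hKfin := (isCompact_contactSet hS hf h q).measure_lt_top (μ := volume)
  have hKS : contactSet S f h q ⊆ S := fun x hx => hx.1
  calc ∫ x in S, excess f h q x ^ 2
      ≤ ∫ x in S, (contactSet S f h q).indicator (fun _ => (gapC n * h) ^ 2) x :=
        setIntegral_mono_on (integrableOn_excess_sq hS hf h q)
          ((integrableOn_const hS.measure_lt_top.ne).indicator hKm) hS.measurableSet hsplit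
    _ = volume.real (contactSet S f h q) * (gapC n * h) ^ 2 := by
        rw [setIntegral_indicator hKm, inter_eq_self_of_subset_right hKS, setIntegral_const,
          smul_eq_mul]
    _ ≤ volume.real B * (gapC n * h) ^ 2 := by
        gcongr
    _ = _ := mul_comm _ _

lemma le_chord_add {φ ψ : ℝ → ℝ} {a h ρ₀ : ℝ} (hρ₀ : 0 < ρ₀)
    (hφ : ConvexOn ℝ (Icc 0 (2 * ρ₀)) φ) (hψ : ConvexOn ℝ (Icc 0 (2 * ρ₀)) ψ) (hh : 0 ≤ h)
    (h1 : ∀ r ∈ Icc 0 (2 * ρ₀), 0 ≤ a * r - (φ r + ψ r)) (h2 : a * ρ₀ - (φ ρ₀ + ψ ρ₀) ≤ h)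
    {ρ : ℝ} (hρ : ρ ∈ Icc 0 (2 * ρ₀)) :
    φ ρ ≤ φ ρ₀ + (φ (2 * ρ₀) - φ ρ₀) / ρ₀ * (ρ - ρ₀) + 2 * h := by
  have m0 : ρ₀ ∈ Icc 0 (2 * ρ₀) := ⟨hρ₀.le, by linarith⟩
  have m2 : 2 * ρ₀ ∈ Icc 0 (2 * ρ₀) := ⟨by linarith, le_rfl⟩
  have e1 : (φ (2 * ρ₀) - φ ρ₀) / ρ₀ * (ρ - ρ₀) = (φ (2 * ρ₀) - φ ρ₀) * ((ρ - ρ₀) / ρ₀) := by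
    ring
  rw [e1]
  rcases le_total ρ ρ₀ with hle | hle
  · set τ := (ρ₀ - ρ) / ρ₀ with hτ
    have hτ0 : 0 ≤ τ := div_nonneg (by linarith) hρ₀.le
    have hτ1 : τ ≤ 1 := (div_le_one hρ₀).2 (by linarith [hρ.1])
    have e2 : (ρ - ρ₀) / ρ₀ = -τ := by rw [hτ]; ring
    have e3 : ρ = ρ₀ - τ * ρ₀ := by rw [hτ]; field_simp; ring
    have h3 := hψ.2 hρ m2 (by positivity : 0 ≤ 1 / (1 + τ))
      (by positivity : 0 ≤ τ / (1 + τ)) (by field_simp)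
    have e4 : (1 / (1 + τ)) • ρ + (τ / (1 + τ)) • (2 * ρ₀) = ρ₀ := by
      rw [e3, smul_eq_mul, smul_eq_mul]; field_simp; ring
    rw [e4, smul_eq_mul, smul_eq_mul] at h3
    have h4 : (1 + τ) * ψ ρ₀ ≤ ψ ρ + τ * ψ (2 * ρ₀) := by
      calc (1 + τ) * ψ ρ₀ ≤ (1 + τ) * (1 / (1 + τ) * ψ ρ + τ / (1 + τ) * ψ (2 * ρ₀)) := by gcongr
        _ = _ := by field_simp
    have h5 := h1 ρ hρ
    have h6 := mul_nonneg hτ0 (h1 _ m2)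
    have h7 : (1 + τ) * (a * ρ₀ - (φ ρ₀ + ψ ρ₀)) ≤ 2 * h := by nlinarith
    rw [e2]
    have e5 : a * ρ = a * ρ₀ - τ * (a * ρ₀) := by linear_combination a * e3
    linarith
  · set τ := (ρ - ρ₀) / ρ₀ with hτ
    have hτ0 : 0 ≤ τ := div_nonneg (by linarith) hρ₀.le
    have hτ1 : τ ≤ 1 := (div_le_one hρ₀).2 (by linarith [hρ.2])
    have h3 := hφ.2 m0 m2 (by linarith : 0 ≤ 1 - τ) hτ0 (by ring)
    have e4 : (1 - τ) • ρ₀ + τ • (2 * ρ₀) = ρ := by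
      rw [hτ, smul_eq_mul, smul_eq_mul]; field_simp; ring
    rw [e4, smul_eq_mul, smul_eq_mul] at h3
    linarith

lemma convexOn_comp_smul {S : Set (E n)} {f : E n → ℝ} (hf : ConvexOn ℝ S f) {e : E n}
    {J : Set ℝ} (hJ : Convex ℝ J) (hmem : ∀ r ∈ J, r • e ∈ S) :
    ConvexOn ℝ J (fun r => f (r • e)) := by
  refine ⟨hJ, fun x hx y hy s t hs ht hst => ?_⟩
  have := hf.2 (hmem x hx) (hmem y hy) hs ht hst
  rw [smul_smul, smul_smul, ← add_smul] at this
  exact this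

lemma convexOn_symSum {S : Set (E n)} {f : E n → ℝ} (hf : ConvexOn ℝ S f) {e : E n} {r₀ : ℝ}
    (he : r₀ • e ∈ S) (he' : -(r₀ • e) ∈ S) : ConvexOn ℝ (Icc 0 r₀) (symSum f e) := by
  have hc : Convex ℝ (Icc 0 r₀) := convex_Icc _ _
  have h1 := convexOn_comp_smul (e := e) hf hc (fun r hr => smul_dir_mem hf.1 he he'
    (by rw [abs_of_nonneg hr.1]; exact hr.2))
  have h2 := convexOn_comp_smul (e := -e) hf hc (fun r hr => smul_dir_mem hf.1 (r₀ := r₀)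
    (by simpa using he') (by simpa using he) (by rw [abs_of_nonneg hr.1]; exact hr.2))
  have h3 : symSum f e = (fun r => f (r • e)) + fun r => f (r • -e) := by
    ext r
    simp [symSum]
  rw [h3]
  exact h1.add h2

/-- The width of the domain of the upper barrier in the directions transversal to the leg. -/
def legW (n : ℕ) : ℝ := balC n / (4 * n)

/-- The constant relating the upper barrier to the potential. -/
def legK (n : ℕ) : ℝ := 48 ^ n * 16 * (gapC n ^ 2 * (2 * legB n) ^ n) ^ 2 / (legW n ^ n) ^ 2

/-- The constant in the bound for the time a long leg needs to disappear. -/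
def legC (n : ℕ) (p Lam : ℝ) : ℝ := 1 / (16 * Lam * legK n ^ p)

/-- On a box around the middle of a long leg a convex function lies below an affine function up to
a multiple of the height. -/
lemma leg_upper_bound {S : Set (E n)} {f : E n → ℝ} (hfc : ConvexOn ℝ S f)
    (hf0 : f 0 ≤ 0) {h : ℝ} (hh : 0 < h) (hfh : -h / 2 ≤ f 0) {q : E n}
    (h0K : (0 : E n) ∈ contactSet S f h q)
    {e : E n} {a r₀ r' : ℝ} (ha : 0 < a) (he : r₀ • e ∈ S) (he' : -(r₀ • e) ∈ S)
    (hr' : 0 < r') (hrr : r' ≤ r₀) (hle : ∀ r ∈ Icc 0 r₀, a * r - symSum f e r ≤ h)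
    (hpos : 0 ≤ a * r' - symSum f e r')
    {i₀ : Fin n} {b : Fin n → E n} (hbi : b i₀ = (h / a) • e) (hdet : (colMatrix b).det ≠ 0)
    (hbp : ∀ i, balC n • b i ∈ contactSet S f h q)
    (hbm : ∀ i, (-balC n) • b i ∈ contactSet S f h q) {y : E n}
    (hy₀ : |dualCoord b i₀ y| ≤ a * r' / (4 * h)) (hy : ∀ i, i ≠ i₀ → |dualCoord b i y| ≤ legW n) :
    (r' / 2) • e + y ∈ S ∧ f ((r' / 2) • e + y) ≤ f ((r' / 2) • e) +
      (f (r' • e) - f ((r' / 2) • e)) / (r' / 2) * (dualCoord b i₀ y * (h / a)) +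
      ⟪q, y - dualCoord b i₀ y • b i₀⟫ + 3 * h := by
  have hK := convex_contactSet hfc h q
  have hn : (0 : ℝ) < n := by exact_mod_cast i₀.pos
  have hJ : ∀ r ∈ Icc 0 r', r • e ∈ S := fun r hr => smul_dir_mem hfc.1 he he'
    (by rw [abs_of_nonneg hr.1]; exact hr.2.trans hrr)
  have hJ' : ∀ r ∈ Icc 0 r', r • -e ∈ S := fun r hr => smul_dir_mem hfc.1 (r₀ := r₀)
    (by simpa using he') (by simpa using he) (by rw [abs_of_nonneg hr.1]; exact hr.2.trans hrr)
  set ρ₀ := r' / 2 with hρ₀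
  have e2 : 2 * ρ₀ = r' := by rw [hρ₀]; ring
  have hφ : ConvexOn ℝ (Icc 0 (2 * ρ₀)) (fun r => f (r • e)) := by
    rw [e2]; exact convexOn_comp_smul hfc (convex_Icc _ _) hJ
  have hψ : ConvexOn ℝ (Icc 0 (2 * ρ₀)) (fun r => f (r • -e)) := by
    rw [e2]; exact convexOn_comp_smul hfc (convex_Icc _ _) hJ'
  have hcv := (convexOn_symSum hfc he he').subset (Icc_subset_Icc_right hrr) (convex_Icc _ _)
  have hc0 : ∀ r ∈ Icc 0 (2 * ρ₀), 0 ≤ a * r - (f (r • e) + f (r • -e)) := by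
    intro r hr
    rw [e2] at hr
    have h1 := hcv.2 (left_mem_Icc.2 hr'.le) (right_mem_Icc.2 hr'.le)
      (sub_nonneg.2 ((div_le_one hr').2 hr.2)) (div_nonneg hr.1 hr'.le) (by ring)
    have e3 : (1 - r / r') • (0 : ℝ) + (r / r') • r' = r := by
      simp only [smul_eq_mul]; field_simp; ring
    have e4 : symSum f e 0 = 2 * f 0 := by simp [symSum]; ring
    rw [e3, smul_eq_mul, smul_eq_mul, e4] at h1
    have h2 : r / r' * symSum f e r' ≤ a * r := by
      calc r / r' * symSum f e r' ≤ r / r' * (a * r') :=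
            mul_le_mul_of_nonneg_left (by linarith) (div_nonneg hr.1 hr'.le)
        _ = a * r := by field_simp
    have h3 : (1 - r / r') * (2 * f 0) ≤ 0 := mul_nonpos_of_nonneg_of_nonpos
      (sub_nonneg.2 ((div_le_one hr').2 hr.2)) (by linarith)
    have e5 : symSum f e r = f (r • e) + f (r • -e) := by simp [symSum]
    rw [← e5]
    linarith
  have hcρ : a * ρ₀ - (f (ρ₀ • e) + f (ρ₀ • -e)) ≤ h := by
    have := hle ρ₀ ⟨by positivity, by linarith⟩
    simpa [symSum] using this
  have hchord := fun {ρ : ℝ} hρ => le_chord_add (ρ := ρ) (by positivity) hφ hψ hh.le hc0 hcρ hρ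
  simp only [e2] at hchord
  set P := (f (r' • e) - f (ρ₀ • e)) / ρ₀ with hP
  set x₀ := dualCoord b i₀ y with hx₀
  have h4 : |x₀ * (h / a)| ≤ r' / 4 := by
    rw [abs_mul, abs_of_pos (by positivity : 0 < h / a)]
    calc |x₀| * (h / a) ≤ a * r' / (4 * h) * (h / a) := by gcongr
      _ = r' / 4 := by field_simp
  have h4' := abs_le.1 h4
  set ρ := (ρ₀ + x₀ * (h / a)) * (4 / 3) with hρ
  have hρm : ρ ∈ Icc 0 r' := ⟨by rw [hρ]; linarith, by rw [hρ]; linarith⟩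
  set y' := y - x₀ • b i₀ with hy'
  have h5 : (4 : ℝ) • y' ∈ contactSet S f h q := by
    have h6 := sum_smul_mem_of_sum_abs_le hK h0K (balC_pos n) hbp hbm
      (w := fun i => if i = i₀ then 0 else 4 * dualCoord b i y) (by
        calc _ ≤ ∑ _i : Fin n, balC n / n := by
              refine Finset.sum_le_sum fun i _ => ?_
              have := balC_pos n
              rcases eq_or_ne i i₀ with rfl | hi
              · simp only [if_true, abs_zero]; positivity
              · simp only [hi, if_false, abs_mul, abs_of_pos (four_pos : (0 : ℝ) < 4)]
                calc 4 * |dualCoord b i y| ≤ 4 * legW n := by gcongr; exact hy i hi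
                  _ = balC n / n := by unfold legW; field_simp
          _ = balC n := by simp; field_simp)
    convert h6 using 1
    have h7 : ∀ i, (if i = i₀ then (0 : ℝ) else 4 * dualCoord b i y) • b i =
        (4 : ℝ) • dualCoord b i y • b i - (if i = i₀ then (4 : ℝ) • x₀ • b i₀ else 0) := fun i => by
      rcases eq_or_ne i i₀ with rfl | hi
      · simp [hx₀]
      · simp [hi, smul_smul]
    rw [Finset.sum_congr rfl fun i _ => h7 i, Finset.sum_sub_distrib, ← Finset.smul_sum,
      sum_dualCoord_smul hdet, Finset.sum_ite_eq' Finset.univ i₀]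
    simp [hy', smul_sub]
  have h6 : (3 / 4 : ℝ) • ρ • e + (1 / 4 : ℝ) • (4 : ℝ) • y' = ρ₀ • e + y := by
    rw [hy', hbi, hρ]
    module
  have h7 := hfc.2 (hJ ρ hρm) h5.1 (by norm_num : (0 : ℝ) ≤ 3 / 4)
    (by norm_num : (0 : ℝ) ≤ 1 / 4) (by norm_num)
  refine ⟨h6 ▸ hfc.1 (hJ ρ hρm) h5.1 (by norm_num) (by norm_num) (by norm_num), ?_⟩
  rw [h6, smul_eq_mul, smul_eq_mul] at h7
  have h8 := h5.2
  rw [inner_smul_right] at h8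
  have h9 := hchord hρm
  have h10 := hchord (left_mem_Icc.2 hr'.le)
  simp only [zero_smul] at h10
  have h11 : P * (ρ - ρ₀) = 4 / 3 * (P * (x₀ * (h / a))) + 1 / 3 * (P * ρ₀) := by
    rw [hρ]; ring
  linarith

namespace NormalizedSolution

variable {lam Lam p d : ℝ} {S : Set (E n)} {T h₀ : ℝ} {v : E n → ℝ → ℝ}

/-- Comparison with an upper barrier around the middle of a long leg. -/
lemma leg_barrier (H : NormalizedSolution lam Lam p d S T h₀ v) {t t' : ℝ}
    (hT : -T ≤ t) (htt : t < t') (ht' : t' ≤ 0) {h : ℝ} (hh : 0 < h)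
    (hvt : -h / 2 ≤ v 0 t') {q : E n}
    (h0K : (0 : E n) ∈ contactSet S (fun x => v x t') h q)
    {e : E n} {a r₀ r' : ℝ} (ha : 0 < a) (he : r₀ • e ∈ S) (he' : -(r₀ • e) ∈ S)
    (hr' : 0 < r') (hrr : r' ≤ r₀)
    (hle : ∀ r ∈ Icc 0 r₀, a * r - symSum (fun x => v x t') e r ≤ h)
    (hpos : 0 ≤ a * r' - symSum (fun x => v x t') e r')
    (hrise : h / 4 ≤ v ((r' / 2) • e) t' - v ((r' / 2) • e) t)
    {i₀ : Fin n} {b : Fin n → E n} (hbi : b i₀ = (h / a) • e) (hdet : (colMatrix b).det ≠ 0)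
    (hbp : ∀ i, balC n • b i ∈ contactSet S (fun x => v x t') h q)
    (hbm : ∀ i, (-balC n) • b i ∈ contactSet S (fun x => v x t') h q) :
    h / 16 / (t' - t) ≤ Lam * ((∏ i, 2 * (24 * h /
      (if i = i₀ then a * r' / (4 * h) else legW n) ^ 2)) *
      (coordMatrix (dualCoord b)).det ^ 2) ^ p := by
  by_contra! hlt
  have hn : (0 : ℝ) < n := by exact_mod_cast i₀.pos
  have hbal := balC_pos n
  have htI : t ∈ Icc (-T) 0 := ⟨hT, htt.le.trans ht'⟩
  have htI' : t' ∈ Icc (-T) 0 := ⟨hT.trans htt.le, ht'⟩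
  have hfc := H.convexOn t' htI'
  have hfct := H.convexOn t htI
  have hf0 : v 0 t' ≤ 0 := H.at_zero_nonpos htI'
  set L := a * r' / (4 * h) with hL
  have hLpos : 0 < L := by positivity
  have hWpos : 0 < legW n := by unfold legW; positivity
  set w : Fin n → ℝ := fun i => if i = i₀ then L else legW n with hw
  have hwpos : ∀ i, 0 < w i := fun i => by
    rw [hw]; dsimp only; split_ifs <;> assumption
  set c := dualCoord b with hc
  set z : E n := (r' / 2) • e with hz
  set P := (v (r' • e) t' - v z t') / (r' / 2) with hP
  set Q : E n → ℝ := fun y => ∑ i, (c i y / w i) ^ 2 with hQ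
  have hQ0 : ∀ y, 0 ≤ Q y := fun y => Finset.sum_nonneg fun i _ => sq_nonneg _
  have hQc : Continuous Q := by
    rw [hQ]; fun_prop
  set ℓ : E n → ℝ := fun y => P * (c i₀ y * (h / a)) + ⟪q, y - c i₀ y • b i₀⟫ with hℓ
  have hcoord : ∀ y, Q y ≤ 1 → ∀ i, |c i y| ≤ w i := fun y hy i => by
    have h1 : (c i y / w i) ^ 2 ≤ 1 :=
      (Finset.single_le_sum (f := fun i => (c i y / w i) ^ 2) (fun i _ => sq_nonneg _)
        (Finset.mem_univ i)).trans hy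
    rwa [sq_le_one_iff_abs_le_one, abs_div, abs_of_pos (hwpos i), div_le_one (hwpos i)] at h1
  have hup : ∀ y, Q y ≤ 1 → z + y ∈ S ∧ v (z + y) t' ≤ v z t' + ℓ y + 3 * h := fun y hy => by
    have := leg_upper_bound (f := fun x => v x t') hfc hf0 hh hvt h0K ha he he' hr' hrr hle hpos
      hbi hdet hbp hbm
      (y := y) (by simpa [hw] using hcoord y hy i₀)
      (fun i hi => by simpa [hw, hi] using hcoord y hy i)
    refine ⟨this.1, this.2.trans (le_of_eq ?_)⟩
    rw [hℓ]
    ring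
  have hzS : z ∈ S := by simpa using (hup 0 (by simp [hQ])).1
  have hQs : ∀ (s : ℝ) y, Q (s • y) = s ^ 2 * Q y := fun s y => by
    simp only [hQ, map_smul, smul_eq_mul, Finset.mul_sum]
    exact Finset.sum_congr rfl fun i _ => by ring
  have hℓs : ∀ (s : ℝ) y, ℓ (s • y) = s * ℓ y := fun s y => by
    have : s • y - (s * c i₀ y) • b i₀ = s • (y - c i₀ y • b i₀) := by module
    simp only [hℓ, map_smul, smul_eq_mul]
    rw [this, inner_smul_right]
    ring
  have hinit : ∀ y, Q y ≤ 1 → v (z + y) t ≤ v z t' + ℓ y - h / 8 + 24 * h * Q y := by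
    intro y hy
    rcases (hQ0 y).eq_or_lt with h0 | h0
    · have hy0 : y = 0 := by
        rw [← sum_dualCoord_smul hdet y]
        refine Finset.sum_eq_zero fun i _ => ?_
        have h1 := (Finset.sum_eq_zero_iff_of_nonneg fun i _ => sq_nonneg _).1 h0.symm i
          (Finset.mem_univ i)
        rw [pow_eq_zero_iff two_ne_zero, div_eq_zero_iff, or_iff_left (hwpos i).ne'] at h1
        change c i y • b i = 0
        rw [h1, zero_smul]
      have hℓ0 : ℓ 0 = 0 := by simpa using hℓs 0 0
      have hQ00 : Q 0 = 0 := by simpa using hQs 0 0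
      rw [hy0, add_zero, hℓ0, hQ00]
      linarith
    · set σ := √(Q y) with hσ
      have hσ2 : σ ^ 2 = Q y := Real.sq_sqrt (hQ0 y)
      have hσ0 : 0 < σ := Real.sqrt_pos.2 h0
      have hσ1 : σ ≤ 1 := Real.sqrt_le_one.2 hy
      have h1 := hup (σ⁻¹ • y) (by rw [hQs, ← hσ2]; field_simp; rfl)
      have h2 := hfct.2 hzS h1.1 (sub_nonneg.2 hσ1) hσ0.le (by ring)
      have h3 : (1 - σ) • z + σ • (z + σ⁻¹ • y) = z + y := by
        rw [smul_add, smul_inv_smul₀ hσ0.ne']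
        module
      rw [h3, smul_eq_mul, smul_eq_mul] at h2
      have h4 : v (z + σ⁻¹ • y) t ≤ v z t' + σ⁻¹ * ℓ y + 3 * h := by
        rw [← hℓs]
        exact (H.mono _ h1.1 t htI t' htI' htt.le).trans h1.2
      have h5 : (1 - σ) * v z t ≤ (1 - σ) * (v z t' - h / 4) :=
        mul_le_mul_of_nonneg_left (by linarith) (sub_nonneg.2 hσ1)
      have h6 : σ * v (z + σ⁻¹ • y) t ≤ σ * (v z t' + σ⁻¹ * ℓ y + 3 * h) :=
        mul_le_mul_of_nonneg_left h4 hσ0.le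
      have h7 : σ * (σ⁻¹ * ℓ y) = ℓ y := by field_simp
      rw [← hσ2]
      nlinarith [sq_nonneg (σ - 13 / 192), hh]
  set N := (fun x => x - z) ⁻¹' {y | Q y ≤ 1} with hN
  have hNS : N ⊆ S := fun x hx => by simpa using (hup (x - z) hx).1
  have hcz : Continuous fun x : E n => Q (x - z) := by fun_prop
  have hNc : IsCompact N := H.compact.of_isClosed_subset
    (isClosed_le hcz continuous_const) hNS
  set κ := h / 16 / (t' - t) with hκ
  have hκt : κ * (t' - t) = h / 16 := by
    rw [hκ, div_mul_cancel₀ _ (sub_pos.2 htt).ne']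
  have hκ0 : 0 ≤ κ := div_nonneg (by positivity) (sub_pos.2 htt).le
  set g : E n := (InnerProductSpace.toDual ℝ (E n)).symm
    ((P * (h / a) - ⟪q, b i₀⟫) • c i₀) + q with hg
  have hgℓ : ∀ y, ⟪g, y⟫ = ℓ y := fun y => by
    simp only [hg, hℓ, inner_add_left, InnerProductSpace.toDual_symm_apply, inner_sub_right,
      inner_smul_right, smul_apply, smul_eq_mul]
    ring
  have hbar : ∀ x s, barrier (v z t' - h / 8 - ⟪g, z⟫) g (fun i => 24 * h / w i ^ 2) c
      (fun i => c i z) κ t x s = v z t' + ℓ (x - z) - h / 8 + 24 * h * Q (x - z) + κ * (s - t) :=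
    fun x s => by
      rw [← hgℓ, inner_sub_right]
      simp only [barrier, hQ, map_sub, Finset.mul_sum]
      have : ∀ i, 24 * h / w i ^ 2 * (c i x - c i z) ^ 2 =
          24 * h * ((c i x - c i z) / w i) ^ 2 := fun i => by ring
      rw [Finset.sum_congr rfl fun i _ => this i]
      ring
  have key := H.upper N hNc hNS t t' hT htt.le ht' (v z t' - h / 8 - ⟪g, z⟫) g
    (fun i => 24 * h / w i ^ 2) c (fun i => c i z) κ t
    (fun i => div_nonneg (by positivity) (sq_nonneg _)) hlt ?_ ?_ z (by simp [hN, hQ])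
  · rw [hbar, hκt, sub_self] at key
    have hℓ0 : ℓ 0 = 0 := by simpa using hℓs 0 0
    have hQ00 : Q 0 = 0 := by simpa using hQs 0 0
    rw [hℓ0, hQ00] at key
    linarith
  · intro x hx
    rw [hbar, sub_self, mul_zero, add_zero]
    simpa using hinit (x - z) hx
  · intro x hx hxint s hs
    rw [hbar]
    have h1 : 1 ≤ Q (x - z) := by
      by_contra! hlt'
      exact hxint (mem_interior.2 ⟨{x | Q (x - z) < 1}, fun y hy =>
        (show Q (y - z) < 1 from hy).le,
        isOpen_lt hcz continuous_const, hlt'⟩)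
    have h2 := (hup (x - z) hx).2
    rw [add_sub_cancel] at h2
    have h3 := H.mono x (hNS hx) s ⟨hT.trans hs.1, hs.2.trans ht'⟩ t' htI' hs.2
    have h4 : 0 ≤ κ * (s - t) := mul_nonneg hκ0 (sub_nonneg.2 hs.1)
    nlinarith

/-- The time a long leg needs to disappear. -/
lemma leg_time_le (hp : 0 < p) (hLam : 0 < Lam)
    (H : NormalizedSolution lam Lam p d S T h₀ v) {t t' : ℝ}
    (hT : -T ≤ t) (htt : t < t') (ht' : t' ≤ 0) {h : ℝ} (hh : 0 < h)
    (hvt : -h / 2 ≤ v 0 t') {e : E n} (hne : e ≠ 0) {a r₀ r' M : ℝ} (ha : 0 < a)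
    (he : r₀ • e ∈ S) (he' : -(r₀ • e) ∈ S) (hM : 3 < M) (hMr : M * h / a ≤ r') (hrr : r' ≤ r₀)
    (hle : ∀ r ∈ Icc 0 r₀, a * r - symSum (fun x => v x t') e r ≤ h)
    (hpos : 0 ≤ a * r' - symSum (fun x => v x t') e r')
    (hrise : h / 2 ≤ symSum (fun x => v x t') e (r' / 2) - symSum (fun x => v x t) e (r' / 2)) :
    legC n p Lam * M ^ (2 * p) * h ^ (1 - n * p) *
      (minPotential S (fun x => v x t') h / h ^ 2) ^ (2 * p) ≤ t' - t := by
  wlog hside : h / 4 ≤ v ((r' / 2) • e) t' - v ((r' / 2) • e) t generalizing e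
  · refine this (e := -e) (neg_ne_zero.2 hne) (by simpa using he') (by simpa using he)
      (by simpa only [symSum_neg] using hle) (by simpa only [symSum_neg] using hpos)
      (by simpa only [symSum_neg] using hrise) ?_
    simp only [symSum] at hrise
    rw [smul_neg]
    linarith
  obtain ⟨i₀, hi₀⟩ : ∃ i₀, e i₀ ≠ 0 := by
    by_contra! hall
    exact hne (by ext i; simpa using hall i)
  have htI' : t' ∈ Icc (-T) 0 := ⟨hT.trans htt.le, ht'⟩
  have hf := H.continuousOn_slice htI'
  have hfc := H.convexOn t' htI'
  have hf0 : v 0 t' ≤ 0 := H.at_zero_nonpos htI'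
  have hMpos : 0 < M := by linarith
  have hr' : 0 < r' := lt_of_lt_of_le (by positivity) hMr
  have hMr' : M * h ≤ a * r' := by rwa [div_le_iff₀ ha, mul_comm r'] at hMr
  have har : a * r' ≤ a * r₀ := mul_le_mul_of_nonneg_left hrr ha.le
  have hMh : 3 * h < M * h := mul_lt_mul_of_pos_right hM hh
  have hsum : symSum (fun x => v x t') e (h / a) ≤ h := by
    have h2 : h / (a * r') ≤ 1 := (div_le_one (by positivity)).2 (by linarith)
    have h3 := ((convexOn_symSum hfc he he').subset (Icc_subset_Icc_right hrr) (convex_Icc _ _)).2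
      (left_mem_Icc.2 hr'.le) (right_mem_Icc.2 hr'.le) (sub_nonneg.2 h2)
      (by positivity : 0 ≤ h / (a * r')) (by ring)
    have e3 : (1 - h / (a * r')) • (0 : ℝ) + (h / (a * r')) • r' = h / a := by
      simp only [smul_eq_mul]; field_simp; ring
    have e4 : symSum (fun x => v x t') e 0 = 2 * v 0 t' := by simp [symSum]; ring
    rw [e3, smul_eq_mul, smul_eq_mul, e4] at h3
    have h4 : (1 - h / (a * r')) * (2 * v 0 t') ≤ 0 :=
      mul_nonpos_of_nonneg_of_nonpos (sub_nonneg.2 h2) (by linarith)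
    have h5 : h / (a * r') * symSum (fun x => v x t') e r' ≤ h / (a * r') * (a * r') := by
      gcongr; linarith
    have h6 : h / (a * r') * (a * r') = h := by field_simp
    linarith
  obtain ⟨q, hq⟩ := exists_potential_eq_minPotential H.compact H.zero_mem hf h
  have h0K : (0 : E n) ∈ contactSet S (fun x => v x t') h q :=
    mem_of_mem_nhds (contactSet_mem_nhds_zero H.zero_mem hf (by linarith) q)
  obtain ⟨b, hbi, hdet, hbp, hbm, hZ⟩ := exists_leg_frame H.compact H.zero_mem hf hfc hf0 hh
    (by linarith) hq ha (hr'.le.trans hrr) he he' hle (by linarith) hsum hi₀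
  have hbar := H.leg_barrier hT htt ht' hh hvt h0K ha he he' hr' hrr hle hpos hside hbi hdet
    hbp hbm
  set L := a * r' / (4 * h) with hL
  have hLM : M / 4 ≤ L := by
    rw [hL, div_le_div_iff₀ (by norm_num) (by positivity)]; linarith
  have hn : (0 : ℝ) < n := by exact_mod_cast i₀.pos
  have hn1 : (1 : ℝ) ≤ n := by exact_mod_cast i₀.pos
  have hbal := balC_pos n
  have hW : 0 < legW n := by unfold legW; positivity
  have hW1 : legW n ≤ 1 := by
    unfold legW
    rw [div_le_one (by positivity)]
    linarith [balC_lt_one n]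
  have hG : 0 < gapC n ^ 2 * (2 * legB n) ^ n := by
    have := gapC_pos n
    have := legB_pos n
    positivity
  set G := gapC n ^ 2 * (2 * legB n) ^ n with hGdef
  set D := |(colMatrix b).det| with hD
  have hDpos : 0 < D := abs_pos.2 hdet
  set Z := minPotential S (fun x => v x t') h / h ^ 2 with hZdef
  have hZpos : 0 < Z := div_pos (minPotential_pos H.compact H.zero_mem hf (by linarith))
    (by positivity)
  have hZD : Z ≤ G * D := by
    rw [hZdef, div_le_iff₀ (by positivity), hGdef]
    calc _ ≤ _ := hZ
      _ = _ := by ring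
  have hprod : ∏ i : Fin n, 2 * (24 * h / (if i = i₀ then L else legW n) ^ 2) =
      (48 * h) ^ n / (legW n ^ n * (L / legW n)) ^ 2 := by
    have h1 : ∀ i : Fin n, 2 * (24 * h / (if i = i₀ then L else legW n) ^ 2) =
        48 * h / (legW n * if i = i₀ then L / legW n else 1) ^ 2 := fun i => by
      split_ifs
      · rw [mul_div_cancel₀ _ hW.ne']; ring
      · rw [mul_one]; ring
    have h2 : ∏ i : Fin n, (legW n * if i = i₀ then L / legW n else 1) =
        legW n ^ n * (L / legW n) := by
      rw [Finset.prod_mul_distrib, Finset.prod_ite_eq' Finset.univ i₀]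
      simp
    rw [Finset.prod_congr rfl fun i _ => h1 i, Finset.prod_div_distrib, Finset.prod_pow, h2]
    simp
  have hLW : M / 4 ≤ L / legW n := by
    rw [le_div_iff₀ hW]
    nlinarith
  rw [det_coordMatrix_dualCoord, ← hD, hprod, ← div_eq_mul_inv, div_div ((48 * h) ^ n), ← mul_pow]
    at hbar
  set Y := legW n ^ n * M * Z / (4 * G) with hY
  have hYpos : 0 < Y := by positivity
  have hYle : Y ≤ legW n ^ n * (L / legW n) * D := by
    calc Y = legW n ^ n * (M / 4) * (Z / G) := by rw [hY]; ring
      _ ≤ legW n ^ n * (L / legW n) * D := by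
        gcongr
        rw [div_le_iff₀ hG]
        linarith
  have h1 : h / 16 / (t' - t) ≤ Lam * ((48 * h) ^ n / Y ^ 2) ^ p := by
    refine hbar.trans ?_
    gcongr
  have hC : legK n * (h ^ n / (M * Z) ^ 2) = (48 * h) ^ n / Y ^ 2 := by
    rw [hY, legK, ← hGdef]
    field_simp
    ring
  have hKpos : 0 < legK n := by rw [legK, ← hGdef]; positivity
  have h2 : ((48 * h) ^ n / Y ^ 2) ^ p = legK n ^ p * (h ^ (n * p) /
      (M ^ (2 * p) * Z ^ (2 * p))) := by
    rw [← hC, Real.mul_rpow hKpos.le (by positivity), Real.div_rpow (by positivity)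
      (by positivity), ← Real.rpow_natCast, ← Real.rpow_natCast, ← Real.rpow_mul (by positivity),
      ← Real.rpow_mul (by positivity), Real.mul_rpow hMpos.le hZpos.le]
    norm_num
  rw [h2, div_le_iff₀ (sub_pos.2 htt)] at h1
  have h3 : h ^ (1 - n * p) = h / h ^ (n * p) := by
    rw [Real.rpow_sub hh, Real.rpow_one]
  rw [h3, legC]
  have := Real.rpow_pos_of_pos hKpos p
  have := Real.rpow_pos_of_pos hMpos (2 * p)
  have := Real.rpow_pos_of_pos hZpos (2 * p)
  have := Real.rpow_pos_of_pos hh (n * p)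
  field_simp at h1 ⊢
  linarith

end NormalizedSolution

/-- The Legendre transform of `G · t` on `[0, r₀]`. -/
def legD (G : ℝ → ℝ → ℝ) (r₀ a t : ℝ) : ℝ := sSup ((fun r => a * r - G r t) '' Icc 0 r₀)

/-- The one-dimensional data of a family of convex functions `G · t` which is nondecreasing in
time, together with a volume functional `Z` controlling how fast legs disappear. -/
structure LegData (n : ℕ) (p c C hs T T' r₀ : ℝ) (M : ℕ) (G Z : ℝ → ℝ → ℝ) : Prop where
  r₀_pos : 0 < r₀
  T'_neg : T' < 0
  T'_mem : -T ≤ T'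
  cont : ContinuousOn (fun z : ℝ × ℝ => G z.1 z.2) (Icc 0 r₀ ×ˢ Icc (-T) 0)
  convexOn : ∀ t ∈ Icc (-T) 0, ConvexOn ℝ (Icc 0 r₀) (fun r => G r t)
  mono : ∀ r ∈ Icc 0 r₀, ∀ s ∈ Icc (-T) 0, ∀ t ∈ Icc (-T) 0, s ≤ t → G r s ≤ G r t
  zero : G 0 0 = 0
  nonneg : ∀ r ∈ Icc 0 r₀, 0 ≤ G r 0
  Z_pos : ∀ h, 0 < h → ∀ t ∈ Icc (-T) 0, 0 < Z h t
  Z_mono : ∀ h h', h ≤ h' → ∀ t ∈ Icc (-T) 0, Z h t ≤ Z h' t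
  Z_anti : ∀ h, ∀ s ∈ Icc (-T) 0, ∀ t ∈ Icc (-T) 0, s ≤ t → Z h t ≤ Z h s
  Z_mul : ∀ η h, 0 < η → η ≤ 1 → ∀ t ∈ Icc (-T) 0, η ^ (n + 2) * Z h t ≤ Z (η * h) t
  leg : ∀ t t', -T ≤ t → t < t' → t' ≤ 0 → ∀ h a r' : ℝ, 0 < h → 0 < a →
    M * h / a ≤ r' → r' ≤ r₀ →
    -h ≤ G 0 t' → (∀ r ∈ Icc 0 r₀, a * r - G r t' ≤ h) → 0 ≤ a * r' - G r' t' →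
    h / 2 ≤ G (r' / 2) t' - G (r' / 2) t →
    c * (M : ℝ) ^ (2 * p) * h ^ (1 - n * p) * (Z h t' / h ^ 2) ^ (2 * p) ≤ t' - t
  center : ∀ t, T' ≤ t → t < 0 → ∀ h, 0 < h → h ≤ hs → -(2 * h) ≤ G 0 t →
    -t ≤ C * h ^ (1 - n * p) * (Z h t / h ^ 2) ^ (2 * p)

namespace LegData

variable {p c C hs T T' r₀ : ℝ} {M : ℕ} {G Z : ℝ → ℝ → ℝ}

lemma mem_zero (H : LegData n p c C hs T T' r₀ M G Z) : (0 : ℝ) ∈ Icc (-T) 0 :=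
  right_mem_Icc.2 (H.T'_mem.trans H.T'_neg.le)

lemma mem_neg (H : LegData n p c C hs T T' r₀ M G Z) : -T ∈ Icc (-T) 0 :=
  left_mem_Icc.2 (H.T'_mem.trans H.T'_neg.le)

lemma max_mem (H : LegData n p c C hs T T' r₀ M G Z) {t : ℝ} (ht : t ∈ Icc (-T) 0) :
    max t T' ∈ Icc (-T) 0 := ⟨H.T'_mem.trans (le_max_right _ _), max_le ht.2 H.T'_neg.le⟩

lemma at_zero_nonpos (H : LegData n p c C hs T T' r₀ M G Z) {t : ℝ} (ht : t ∈ Icc (-T) 0) :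
    G 0 t ≤ 0 := by
  have := H.mono 0 (left_mem_Icc.2 H.r₀_pos.le) t ht 0 H.mem_zero ht.2
  rwa [H.zero] at this

lemma continuousOn_gap (H : LegData n p c C hs T T' r₀ M G Z) (a : ℝ) {t : ℝ}
    (ht : t ∈ Icc (-T) 0) : ContinuousOn (fun r => a * r - G r t) (Icc 0 r₀) :=
  (by fun_prop : Continuous fun r : ℝ => a * r).continuousOn.sub
    (ContinuousOn.comp (g := fun z : ℝ × ℝ => G z.1 z.2) (f := fun r => (r, t)) H.cont
      (by fun_prop) fun _ hr => ⟨hr, ht⟩)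

lemma exists_eq_legD (H : LegData n p c C hs T T' r₀ M G Z) (a : ℝ) {t : ℝ}
    (ht : t ∈ Icc (-T) 0) : ∃ r ∈ Icc 0 r₀, a * r - G r t = legD G r₀ a t := by
  obtain ⟨r, hr, h⟩ := isCompact_Icc.exists_sSup_image_eq (nonempty_Icc.2 H.r₀_pos.le)
    (H.continuousOn_gap a ht)
  exact ⟨r, hr, h.symm⟩

lemma le_legD (H : LegData n p c C hs T T' r₀ M G Z) (a : ℝ) {t : ℝ}
    (ht : t ∈ Icc (-T) 0) {r : ℝ} (hr : r ∈ Icc 0 r₀) : a * r - G r t ≤ legD G r₀ a t :=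
  le_csSup (isCompact_Icc.image_of_continuousOn (H.continuousOn_gap a ht)).bddAbove
    (mem_image_of_mem _ hr)

lemma legD_le (H : LegData n p c C hs T T' r₀ M G Z) {a : ℝ} {t : ℝ}
    (ht : t ∈ Icc (-T) 0) {B : ℝ} (h : ∀ r ∈ Icc 0 r₀, a * r - G r t ≤ B) :
    legD G r₀ a t ≤ B := by
  obtain ⟨r, hr, hr'⟩ := H.exists_eq_legD a ht
  exact hr' ▸ h r hr

lemma legD_nonneg (H : LegData n p c C hs T T' r₀ M G Z) (a : ℝ) {t : ℝ}
    (ht : t ∈ Icc (-T) 0) : 0 ≤ legD G r₀ a t := by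
  have := H.le_legD a ht (left_mem_Icc.2 H.r₀_pos.le)
  have := H.at_zero_nonpos ht
  linarith

lemma legD_mono (H : LegData n p c C hs T T' r₀ M G Z) {a b : ℝ} (hab : a ≤ b) {s t : ℝ}
    (hs' : s ∈ Icc (-T) 0) (ht : t ∈ Icc (-T) 0) (hst : s ≤ t) :
    legD G r₀ a t ≤ legD G r₀ b s := H.legD_le ht fun r hr => by
  have h1 := H.le_legD b hs' hr
  have h2 := H.mono r hr s hs' t ht hst
  have h3 := mul_le_mul_of_nonneg_right hab hr.1
  linarith

lemma continuous_legD (H : LegData n p c C hs T T' r₀ M G Z) {t : ℝ} (ht : t ∈ Icc (-T) 0) :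
    Continuous fun a => legD G r₀ a t := by
  refine (LipschitzWith.of_le_add_mul r₀.toNNReal fun a b => ?_).continuous
  refine H.legD_le ht fun r hr => ?_
  have h1 := H.le_legD b ht hr
  have h2 : (a - b) * r ≤ |a - b| * r₀ :=
    mul_le_mul (le_abs_self _) hr.2 hr.1 (abs_nonneg _)
  rw [Real.dist_eq, Real.coe_toNNReal _ H.r₀_pos.le]
  linarith

lemma exists_long_leg (H : LegData n p c C hs T T' r₀ M G Z) {t : ℝ} (ht : t ∈ Icc (-T) 0)
    {δ : ℝ} {a' a₂ : ℝ} (ha' : 0 < a') (haa : a' ≤ a₂) :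
    ∃ a ∈ Icc a' a₂, (legD G r₀ a t + δ) * a' ^ M ≤ (legD G r₀ a' t + δ) * a ^ M ∧
      (a = a₂ ∨ (0 < legD G r₀ a t + δ → ∃ r ∈ Icc 0 r₀, M * (legD G r₀ a t + δ) / a ≤ r ∧
        legD G r₀ a t ≤ a * r - G r t)) := by
  have hD := H.continuous_legD ht
  have hK : IsCompact {a ∈ Icc a' a₂ | (legD G r₀ a t + δ) * a' ^ M ≤
      (legD G r₀ a' t + δ) * a ^ M} :=
    isCompact_Icc.inter_right (isClosed_le ((hD.add continuous_const).mul continuous_const)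
      (continuous_const.mul (continuous_pow M)))
  obtain ⟨a, ⟨haI, ha⟩, hmax⟩ := hK.exists_isGreatest ⟨a', left_mem_Icc.2 haa, le_rfl⟩
  refine ⟨a, haI, ha, ?_⟩
  rcases haI.2.eq_or_lt with h | hlt
  · exact Or.inl h
  refine Or.inr fun hpos => ?_
  have ha0 : 0 < a := ha'.trans_le haI.1
  set h := legD G r₀ a t + δ with hh
  have hstep : ∀ x ∈ Ioc a a₂, ∃ r ∈ Icc (M * h / a) r₀,
      legD G r₀ a t - (x - a) * r₀ ≤ a * r - G r t := by
    intro x hx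
    obtain ⟨r, hr, hre⟩ := H.exists_eq_legD x ht
    have h1 : h * x ^ M < (legD G r₀ x t + δ) * a ^ M := by
      by_contra! hle
      have h2 : x ≤ a := hmax ⟨⟨haI.1.trans hx.1.le, hx.2⟩, by
        have e1 : (legD G r₀ x t + δ) * a' ^ M * a ^ M ≤ h * a' ^ M * x ^ M := by
          have := mul_le_mul_of_nonneg_right hle (pow_pos ha' M).le
          linarith
        have e2 : h * a' ^ M * x ^ M ≤ (legD G r₀ a' t + δ) * a ^ M * x ^ M :=
          mul_le_mul_of_nonneg_right ha (pow_pos (ha0.trans hx.1) M).le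
        refine le_of_mul_le_mul_right ?_ (pow_pos ha0 M)
        linarith⟩
      linarith [hx.1]
    have h3 := one_add_mul_le_pow (a := (x - a) / a) (by
      have : 0 ≤ (x - a) / a := div_nonneg (by linarith [hx.1]) ha0.le
      linarith) M
    have h4 : 1 + (x - a) / a = x / a := by field_simp; ring
    rw [h4, div_pow] at h3
    have h5 : h * (1 + M * ((x - a) / a)) ≤ legD G r₀ x t + δ := by
      refine (mul_le_mul_of_nonneg_left h3 hpos.le).trans ?_
      rw [mul_div_assoc', div_le_iff₀ (pow_pos ha0 M)]
      exact h1.le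
    have h6 := H.le_legD a ht hr
    have h7 : (x - a) * (M * h / a) ≤ (x - a) * r := by
      have : h * (M * ((x - a) / a)) = (x - a) * (M * h / a) := by ring
      linarith
    refine ⟨r, ⟨le_of_mul_le_mul_left h7 (sub_pos.2 hx.1), hr.2⟩, ?_⟩
    have h8 : (x - a) * r ≤ (x - a) * r₀ :=
      mul_le_mul_of_nonneg_left hr.2 (sub_nonneg.2 hx.1.le)
    have h9 := H.legD_mono hx.1.le ht ht le_rfl
    linarith
  have hsub : Icc (M * h / a) r₀ ⊆ Icc 0 r₀ := Icc_subset_Icc_left (by positivity)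
  obtain ⟨r₁, hr₁, -⟩ := hstep a₂ ⟨hlt, le_rfl⟩
  obtain ⟨r, hr, hrmax⟩ := isCompact_Icc.exists_isMaxOn ⟨r₁, hr₁⟩
    ((H.continuousOn_gap a ht).mono hsub)
  refine ⟨r, hsub hr, hr.1, ?_⟩
  refine le_of_forall_pos_lt_add fun ε hε => ?_
  set x := min a₂ (a + ε / (2 * r₀)) with hx
  have hr₀ := H.r₀_pos
  have hxm : x ∈ Ioc a a₂ := ⟨lt_min hlt (by linarith [div_pos hε (by linarith : 0 < 2 * r₀)]),
    min_le_left _ _⟩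
  obtain ⟨r₂, hr₂, h1⟩ := hstep x hxm
  have h2 : a * r₂ - G r₂ t ≤ a * r - G r t := hrmax hr₂
  have h3 : (x - a) * r₀ ≤ ε / (2 * r₀) * r₀ :=
    mul_le_mul_of_nonneg_right (by linarith [min_le_right a₂ (a + ε / (2 * r₀))]) hr₀.le
  have h4 : ε / (2 * r₀) * r₀ = ε / 2 := by field_simp
  linarith

lemma exists_last_time (H : LegData n p c C hs T T' r₀ M G Z) {t' : ℝ}
    (ht' : t' ∈ Icc (-T) 0) {a r' B : ℝ} (hr' : r' ∈ Icc 0 r₀) (hB : legD G r₀ a t' < B) :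
    (∀ r ∈ Icc 0 (r' / 2), a * r - G r (-T) ≤ B) ∨ ∃ t ∈ Ico (-T) t',
      (∀ r ∈ Icc 0 (r' / 2), a * r - G r t ≤ B) ∧ ∃ r ∈ Icc 0 (r' / 2), B ≤ a * r - G r t := by
  have hsub : Icc 0 (r' / 2) ⊆ Icc 0 r₀ := Icc_subset_Icc_right (by linarith [hr'.1, hr'.2])
  have hsubt : Icc (-T) t' ⊆ Icc (-T) 0 := Icc_subset_Icc_right ht'.2
  have hcont : ContinuousOn (fun z : ℝ × ℝ => a * z.1 - G z.1 z.2)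
      (Icc 0 (r' / 2) ×ˢ Icc (-T) t') :=
    (by fun_prop : Continuous fun z : ℝ × ℝ => a * z.1).continuousOn.sub
      (H.cont.mono (prod_mono hsub hsubt))
  have hK : IsCompact (Prod.snd '' {z ∈ Icc 0 (r' / 2) ×ˢ Icc (-T) t' |
      B ≤ a * z.1 - G z.1 z.2}) := by
    refine IsCompact.image ?_ continuous_snd
    refine (isCompact_Icc.prod isCompact_Icc).of_isClosed_subset ?_ fun z hz => hz.1
    exact hcont.preimage_isClosed_of_isClosed (isClosed_Icc.prod isClosed_Icc) isClosed_Ici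
  by_cases hne : (Prod.snd '' {z ∈ Icc 0 (r' / 2) ×ˢ Icc (-T) t' |
      B ≤ a * z.1 - G z.1 z.2}).Nonempty
  · right
    obtain ⟨t, ⟨⟨r, s⟩, ⟨⟨hr, hs1⟩, hrB⟩, rfl⟩, hmax⟩ := hK.exists_isGreatest hne
    simp only at hr hs1 hrB hmax
    have hst : s < t' := by
      refine lt_of_le_of_ne hs1.2 fun h => ?_
      subst h
      exact (hrB.trans (H.le_legD a ht' (hsub hr))).not_gt hB
    refine ⟨s, ⟨hs1.1, hst⟩, fun x hx => ?_, r, hr, hrB⟩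
    by_contra! hlt
    have hc : ContinuousOn (fun τ => a * x - G x τ) (Icc (-T) t') :=
      ContinuousOn.comp (g := fun z : ℝ × ℝ => a * z.1 - G z.1 z.2) (f := fun τ => (x, τ)) hcont
        (by fun_prop) fun _ hτ => ⟨hx, hτ⟩
    have hiv := intermediate_value_Icc' hst.le (hc.mono (Icc_subset_Icc_left hs1.1))
    obtain ⟨τ, hτ, hτB⟩ := hiv ⟨((H.le_legD a ht' (hsub hx)).trans hB.le), hlt.le⟩
    have h1 : τ ≤ s := hmax ⟨(x, τ), ⟨⟨hx, hs1.1.trans hτ.1, hτ.2⟩, hτB.ge⟩, rfl⟩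
    have h2 : τ = s := le_antisymm h1 hτ.1
    subst h2
    exact hlt.ne hτB.symm
  · left
    intro r hr
    by_contra! hlt
    exact hne ⟨-T, (r, -T), ⟨⟨hr, left_mem_Icc.2 ht'.1⟩, hlt.le⟩, rfl⟩

end LegData

/-- The factor by which the volume functional has to grow at each step of the iteration. -/
def growthC (n : ℕ) : ℝ := 2 * (2 * Real.exp 8) ^ (n + 3)

lemma one_le_growthC : 1 ≤ growthC n := by
  have h1 : (1 : ℝ) ≤ 2 * Real.exp 8 := by linarith [Real.add_one_le_exp (8 : ℝ)]
  have h2 := one_le_pow₀ h1 (n := n + 3)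
  unfold growthC
  linarith

/-- The quantity which doubles along the iteration. -/
def legF (n M : ℕ) (G Z : ℝ → ℝ → ℝ) (r₀ T' δ κ a t : ℝ) : ℝ :=
  Z (legD G r₀ a t + δ) (max t T') * (a ^ M / (legD G r₀ a t + δ)) ^ (n + 3) * Real.exp (-κ * t)

lemma le_of_doubling {ι : Type*} {P : ι → Prop} {F : ι → ℝ} {C₀ B : ℝ} (hC₀ : 0 ≤ C₀)
    (hB : ∀ x, P x → F x ≤ B) (hstep : ∀ x, P x → C₀ < F x → ∃ y, P y ∧ 2 * F x ≤ F y)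
    (x : ι) (hx : P x) : F x ≤ C₀ := by
  by_contra! hlt
  have key : ∀ k : ℕ, ∃ y, P y ∧ 2 ^ k * F x ≤ F y := by
    intro k
    induction k with
    | zero => exact ⟨x, hx, by simp⟩
    | succ k ih =>
      obtain ⟨y, hy, hyk⟩ := ih
      have h1 : 1 * F x ≤ 2 ^ k * F x :=
        mul_le_mul_of_nonneg_right (one_le_pow₀ (by norm_num)) (hC₀.trans hlt.le)
      obtain ⟨z, hz, hyz⟩ := hstep y hy (by linarith)
      refine ⟨z, hz, ?_⟩
      rw [pow_succ]
      linarith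
  have hpos : 0 < F x := hC₀.trans_lt hlt
  obtain ⟨k, hk⟩ := pow_unbounded_of_one_lt (B / F x) (one_lt_two : (1 : ℝ) < 2)
  obtain ⟨y, hy, hyk⟩ := key k
  have := hB y hy
  rw [div_lt_iff₀ hpos] at hk
  linarith

namespace LegData

variable {p c C hs T T' r₀ : ℝ} {M : ℕ} {G Z : ℝ → ℝ → ℝ}

lemma concaveOn_gap (H : LegData n p c C hs T T' r₀ M G Z) (a : ℝ) {t : ℝ}
    (ht : t ∈ Icc (-T) 0) : ConcaveOn ℝ (Icc 0 r₀) fun r => a * r - G r t := by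
  have h1 : ConcaveOn ℝ (Icc 0 r₀) fun r : ℝ => a * r :=
    (LinearMap.mulLeft ℝ a).concaveOn (convex_Icc _ _)
  exact h1.sub (H.convexOn t ht)

lemma rise (H : LegData n p c C hs T T' r₀ M G Z) {t t' : ℝ} (ht : t ∈ Icc (-T) 0)
    (ht' : t' ∈ Icc (-T) 0) (htt : t ≤ t') {a B b r r' : ℝ} (hr' : r' ∈ Icc 0 r₀)
    (hr'0 : 0 < r') (hB : legD G r₀ a t' ≤ b) (hb : b ≤ a * r' - G r' t')
    (hr : r ∈ Icc 0 (r' / 2)) (hBr : B ≤ a * r - G r t) (hbB : b ≤ B) :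
    (B - b) / 2 ≤ G (r' / 2) t' - G (r' / 2) t := by
  have h0 := H.mono r' hr' t ht t' ht' htt
  have h1 := H.le_legD a ht' (r := r' / 2) ⟨by linarith, by linarith [hr'.2]⟩
  have hd : 0 < r' - r := by linarith [hr.2]
  set l := (r' / 2 - r) / (r' - r) with hl
  have hl0 : 0 ≤ l := div_nonneg (by linarith [hr.2]) hd.le
  have hl1 : l ≤ 1 / 2 := by
    rw [hl, div_le_iff₀ hd]
    linarith [hr.1]
  have h2 := (H.concaveOn_gap a ht).2 (x := r) (y := r') ⟨hr.1, by linarith [hr.2, hr'.2]⟩ hr'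
    (by linarith : 0 ≤ 1 - l) hl0 (by ring)
  have h3 : (1 - l) • r + l • r' = r' / 2 := by
    have : l * (r' - r) = r' / 2 - r := div_mul_cancel₀ _ hd.ne'
    simp only [smul_eq_mul]
    linarith
  rw [h3] at h2
  simp only [smul_eq_mul] at h2
  have h4 : (1 - l) * B ≤ (1 - l) * (a * r - G r t) :=
    mul_le_mul_of_nonneg_left hBr (by linarith)
  have h5 : l * b ≤ l * (a * r' - G r' t) := mul_le_mul_of_nonneg_left (by linarith) hl0
  have h6 : l * (B - b) ≤ 1 / 2 * (B - b) := mul_le_mul_of_nonneg_right hl1 (by linarith)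
  linarith

lemma shrink_legD_le (H : LegData n p c C hs T T' r₀ M G Z) {t : ℝ} (ht : t ∈ Icc (-T) 0)
    {a h B r' : ℝ} (ha : 0 < a) (hM : 0 < M) (hr'0 : 0 < r')
    (hMr : M * h / a ≤ r') (hB0 : 0 ≤ B) (hBh : B ≤ 2 * h)
    (hB : ∀ r ∈ Icc 0 (r' / 2), a * r - G r t ≤ B) :
    legD G r₀ (a * (1 - 4 / M)) t ≤ B := by
  have hM' : (0 : ℝ) < M := by exact_mod_cast hM
  refine H.legD_le ht fun r hr => ?_
  have hsplit : a * (1 - 4 / M) * r - G r t = (a * r - G r t) - 4 * (a * r / M) := by ring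
  have hpos : 0 ≤ a * r / M := by have := hr.1; positivity
  rw [hsplit]
  rcases le_total r (r' / 2) with h1 | h1
  · linarith [hB r ⟨hr.1, h1⟩]
  have hr0 : 0 < r := by linarith
  have hl1 : r' / 2 / r ≤ 1 := (div_le_one hr0).2 h1
  have h2 := (H.concaveOn_gap a ht).2 (left_mem_Icc.2 H.r₀_pos.le) hr
    (by linarith : 0 ≤ 1 - r' / 2 / r) (by positivity : 0 ≤ r' / 2 / r) (by ring)
  have h3 : (1 - r' / 2 / r) • (0 : ℝ) + (r' / 2 / r) • r = r' / 2 := by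
    simp only [smul_eq_mul]
    field_simp
    ring
  rw [h3] at h2
  simp only [smul_eq_mul, mul_zero, zero_sub] at h2
  have h4 := hB (r' / 2) ⟨by linarith, le_rfl⟩
  have h5 : 0 ≤ (1 - r' / 2 / r) * -G 0 t :=
    mul_nonneg (by linarith) (by linarith [H.at_zero_nonpos ht])
  have h6 : r' / 2 / r * (a * r - G r t) ≤ 2 * h := by linarith
  have h7 : a * r - G r t ≤ 2 * h / (r' / 2 / r) := by
    rw [le_div_iff₀ (by positivity)]
    linarith
  have h8 : 2 * h / (r' / 2 / r) = 4 * (h * r / r') := by field_simp; ring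
  have h9 : h * r / r' ≤ a * r / M := by
    rw [div_le_div_iff₀ hr'0 hM']
    rw [div_le_iff₀ ha] at hMr
    have := mul_le_mul_of_nonneg_right hMr hr0.le
    linarith
  linarith

lemma growth (H : LegData n p c C hs T T' r₀ M G Z) (hp : 0 < p) (hC : 0 < C)
    (hMC : 2 * C * growthC n ^ (2 * p) ≤ c * (M : ℝ) ^ (2 * p)) {t t' h : ℝ}
    (ht : t ∈ Icc (-T) 0) (ht' : t' ∈ Icc (-T) 0) (htt : t < t') (hh : 0 < h) (hhs : h ≤ hs)
    (hG : -(2 * h) ≤ G 0 t)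
    (hleg : c * (M : ℝ) ^ (2 * p) * h ^ (1 - n * p) * (Z h t' / h ^ 2) ^ (2 * p) ≤ t' - t) :
    growthC n * Z h (max t' T') ≤
      Z h (max t T') * Real.exp (Real.log (growthC n) / (2 * -T') * (t' - t)) := by
  have hΓ : 1 ≤ growthC n := one_le_growthC
  have hT' := H.T'_neg
  have hlog : 0 ≤ Real.log (growthC n) := Real.log_nonneg hΓ
  have hm := H.max_mem ht
  have hm' := H.max_mem ht'
  have hm0 : max t T' < 0 := max_lt (htt.trans_le ht'.2) hT'
  rcases le_or_gt (t' - t) (2 * -(max t T')) with hcase | hcase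
  · have h1 := H.center (max t T') (le_max_right _ _) hm0 h hh hhs
      (hG.trans (H.mono 0 (left_mem_Icc.2 H.r₀_pos.le) t ht _ hm (le_max_left _ _)))
    set X := Z h (max t T') / h ^ 2 with hX
    set X' := Z h t' / h ^ 2 with hX'
    have hXpos : 0 < X := div_pos (H.Z_pos h hh _ hm) (by positivity)
    have hX'pos : 0 < X' := div_pos (H.Z_pos h hh _ ht') (by positivity)
    have hhp : 0 < h ^ (1 - n * p) := Real.rpow_pos_of_pos hh _
    have h2 : (2 * C * h ^ (1 - n * p)) * (growthC n * X') ^ (2 * p) ≤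
        (2 * C * h ^ (1 - n * p)) * X ^ (2 * p) := by
      rw [Real.mul_rpow (by linarith) hX'pos.le]
      have h3 := mul_le_mul_of_nonneg_right hMC
        (mul_nonneg hhp.le (Real.rpow_nonneg hX'pos.le (2 * p)))
      linarith
    have h4 := le_of_mul_le_mul_left h2 (by positivity)
    have h5 : growthC n * X' ≤ X :=
      (Real.rpow_le_rpow_iff (by positivity) hXpos.le (by positivity)).1 h4
    have h6 : growthC n * Z h t' ≤ Z h (max t T') := by
      rw [hX, hX', mul_div_assoc', div_le_div_iff_of_pos_right (by positivity)] at h5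
      exact h5
    have h7 := H.Z_anti h t' ht' _ hm' (le_max_left _ _)
    have h8 : 1 ≤ Real.exp (Real.log (growthC n) / (2 * -T') * (t' - t)) :=
      Real.one_le_exp (mul_nonneg (div_nonneg hlog (by linarith)) (by linarith))
    have h9 := mul_le_mul_of_nonneg_left h7 (by linarith : 0 ≤ growthC n)
    have h10 := le_mul_of_one_le_right (H.Z_pos h hh _ hm).le h8
    linarith
  · have htT : t < T' := by
      by_contra! hle
      rw [max_eq_left hle] at hcase
      linarith [ht'.2, ht.2]
    rw [max_eq_right htT.le] at hcase ⊢
    have h1 : Real.log (growthC n) ≤ Real.log (growthC n) / (2 * -T') * (t' - t) := by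
      rw [div_mul_eq_mul_div, le_div_iff₀ (by linarith)]
      exact mul_le_mul_of_nonneg_left hcase.le hlog
    have h2 := Real.exp_le_exp.2 h1
    rw [Real.exp_log (by linarith)] at h2
    have hTm : T' ∈ Icc (-T) 0 := ⟨H.T'_mem, hT'.le⟩
    have h3 := H.Z_anti h T' hTm _ hm' (le_max_right _ _)
    have h4 := mul_le_mul_of_nonneg_left h3 (by linarith : 0 ≤ growthC n)
    have h5 := mul_le_mul_of_nonneg_left h2 (H.Z_pos h hh _ hTm).le
    linarith

lemma exp_le_one_sub_pow {M : ℕ} (hM : 8 ≤ M) : Real.exp (-8) ≤ (1 - 4 / (M : ℝ)) ^ M := by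
  have hM' : (8 : ℝ) ≤ M := by exact_mod_cast hM
  have h1 : 1 ≤ (1 - 4 / (M : ℝ)) * (1 + 8 / M) := by
    have : (1 - 4 / (M : ℝ)) * (1 + 8 / M) = 1 + 4 * (M - 8) / M ^ 2 := by
      field_simp
      ring
    rw [this]
    have : 0 ≤ 4 * ((M : ℝ) - 8) / M ^ 2 := div_nonneg (by linarith) (by positivity)
    linarith
  have h0 : 0 ≤ 1 - 4 / (M : ℝ) := by
    rw [sub_nonneg, div_le_one (by linarith)]
    linarith
  have h2 := one_le_pow₀ h1 (n := M)
  rw [mul_pow] at h2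
  have h3 : (1 + 8 / (M : ℝ)) ^ M ≤ Real.exp 8 := by
    refine (pow_le_pow_left₀ (by positivity) ((add_comm _ _).trans_le (Real.add_one_le_exp _)) M
      ).trans ?_
    rw [← Real.exp_nat_mul]
    refine Real.exp_le_exp.2 (le_of_eq ?_)
    field_simp
  have h4 := mul_le_mul_of_nonneg_left h3 (pow_nonneg h0 M)
  rw [Real.exp_neg, inv_le_iff_one_le_mul₀ (Real.exp_pos 8)]
  linarith

lemma two_mul_legF_le (H : LegData n p c C hs T T' r₀ M G Z) (hM : 8 ≤ M) {t t' a h δ κ : ℝ}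
    (ht : t ∈ Icc (-T) 0) (ha : 0 < a) (hδ : 0 < δ)
    (hh : h = legD G r₀ a t' + δ) (hh0 : 0 < h)
    (hE : legD G r₀ (a * (1 - 4 / M)) t + δ ≤ 2 * h)
    (hgrow : growthC n * Z h (max t' T') ≤ Z h (max t T') * Real.exp (κ * (t' - t))) :
    2 * legF n M G Z r₀ T' δ κ a t' ≤ legF n M G Z r₀ T' δ κ (a * (1 - 4 / M)) t := by
  have hm := H.max_mem ht
  unfold legF
  rw [← hh]
  set E' := legD G r₀ (a * (1 - 4 / M)) t + δ with hE'
  have hE'0 : 0 < E' := add_pos_of_nonneg_of_pos (H.legD_nonneg _ ht) hδ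
  set η := E' / (2 * h) with hη
  have hη0 : 0 < η := by positivity
  have hη1 : η ≤ 1 := (div_le_one (by positivity)).2 hE
  have h1 := H.Z_mul η (2 * h) hη0 hη1 _ hm
  rw [hη, div_mul_cancel₀ _ (by positivity), ← hη] at h1
  have h2 := H.Z_mono h (2 * h) (by linarith) _ hm
  have hZ := H.Z_pos h hh0 _ hm
  have h3 : η ^ (n + 3) * Z h (max t T') ≤ Z E' (max t T') := by
    have e1 : η ^ (n + 3) ≤ η ^ (n + 2) := pow_le_pow_of_le_one hη0.le hη1 (by omega)
    have e2 := mul_le_mul e1 h2 hZ.le (by positivity)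
    exact e2.trans h1
  have h4 := exp_le_one_sub_pow hM
  have hY : 0 < a ^ M / h := by positivity
  have h5 : Real.exp (-8) / 2 * (a ^ M / h) ≤ η * ((a * (1 - 4 / M)) ^ M / E') := by
    have e1 : η * ((a * (1 - 4 / M)) ^ M / E') = (1 - 4 / (M : ℝ)) ^ M / 2 * (a ^ M / h) := by
      rw [mul_pow, hη]
      field_simp
    rw [e1]
    gcongr
  have h6 := pow_le_pow_left₀ (by positivity) h5 (n + 3)
  rw [mul_pow, mul_pow] at h6
  have h7 : 0 < (a * (1 - 4 / M)) ^ M / E' := by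
    have := (by positivity : 0 < Real.exp (-8) / 2 * (a ^ M / h)).trans_le h5
    exact pos_of_mul_pos_right this hη0.le
  have h8 : growthC n * (Real.exp (-8) / 2) ^ (n + 3) = 2 := by
    unfold growthC
    rw [mul_assoc, ← mul_pow, Real.exp_neg]
    have : 2 * Real.exp 8 * ((Real.exp 8)⁻¹ / 2) = 1 := by field_simp
    rw [this, one_pow, mul_one]
  have h9 : Real.exp (κ * (t' - t)) * Real.exp (-κ * t') = Real.exp (-κ * t) := by
    rw [← Real.exp_add]
    ring_nf
  calc 2 * (Z h (max t' T') * (a ^ M / h) ^ (n + 3) * Real.exp (-κ * t'))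
      = growthC n * Z h (max t' T') *
          ((Real.exp (-8) / 2) ^ (n + 3) * (a ^ M / h) ^ (n + 3) * Real.exp (-κ * t')) := by
        linear_combination
          -(Z h (max t' T') * (a ^ M / h) ^ (n + 3) * Real.exp (-κ * t')) * h8
    _ ≤ Z h (max t T') * Real.exp (κ * (t' - t)) *
          ((Real.exp (-8) / 2) ^ (n + 3) * (a ^ M / h) ^ (n + 3) * Real.exp (-κ * t')) :=
        mul_le_mul_of_nonneg_right hgrow (by positivity)
    _ = Z h (max t T') * ((Real.exp (-8) / 2) ^ (n + 3) * (a ^ M / h) ^ (n + 3)) *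
          Real.exp (-κ * t) := by rw [← h9]; ring
    _ ≤ Z h (max t T') * (η ^ (n + 3) * ((a * (1 - 4 / M)) ^ M / E') ^ (n + 3)) *
          Real.exp (-κ * t) := by gcongr
    _ = η ^ (n + 3) * Z h (max t T') * ((a * (1 - 4 / M)) ^ M / E') ^ (n + 3) *
          Real.exp (-κ * t) := by ring
    _ ≤ _ := by gcongr

end LegData

namespace LegData

variable {p c C hs T T' r₀ : ℝ} {M : ℕ} {G Z : ℝ → ℝ → ℝ}

/-- The rate of the exponential weight in time. -/
def rateC (n : ℕ) (T' : ℝ) : ℝ := Real.log (growthC n) / (2 * -T')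

lemma legF_le (H : LegData n p c C hs T T' r₀ M G Z) {δ a a₂ t Y : ℝ} (hδ : 0 < δ) (hδ1 : δ ≤ 1)
    (ht : t ∈ Icc (-T) 0) (ha : 0 < a) (haa : a ≤ a₂) (hY : a ^ M / (legD G r₀ a t + δ) ≤ Y) :
    legF n M G Z r₀ T' δ (rateC n T') a t ≤
      Z (legD G r₀ a₂ (-T) + 1) (-T) * Y ^ (n + 3) * Real.exp (rateC n T' * T) := by
  have hm := H.max_mem ht
  have hE : 0 < legD G r₀ a t + δ := add_pos_of_nonneg_of_pos (H.legD_nonneg _ ht) hδ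
  have hκ : 0 ≤ rateC n T' :=
    div_nonneg (Real.log_nonneg one_le_growthC) (by linarith [H.T'_neg])
  have h1 : Z (legD G r₀ a t + δ) (max t T') ≤ Z (legD G r₀ a₂ (-T) + 1) (-T) :=
    (H.Z_mono _ _ (add_le_add (H.legD_mono haa H.mem_neg ht ht.1) hδ1) _ hm).trans
      (H.Z_anti _ _ H.mem_neg _ hm hm.1)
  have h2 := H.Z_pos _ hE _ hm
  have h3 : -rateC n T' * t ≤ rateC n T' * T := by
    have := mul_le_mul_of_nonneg_left ht.1 hκ
    linarith
  have h4 : 0 ≤ a ^ M / (legD G r₀ a t + δ) := by positivity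
  unfold legF
  have h5 := mul_le_mul h1 (pow_le_pow_left₀ h4 hY (n + 3)) (by positivity) (h2.le.trans h1)
  exact mul_le_mul h5 (Real.exp_le_exp.2 h3) (Real.exp_pos _).le
    (mul_nonneg (h2.le.trans h1) (pow_nonneg (h4.trans hY) _))

lemma legF_le_legF (H : LegData n p c C hs T T' r₀ M G Z) {δ a a' t κ : ℝ} (hδ : 0 < δ)
    (ht : t ∈ Icc (-T) 0) (ha' : 0 < a') (haa : a' ≤ a)
    (hE : (legD G r₀ a t + δ) * a' ^ M ≤ (legD G r₀ a' t + δ) * a ^ M) :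
    legF n M G Z r₀ T' δ κ a' t ≤ legF n M G Z r₀ T' δ κ a t := by
  have hm := H.max_mem ht
  have hE1 : 0 < legD G r₀ a t + δ := add_pos_of_nonneg_of_pos (H.legD_nonneg _ ht) hδ
  have hE2 : 0 < legD G r₀ a' t + δ := add_pos_of_nonneg_of_pos (H.legD_nonneg _ ht) hδ
  have h1 : Z (legD G r₀ a' t + δ) (max t T') ≤ Z (legD G r₀ a t + δ) (max t T') :=
    H.Z_mono _ _ (by linarith [H.legD_mono haa ht ht le_rfl]) _ hm
  have h2 : a' ^ M / (legD G r₀ a' t + δ) ≤ a ^ M / (legD G r₀ a t + δ) := by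
    rw [div_le_div_iff₀ hE2 hE1]
    linarith
  have h3 := H.Z_pos _ hE1 _ hm
  have h4 : 0 ≤ a' ^ M / (legD G r₀ a' t + δ) := by positivity
  unfold legF
  gcongr

/-- The bound of the doubling quantity. -/
def boundC (n M : ℕ) (G Z : ℝ → ℝ → ℝ) (T T' r₀ hs c₁ a₂ : ℝ) : ℝ :=
  Z (legD G r₀ a₂ (-T) + 1) (-T) * (a₂ ^ M / r₀ + a₂ ^ M / hs + M / (2 * c₁)) ^ (n + 3) *
    Real.exp (rateC n T' * T)

lemma exists_double (H : LegData n p c C hs T T' r₀ M G Z) (hp : 0 < p) (hC : 0 < C)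
    (hs0 : 0 < hs) (hM : 8 ≤ M)
    (hMC : 2 * C * growthC n ^ (2 * p) ≤ c * (M : ℝ) ^ (2 * p)) {c₁ a₂ : ℝ} (hc₁ : 0 < c₁)
    (ha₂ : G r₀ 0 / r₀ + 1 ≤ a₂)
    (hinit : ∀ r ∈ Ioc 0 r₀, ∀ a ∈ Ioc 0 a₂, a * r ≤ 2 * G r (-T) → c₁ * a ^ M ≤ a * r)
    {δ : ℝ} (hδ : 0 < δ) (hδ1 : δ ≤ 1) {t' a' : ℝ} (ht' : t' ∈ Icc (-T) 0)
    (ha' : a' ∈ Ioc 0 a₂)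
    (hF : boundC n M G Z T T' r₀ hs c₁ a₂ < legF n M G Z r₀ T' δ (rateC n T') a' t') :
    ∃ t ∈ Icc (-T) 0, ∃ a ∈ Ioc 0 a₂, 2 * legF n M G Z r₀ T' δ (rateC n T') a' t' ≤
      legF n M G Z r₀ T' δ (rateC n T') a t := by
  have hM' : (8 : ℝ) ≤ M := by exact_mod_cast hM
  have hr₀ := H.r₀_pos
  have ha₂0 : 0 < a₂ := ha'.1.trans_le ha'.2
  obtain ⟨a, haI, hE, hcase⟩ := H.exists_long_leg (δ := δ) ht' ha'.1 ha'.2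
  have ha0 : 0 < a := ha'.1.trans_le haI.1
  have hFF := H.legF_le_legF (κ := rateC n T') hδ ht' ha'.1 haI.1 hE
  set h := legD G r₀ a t' + δ with hh
  have hh0 : 0 < h := add_pos_of_nonneg_of_pos (H.legD_nonneg _ ht') hδ
  have hbound : ¬ a ^ M / h ≤ a₂ ^ M / r₀ + a₂ ^ M / hs + M / (2 * c₁) := fun hY =>
    (hF.trans_le hFF).not_ge (H.legF_le hδ hδ1 ht' ha0 haI.2 hY)
  have p1 : 0 < a₂ ^ M / r₀ := by positivity
  have p2 : 0 < a₂ ^ M / hs := by positivity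
  have p3 : 0 < M / (2 * c₁) := by positivity
  have haM : a ^ M ≤ a₂ ^ M := pow_le_pow_left₀ ha0.le haI.2 M
  have hhs : h ≤ hs := by
    by_contra! hlt
    refine hbound ?_
    have : a ^ M / h ≤ a₂ ^ M / hs := div_le_div₀ (by positivity) haM hs0 hlt.le
    linarith
  rcases hcase with rfl | hcase
  · refine absurd ?_ hbound
    have h1 := H.le_legD a ht' (right_mem_Icc.2 hr₀.le)
    have h2 := H.mono r₀ (right_mem_Icc.2 hr₀.le) t' ht' 0 H.mem_zero ht'.2
    have h3 : (G r₀ 0 / r₀ + 1) * r₀ ≤ a * r₀ := mul_le_mul_of_nonneg_right ha₂ hr₀.le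
    rw [add_mul, div_mul_cancel₀ _ hr₀.ne'] at h3
    have h4 : r₀ ≤ h := by linarith
    have : a ^ M / h ≤ a ^ M / r₀ := div_le_div_of_nonneg_left (by positivity) hr₀ h4
    linarith
  obtain ⟨r', hr', hMr, hgap⟩ := hcase hh0
  have hr'0 : 0 < r' := lt_of_lt_of_le (by positivity) hMr
  have hD : legD G r₀ a t' = h - δ := by rw [hh]; ring
  have hD0 := H.legD_nonneg a ht'
  rcases H.exists_last_time ht' hr' (a := a) (B := 2 * h - δ) (by linarith) with hno | hyes
  · refine absurd ?_ hbound
    have hr : M * h / (2 * a) ≤ r' / 2 := by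
      have : M * h / (2 * a) = M * h / a / 2 := by field_simp
      linarith
    have h1 := hno (M * h / (2 * a)) ⟨by positivity, hr⟩
    have h2 : a * (M * h / (2 * a)) = M * h / 2 := by field_simp
    have h3 : 8 * h ≤ M * h := mul_le_mul_of_nonneg_right hM' hh0.le
    have h4 := hinit (M * h / (2 * a)) ⟨by positivity, by linarith [hr'.2]⟩ a ⟨ha0, haI.2⟩
      (by linarith)
    rw [h2] at h4
    have : a ^ M / h ≤ M / (2 * c₁) := by
      rw [div_le_div_iff₀ hh0 (by positivity)]
      linarith
    linarith
  obtain ⟨t, htI, hle, r, hr, hge⟩ := hyes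
  have ht : t ∈ Icc (-T) 0 := ⟨htI.1, htI.2.le.trans ht'.2⟩
  have hrise := H.rise ht ht' htI.2.le hr' hr'0 (b := h - δ) (by linarith) (by linarith) hr hge
    (by linarith)
  have hG := hle 0 ⟨le_rfl, by linarith⟩
  have hG' := H.le_legD a ht' (left_mem_Icc.2 hr₀.le)
  have hleg := H.leg t t' htI.1 htI.2 ht'.2 h a r' hh0 ha0 hMr hr'.2 (by linarith)
    (fun x hx => (H.le_legD a ht' hx).trans (by linarith)) (by linarith) (by linarith)
  have hgrow := H.growth hp hC hMC ht ht' htI.2 hh0 hhs (by linarith) hleg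
  have hshr := H.shrink_legD_le ht ha0 (by omega) hr'0 hMr (B := 2 * h - δ) (by linarith)
    (by linarith) hle
  have h41 : 0 < 1 - 4 / (M : ℝ) := by
    rw [sub_pos, div_lt_one (by linarith)]
    linarith
  refine ⟨t, ht, a * (1 - 4 / M), ⟨by positivity, ?_⟩, ?_⟩
  · have : a * (1 - 4 / M) ≤ a * 1 :=
      mul_le_mul_of_nonneg_left (by linarith [(by positivity : (0 : ℝ) ≤ 4 / M)]) ha0.le
    linarith [haI.2]
  · have := H.two_mul_legF_le (κ := rateC n T') hM ht ha0 hδ hh hh0 (by linarith) hgrow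
    linarith

lemma legF_le_boundC (H : LegData n p c C hs T T' r₀ M G Z) (hp : 0 < p) (hC : 0 < C)
    (hs0 : 0 < hs) (hM : 8 ≤ M)
    (hMC : 2 * C * growthC n ^ (2 * p) ≤ c * (M : ℝ) ^ (2 * p)) {c₁ a₂ : ℝ} (hc₁ : 0 < c₁)
    (ha₂0 : 0 < a₂) (ha₂ : G r₀ 0 / r₀ + 1 ≤ a₂)
    (hinit : ∀ r ∈ Ioc 0 r₀, ∀ a ∈ Ioc 0 a₂, a * r ≤ 2 * G r (-T) → c₁ * a ^ M ≤ a * r)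
    {δ : ℝ} (hδ : 0 < δ) (hδ1 : δ ≤ 1) {t a : ℝ} (ht : t ∈ Icc (-T) 0) (ha : a ∈ Ioc 0 a₂) :
    legF n M G Z r₀ T' δ (rateC n T') a t ≤ boundC n M G Z T T' r₀ hs c₁ a₂ := by
  have hr₀ := H.r₀_pos
  have hZ : 0 < Z (legD G r₀ a₂ (-T) + 1) (-T) :=
    H.Z_pos _ (by linarith [H.legD_nonneg a₂ H.mem_neg]) _ H.mem_neg
  refine le_of_doubling (ι := ℝ × ℝ) (P := fun z => z.1 ∈ Icc (-T) 0 ∧ z.2 ∈ Ioc 0 a₂)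
    (F := fun z => legF n M G Z r₀ T' δ (rateC n T') z.2 z.1)
    (B := Z (legD G r₀ a₂ (-T) + 1) (-T) * (a₂ ^ M / δ) ^ (n + 3) * Real.exp (rateC n T' * T))
    (by unfold boundC; positivity) (fun z hz => ?_) (fun z hz hlt => ?_) (t, a) ⟨ht, ha⟩
  · refine H.legF_le hδ hδ1 hz.1 hz.2.1 hz.2.2 ?_
    refine div_le_div₀ (by positivity) (pow_le_pow_left₀ hz.2.1.le hz.2.2 M) hδ ?_
    linarith [H.legD_nonneg z.2 hz.1]
  · obtain ⟨s, hs', b, hb, h⟩ :=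
      H.exists_double hp hC hs0 hM hMC hc₁ ha₂ hinit hδ hδ1 hz.1 hz.2 hlt
    exact ⟨(s, b), ⟨hs', hb⟩, h⟩

lemma exists_le_legD (H : LegData n p c C hs T T' r₀ M G Z) (hp : 0 < p) (hC : 0 < C)
    (hs0 : 0 < hs) (hM : 8 ≤ M)
    (hMC : 2 * C * growthC n ^ (2 * p) ≤ c * (M : ℝ) ^ (2 * p)) {c₁ a₂ : ℝ} (hc₁ : 0 < c₁)
    (ha₂0 : 0 < a₂) (ha₂ : G r₀ 0 / r₀ + 1 ≤ a₂)
    (hinit : ∀ r ∈ Ioc 0 r₀, ∀ a ∈ Ioc 0 a₂, a * r ≤ 2 * G r (-T) → c₁ * a ^ M ≤ a * r) :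
    ∃ k > 0, ∀ a ∈ Ioc 0 a₂, k * a ^ (M * (n + 3)) ≤ legD G r₀ a 0 := by
  have hr₀ := H.r₀_pos
  have hZ : 0 < Z (legD G r₀ a₂ (-T) + 1) (-T) :=
    H.Z_pos _ (by linarith [H.legD_nonneg a₂ H.mem_neg]) _ H.mem_neg
  have hK : 0 < boundC n M G Z T T' r₀ hs c₁ a₂ := by unfold boundC; positivity
  set K := boundC n M G Z T T' r₀ hs c₁ a₂ with hKdef
  set m := legD G r₀ a₂ 0 + 1 with hm
  have hm0 : 0 < m := by linarith [H.legD_nonneg a₂ H.mem_zero]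
  have hz0 := H.Z_pos m hm0 0 H.mem_zero
  refine ⟨Z m 0 / (m ^ (n + 2) * K), by positivity, fun a ha => ?_⟩
  refine le_of_forall_pos_le_add fun ε hε => ?_
  set δ := min ε 1 with hδ
  have hδ0 : 0 < δ := lt_min hε one_pos
  have hδ1 : δ ≤ 1 := min_le_right _ _
  refine le_trans ?_ (add_le_add_right (min_le_left ε 1) _)
  have h1 := H.legF_le_boundC hp hC hs0 hM hMC hc₁ ha₂0 ha₂ hinit hδ0 hδ1 H.mem_zero ha
  unfold legF at h1
  rw [max_eq_left H.T'_neg.le, mul_zero, Real.exp_zero, mul_one, ← hKdef] at h1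
  set e := legD G r₀ a 0 + δ with he
  have he0 : 0 < e := add_pos_of_nonneg_of_pos (H.legD_nonneg _ H.mem_zero) hδ0
  have hem : e ≤ m := add_le_add (H.legD_mono ha.2 H.mem_zero H.mem_zero le_rfl) hδ1
  have h2 := H.Z_mul (e / m) m (by positivity) ((div_le_one hm0).2 hem) 0 H.mem_zero
  rw [div_mul_cancel₀ _ hm0.ne'] at h2
  have h3 : (e / m) ^ (n + 2) * Z m 0 * (a ^ M / e) ^ (n + 3) ≤ K :=
    (mul_le_mul_of_nonneg_right h2 (by have := ha.1; positivity)).trans h1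
  have h4 : (e / m) ^ (n + 2) * Z m 0 * (a ^ M / e) ^ (n + 3) =
      Z m 0 * a ^ (M * (n + 3)) / (m ^ (n + 2) * e) := by
    rw [div_pow, div_pow, ← pow_mul, pow_succ e (n + 2)]
    field_simp
  rw [h4, div_le_iff₀ (by positivity)] at h3
  rw [div_mul_eq_mul_div, div_le_iff₀ (by positivity)]
  linarith

lemma exists_rate (H : LegData n p c C hs T T' r₀ M G Z) (hp : 0 < p) (hC : 0 < C)
    (hs0 : 0 < hs) (hM : 8 ≤ M)
    (hMC : 2 * C * growthC n ^ (2 * p) ≤ c * (M : ℝ) ^ (2 * p)) {c₁ a₂ : ℝ} (hc₁ : 0 < c₁)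
    (ha₂0 : 0 < a₂) (ha₂ : G r₀ 0 / r₀ + 1 ≤ a₂)
    (hinit : ∀ r ∈ Ioc 0 r₀, ∀ a ∈ Ioc 0 a₂, a * r ≤ 2 * G r (-T) → c₁ * a ^ M ≤ a * r) :
    ∃ k > 0, ∀ s ∈ Ioc 0 r₀, k * (G s 0 / s) ^ (M * (n + 3)) ≤ G s 0 := by
  have hr₀ := H.r₀_pos
  obtain ⟨k, hk, hkD⟩ := H.exists_le_legD hp hC hs0 hM hMC hc₁ ha₂0 ha₂ hinit
  refine ⟨k, hk, fun s hs' => ?_⟩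
  have hsI : s ∈ Icc 0 r₀ := ⟨hs'.1.le, hs'.2⟩
  rcases (H.nonneg s hsI).eq_or_lt with h0 | h0
  · rw [← h0, zero_div, zero_pow (by positivity), mul_zero]
  have hconv : ∀ x y : ℝ, 0 < x → x ≤ y → y ≤ r₀ → G x 0 / x * y ≤ G y 0 := by
    intro x y hx hxy hy
    have hy0 : 0 < y := hx.trans_le hxy
    have h1 := (H.convexOn 0 H.mem_zero).2 (left_mem_Icc.2 hr₀.le) (⟨hy0.le, hy⟩ : y ∈ Icc 0 r₀)
      (sub_nonneg.2 ((div_le_one hy0).2 hxy) : 0 ≤ 1 - x / y) (by positivity : 0 ≤ x / y)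
      (by ring)
    have h2 : (1 - x / y) • (0 : ℝ) + (x / y) • y = x := by
      simp only [smul_eq_mul]
      field_simp
      ring
    rw [h2] at h1
    simp only [smul_eq_mul, H.zero, mul_zero, zero_add] at h1
    rw [div_mul_eq_mul_div, div_le_iff₀ hx]
    rw [div_mul_eq_mul_div, le_div_iff₀ hy0] at h1
    linarith
  have ha : G s 0 / s ∈ Ioc 0 a₂ := by
    refine ⟨div_pos h0 hs'.1, ?_⟩
    have h1 := hconv s r₀ hs'.1 hs'.2 le_rfl
    rw [← le_div_iff₀ hr₀] at h1
    linarith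
  refine (hkD _ ha).trans (H.legD_le H.mem_zero fun r hr => ?_)
  rcases le_total r s with h1 | h1
  · have h2 := mul_le_mul_of_nonneg_left h1 ha.1.le
    rw [div_mul_cancel₀ _ hs'.1.ne'] at h2
    linarith [H.nonneg r hr]
  · linarith [hconv s r hs'.1 h1 hr.2]

end LegData

lemma legC_pos (n : ℕ) (p : ℝ) {Lam : ℝ} (hLam : 0 < Lam) : 0 < legC n p Lam := by
  have hg := gapC_pos n
  have hb := balC_pos n
  have hK : 0 < legK n := by
    unfold legK legB legW
    rcases n.eq_zero_or_pos with rfl | hn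
    · simp only [pow_zero]
      positivity
    · positivity
  unfold legC
  positivity

lemma centerC_pos (n : ℕ) {d p lam : ℝ} (hd : 1 ≤ d) (hlam : 0 < lam) :
    0 < centerC n d p lam := by
  have hg := gapC_pos n
  have hdet := detC_pos n
  have hd' : 0 < d := by linarith
  unfold centerC centerDepth centerR
  positivity

lemma exists_index {c p : ℝ} (hc : 0 < c) (hp : 0 < p) (K B : ℝ) :
    ∃ M : ℕ, 8 ≤ M ∧ B ≤ M ∧ K ≤ c * (M : ℝ) ^ (2 * p) := by
  have h1 : Filter.Tendsto (fun M : ℕ => c * (M : ℝ) ^ (2 * p)) Filter.atTop Filter.atTop :=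
    ((tendsto_rpow_atTop (by positivity)).comp tendsto_natCast_atTop_atTop).const_mul_atTop hc
  have h2 : Filter.Tendsto (fun M : ℕ => (M : ℝ)) Filter.atTop Filter.atTop :=
    tendsto_natCast_atTop_atTop
  obtain ⟨M, ⟨h3, h4⟩, h5⟩ := (((Filter.eventually_ge_atTop 8).and
    (h2.eventually_ge_atTop B)).and (h1.eventually_ge_atTop K)).exists
  exact ⟨M, h3, h4, h5⟩

lemma le_rpow_of_mul_pow_le {k g s : ℝ} {m : ℕ} (hk : 0 < k) (hg : 0 ≤ g) (hs : 0 < s)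
    (hm : m ≠ 0) (h : k * (g / s) ^ (m + 1) ≤ g) :
    g ≤ (1 / k) ^ (m : ℝ)⁻¹ * s ^ (1 + (m : ℝ)⁻¹) := by
  rcases hg.eq_or_lt with h0 | h0
  · rw [← h0]
    positivity
  have h1 : g ^ m ≤ 1 / k * s ^ (m + 1) := by
    rw [div_pow, mul_div_assoc', div_le_iff₀ (by positivity), pow_succ g] at h
    rw [div_mul_eq_mul_div, le_div_iff₀ hk, one_mul]
    refine le_of_mul_le_mul_right ?_ h0
    linarith
  have h2 := Real.rpow_le_rpow (by positivity) h1 (by positivity : 0 ≤ (m : ℝ)⁻¹)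
  rw [Real.pow_rpow_inv_natCast hg hm, Real.mul_rpow (by positivity) (by positivity),
    ← Real.rpow_natCast, ← Real.rpow_mul hs.le] at h2
  convert h2 using 3
  have : (m : ℝ) ≠ 0 := by exact_mod_cast hm
  push_cast
  field_simp

lemma init_of_le_rpow {β C₁ a₂ r₀ : ℝ} {M : ℕ} {g : ℝ → ℝ} (hβ : 0 < β) (hC₁ : 0 < C₁)
    (ha₂ : 0 < a₂) (hM : 1 + β⁻¹ ≤ M) (hg : ∀ r ∈ Ioc 0 r₀, g r ≤ C₁ * r ^ (1 + β)) :
    ∃ c₁ > 0, ∀ r ∈ Ioc 0 r₀, ∀ a ∈ Ioc 0 a₂, a * r ≤ 2 * g r → c₁ * a ^ M ≤ a * r := by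
  refine ⟨(2 * C₁) ^ (-β⁻¹) / a₂ ^ (M - (1 + β⁻¹)), by positivity, fun r hr a ha hle => ?_⟩
  have hr0 := hr.1
  have ha0 := ha.1
  have h1 : a ≤ 2 * C₁ * r ^ β := by
    have := hg r hr
    rw [Real.rpow_add hr0, Real.rpow_one] at this
    refine le_of_mul_le_mul_right ?_ hr0
    linarith
  have h2 : a ^ β⁻¹ ≤ (2 * C₁) ^ β⁻¹ * r := by
    have := Real.rpow_le_rpow ha0.le h1 (by positivity : 0 ≤ β⁻¹)
    rwa [Real.mul_rpow (by positivity) (by positivity), Real.rpow_rpow_inv hr0.le hβ.ne'] at this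
  have h3 : (a : ℝ) ^ M = a ^ ((M : ℝ) - (1 + β⁻¹)) * (a * a ^ β⁻¹) := by
    rw [← Real.rpow_natCast, ← Real.rpow_one_add' ha0.le (by positivity), ← Real.rpow_add ha0]
    ring_nf
  have h4 : a ^ ((M : ℝ) - (1 + β⁻¹)) ≤ a₂ ^ ((M : ℝ) - (1 + β⁻¹)) :=
    Real.rpow_le_rpow ha0.le ha.2 (by linarith)
  rw [Real.rpow_neg (by positivity), h3]
  have hX : 0 < (2 * C₁) ^ β⁻¹ := by positivity
  have hY : 0 < a₂ ^ ((M : ℝ) - (1 + β⁻¹)) := by positivity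
  calc ((2 * C₁) ^ β⁻¹)⁻¹ / a₂ ^ ((M : ℝ) - (1 + β⁻¹)) *
        (a ^ ((M : ℝ) - (1 + β⁻¹)) * (a * a ^ β⁻¹))
      ≤ ((2 * C₁) ^ β⁻¹)⁻¹ / a₂ ^ ((M : ℝ) - (1 + β⁻¹)) *
        (a₂ ^ ((M : ℝ) - (1 + β⁻¹)) * (a * ((2 * C₁) ^ β⁻¹ * r))) := by gcongr
    _ = a * r := by field_simp

namespace NormalizedSolution

variable {lam Lam p d T h₀ : ℝ} {S : Set (E n)} {v : E n → ℝ → ℝ}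

lemma exists_boundary_time (H : NormalizedSolution lam Lam p d S T h₀ v) :
    ∃ T' ∈ Ico (-T) 0, ∀ x ∈ S, x ∉ interior S → ∀ t ∈ Icc T' 0, h₀ / 2 ≤ v x t := by
  have hT := H.T_pos
  have hh := H.h₀_pos
  have huc := (H.compact.prod isCompact_Icc).uniformContinuousOn_of_continuous H.cont
  obtain ⟨δ, hδ, hu⟩ := Metric.uniformContinuousOn_iff.1 huc (h₀ / 2) (by linarith)
  refine ⟨max (-T) (-(δ / 2)), ⟨le_max_left _ _, max_lt (by linarith) (by linarith)⟩, ?_⟩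
  intro x hx hxi t ht
  have h1 := hu (x, t) ⟨hx, (le_max_left _ _).trans ht.1, ht.2⟩ (x, 0)
    ⟨hx, by linarith, le_rfl⟩ (by
      rw [dist_prod_same_left, Real.dist_eq, sub_zero, abs_lt]
      constructor <;> linarith [(le_max_right _ _).trans ht.1, ht.2])
  rw [Real.dist_eq, abs_lt] at h1
  have := H.height_le x hx hxi
  linarith [h1.1]

lemma symSum_nonneg (H : NormalizedSolution lam Lam p d S T h₀ v) {e : E n} {r : ℝ}
    (h1 : r • e ∈ S) (h2 : -(r • e) ∈ S) : 0 ≤ symSum (fun x => v x 0) e r := by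
  have h3 := (H.convexOn 0 ⟨by linarith [H.T_pos], le_rfl⟩).2 h1 h2
    (by norm_num : (0 : ℝ) ≤ 1 / 2) (by norm_num : (0 : ℝ) ≤ 1 / 2) (by norm_num)
  rw [smul_neg, add_neg_cancel] at h3
  simp only [smul_eq_mul, H.zero] at h3
  unfold symSum
  linarith

lemma legData (H : NormalizedSolution lam Lam p d S T h₀ v) (hp : 0 < p) (hlam : 0 < lam)
    (hLam : 0 < Lam) (hd : 1 ≤ d) {e : E n} (hne : e ≠ 0) {r₀ : ℝ} (hr₀ : 0 < r₀)
    (he : r₀ • e ∈ S) (he' : -(r₀ • e) ∈ S) {M : ℕ} (hM : 8 ≤ M) {T' : ℝ} (hT' : T' ∈ Ico (-T) 0)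
    (hbd : ∀ x ∈ S, x ∉ interior S → ∀ t ∈ Icc T' 0, h₀ / 2 ≤ v x t) :
    LegData n p (legC n p Lam) (centerC n d p lam) (h₀ / (2 * (gapC n + 1))) T T' r₀ M
      (fun r t => symSum (fun x => v x t) e r)
      (fun h t => minPotential S (fun x => v x t) h) where
  r₀_pos := hr₀
  T'_neg := hT'.2
  T'_mem := hT'.1
  cont := by
    have hmem : ∀ r ∈ Icc 0 r₀, r • e ∈ S ∧ -(r • e) ∈ S := fun r hr =>
      ⟨smul_dir_mem H.convex he he' (abs_le.2 ⟨by linarith [hr.1], hr.2⟩), by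
        rw [← neg_smul]
        exact smul_dir_mem H.convex he he' (abs_le.2 ⟨by linarith [hr.2], by linarith [hr.1]⟩)⟩
    unfold symSum
    refine ContinuousOn.add ?_ ?_
    · exact ContinuousOn.comp (g := fun z : E n × ℝ => v z.1 z.2)
        (f := fun z : ℝ × ℝ => (z.1 • e, z.2)) H.cont (by fun_prop)
        fun z hz => ⟨(hmem z.1 hz.1).1, hz.2⟩
    · exact ContinuousOn.comp (g := fun z : E n × ℝ => v z.1 z.2)
        (f := fun z : ℝ × ℝ => (-(z.1 • e), z.2)) H.cont (by fun_prop)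
        fun z hz => ⟨(hmem z.1 hz.1).2, hz.2⟩
  convexOn := fun t ht => convexOn_symSum (H.convexOn t ht) he he'
  mono := fun r hr s hs t ht hst => by
    have h1 := smul_dir_mem H.convex he he' (abs_le.2 ⟨by linarith [hr.1], hr.2⟩)
    have h2 := smul_dir_mem H.convex he he' (r := -r)
      (abs_le.2 ⟨by linarith [hr.2], by linarith [hr.1]⟩)
    rw [neg_smul] at h2
    exact add_le_add (H.mono _ h1 s hs t ht hst) (H.mono _ h2 s hs t ht hst)
  zero := by simp [symSum, H.zero]
  nonneg := fun r hr => by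
    have h2 := smul_dir_mem H.convex he he' (r := -r)
      (abs_le.2 ⟨by linarith [hr.2], by linarith [hr.1]⟩)
    rw [neg_smul] at h2
    exact H.symSum_nonneg
      (smul_dir_mem H.convex he he' (abs_le.2 ⟨by linarith [hr.1], hr.2⟩)) h2
  Z_pos := fun h hh t ht => minPotential_pos H.compact H.zero_mem (H.continuousOn_slice ht)
    ((H.at_zero_nonpos ht).trans_lt hh)
  Z_mono := fun h h' hh t ht => minPotential_mono H.compact (H.continuousOn_slice ht)
    (H.continuousOn_slice ht) hh fun _ _ => le_rfl
  Z_anti := fun h s hs t ht hst => minPotential_mono H.compact (H.continuousOn_slice ht)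
    (H.continuousOn_slice hs) le_rfl fun x hx => H.mono x hx s hs t ht hst
  Z_mul := fun η h hη hη1 t ht => minPotential_mul_ge H.compact H.convex H.zero_mem
    (H.continuousOn_slice ht) (H.convexOn t ht) (H.at_zero_nonpos ht) h hη hη1
  leg := fun t t' hT htt ht' h a r' hh ha hMr hrr hG hle hpos hrise => by
    have hM' : (8 : ℝ) ≤ M := by exact_mod_cast hM
    refine H.leg_time_le hp hLam hT htt ht' hh ?_ hne ha he he' (by linarith) hMr hrr hle hpos
      hrise
    simp only [symSum, zero_smul, neg_zero] at hG
    linarith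
  center := fun t hT ht h hh hhs hG => by
    have hg := gapC_pos n
    rw [le_div_iff₀ (by positivity)] at hhs
    refine H.neg_time_le hlam hp hd (hT'.1.trans hT) ht
      (fun x hx hxi s hs => hbd x hx hxi s ⟨hT.trans hs.1, hs.2⟩) hh (by linarith) ?_
    simp only [symSum, zero_smul, neg_zero] at hG
    linarith

/-- The main one-dimensional estimate. -/
lemma exists_symSum_le (H : NormalizedSolution lam Lam p d S T h₀ v) (hp : 0 < p) (hlam : 0 < lam)
    (hLam : 0 < Lam) (hd : 1 ≤ d) {e : E n} (hne : e ≠ 0) {r₀ : ℝ} (hr₀ : 0 < r₀)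
    (he : r₀ • e ∈ S) (he' : -(r₀ • e) ∈ S) {M : ℕ} (hM : 8 ≤ M)
    (hMC : 2 * centerC n d p lam * growthC n ^ (2 * p) ≤ legC n p Lam * (M : ℝ) ^ (2 * p))
    (hinit : ∀ a₂ > 0, ∃ c₁ > 0, ∀ r ∈ Ioc 0 r₀, ∀ a ∈ Ioc 0 a₂,
      a * r ≤ 2 * symSum (fun x => v x (-T)) e r → c₁ * a ^ M ≤ a * r) :
    ∃ K, 0 ≤ K ∧ ∀ s ∈ Icc 0 r₀, symSum (fun x => v x 0) e s ≤
      K * s ^ (1 + ((M * (n + 3) - 1 : ℕ) : ℝ)⁻¹) := by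
  obtain ⟨T', hT', hbd⟩ := H.exists_boundary_time
  have L := H.legData hp hlam hLam hd hne hr₀ he he' hM hT' hbd
  have hg := gapC_pos n
  have hh := H.h₀_pos
  have hG := L.nonneg r₀ (right_mem_Icc.2 hr₀.le)
  set a₂ := symSum (fun x => v x 0) e r₀ / r₀ + 1 with ha₂
  have ha₂0 : 0 < a₂ := by positivity
  obtain ⟨c₁, hc₁, hc⟩ := hinit a₂ ha₂0
  obtain ⟨k, hk, hks⟩ := L.exists_rate hp (centerC_pos n hd hlam) (by positivity) hM hMC hc₁ ha₂0
    le_rfl hc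
  refine ⟨(1 / k) ^ ((M * (n + 3) - 1 : ℕ) : ℝ)⁻¹, by positivity, fun s hs => ?_⟩
  rcases hs.1.eq_or_lt with h0 | h0
  · subst h0
    simp only [symSum, zero_smul, neg_zero, H.zero, add_zero]
    positivity
  have hN : 24 ≤ M * (n + 3) := by nlinarith
  refine le_rpow_of_mul_pow_le hk (L.nonneg s hs) h0 (by omega) ?_
  rw [Nat.sub_add_cancel (by omega)]
  exact hks s ⟨h0, hs.2⟩

end NormalizedSolution

/-- The function `u` minus the affine function `u 0 0 + ⟪q, ·⟫`. -/
def tilt (u : E n → ℝ → ℝ) (q x : E n) (t : ℝ) : ℝ := u x t - (u 0 0 + ⟪q, x⟫)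

lemma convexOn_tilt {u : E n → ℝ → ℝ} {s : Set (E n)} {t : ℝ}
    (h : ConvexOn ℝ s fun x => u x t) (q : E n) : ConvexOn ℝ s fun x => tilt u q x t := by
  have h1 : ConcaveOn ℝ s fun x : E n => u 0 0 + ⟪q, x⟫ :=
    (concaveOn_const _ h.1).add ((innerSL ℝ q).toLinearMap.concaveOn h.1)
  exact h.sub h1

lemma continuousOn_tilt {u : E n → ℝ → ℝ} {s : Set (E n × ℝ)}
    (h : ContinuousOn (fun z : E n × ℝ => u z.1 z.2) s) (q : E n) :
    ContinuousOn (fun z : E n × ℝ => tilt u q z.1 z.2) s :=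
  h.sub (by fun_prop : Continuous fun z : E n × ℝ => u 0 0 + ⟪q, z.1⟫).continuousOn

lemma DBalanced.neg_smul_mem {d : ℝ} (hd : 1 ≤ d) {S : Set (E n)} (h : DBalanced d S 0)
    {x : E n} (hx : x ∈ S) : (-(1 / d)) • x ∈ S := by
  obtain ⟨A, hA, h1, h2⟩ := h
  simp only [sub_zero, image_id'] at h1 h2
  have h3 := h2 (mem_image_of_mem A hx)
  rw [mem_ball_zero_iff] at h3
  have hd0 : 0 < d := by linarith
  have h4 : (-(1 / d)) • A x ∈ ball (0 : E n) 1 := by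
    rw [mem_ball_zero_iff, norm_smul, norm_neg, Real.norm_of_nonneg (by positivity),
      div_mul_eq_mul_div, one_mul, div_lt_one hd0]
    exact h3
  obtain ⟨y, hy, hyx⟩ := h1 h4
  rw [← map_smul] at hyx
  exact hA.1 hyx ▸ hy

lemma normalizedSolution_tilt {lam Lam p d T h : ℝ} (hd : 1 ≤ d) {Ω : Set (E n)}
    {u : E n → ℝ → ℝ} {q : E n} (hΩ : IsOpen Ω) (hΩc : Convex ℝ Ω) (hT : 0 < T)
    (hu : ViscositySolution lam Lam p Ω (-T) 0 u) (h0 : (0 : E n) ∈ Ω) (hh : 0 < h)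
    (hK : IsCompact (closure {y ∈ Ω | u y 0 ≤ u 0 0 + ⟪q, y⟫ + h}))
    (hKΩ : closure {y ∈ Ω | u y 0 ≤ u 0 0 + ⟪q, y⟫ + h} ⊆ Ω)
    (hbal : DBalanced d {y ∈ Ω | u y 0 ≤ u 0 0 + ⟪q, y⟫ + h} 0) :
    NormalizedSolution lam Lam p d {y ∈ Ω | u y 0 ≤ u 0 0 + ⟪q, y⟫ + h} T h (tilt u q) := by
  obtain ⟨⟨hcont, hconv, hmono⟩, hsub, hsup⟩ := hu
  set S := {y ∈ Ω | u y 0 ≤ u 0 0 + ⟪q, y⟫ + h} with hS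
  have hT0 : (0 : ℝ) ∈ Icc (-T) 0 := ⟨by linarith, le_rfl⟩
  have hSΩ : S ⊆ Ω := fun x hx => hx.1
  have hSc : S ⊆ closure Ω := hSΩ.trans subset_closure
  have hmem : ∀ {x}, x ∈ S ↔ x ∈ Ω ∧ tilt u q x 0 ≤ h := fun {x} => by
    refine and_congr_right fun _ => ?_
    unfold tilt
    constructor <;> intro <;> linarith
  have hslice : ContinuousOn (fun x => tilt u q x 0) (closure Ω) :=
    ContinuousOn.comp (g := fun z : E n × ℝ => tilt u q z.1 z.2) (f := fun x => (x, (0 : ℝ)))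
      (continuousOn_tilt hcont q) (by fun_prop) fun x hx => ⟨hx, hT0⟩
  have hclosed : IsClosed {x ∈ closure Ω | tilt u q x 0 ≤ h} :=
    hslice.preimage_isClosed_of_isClosed isClosed_closure isClosed_Iic
  have hSclosed : closure S = S := by
    refine Subset.antisymm (fun x hx => hmem.2 ⟨hKΩ hx, ?_⟩) subset_closure
    have hsub' : S ⊆ {x ∈ closure Ω | tilt u q x 0 ≤ h} := fun y hy => ⟨hSc hy, (hmem.1 hy).2⟩
    exact (closure_minimal hsub' hclosed hx).2
  have hopen : IsOpen {x ∈ Ω | tilt u q x 0 < h} :=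
    (hslice.mono subset_closure).isOpen_inter_preimage hΩ isOpen_Iio
  have h_int : ∀ x ∈ Ω, tilt u q x 0 < h → x ∈ interior S := fun x hx hlt =>
    interior_maximal (fun y hy => hmem.2 ⟨hy.1, hy.2.le⟩) hopen ⟨hx, hlt⟩
  have hzero : tilt u q 0 0 = 0 := by simp [tilt]
  have hScvx : Convex ℝ S := by
    have h1 := ((convexOn_tilt (hconv 0 hT0) q).subset subset_closure hΩc).convex_le h
    convert h1 using 1
    ext x
    exact hmem
  have hbar : ∀ (A : ℝ) (q' : E n) (m : Fin n → ℝ) (c : Fin n → E n →L[ℝ] ℝ) (b : Fin n → ℝ)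
      (κ τ : ℝ) (x : E n) (s : ℝ), barrier (A + u 0 0) (q' + q) m c b κ τ x s =
        barrier A q' m c b κ τ x s + (u 0 0 + ⟪q, x⟫) := by
    intro A q' m c b κ τ x s
    unfold barrier
    rw [inner_add_left]
    ring
  exact
    { T_pos := hT
      h₀_pos := hh
      compact := hSclosed ▸ hK
      convex := hScvx
      zero_mem := h_int 0 h0 (hzero.trans_lt hh)
      cont := (continuousOn_tilt hcont q).mono (prod_mono hSc le_rfl)
      convexOn := fun t ht => (convexOn_tilt (hconv t ht) q).subset hSc hScvx
      mono := fun x hx s hs t ht hst => sub_le_sub_right (hmono x (hSc hx) s hs t ht hst) _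
      zero := hzero
      le_height := fun x hx => (hmem.1 hx).2
      height_le := fun x hx hxi => not_lt.1 fun hlt => hxi (h_int x (hSΩ hx) hlt)
      balanced := fun x hx => hbal.neg_smul_mem hd hx
      upper := fun N hN hNS t₁ t₂ h1 h12 h2 A q' m c b κ τ hm hκ hinit hbdry x hx => by
        have key := le_barrier_of_viscSubsolution hsub hcont hN (hNS.trans hSΩ) h1 h12 h2
          (A := A + u 0 0) (q := q' + q) (b := b) (τ := τ) hm hκ
          (fun y hy => by
            have := hinit y hy
            rw [tilt] at this
            rw [hbar]
            linarith)
          (fun y hy hyi t ht => by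
            have := hbdry y hy hyi t ht
            rw [tilt] at this
            rw [hbar]
            linarith) x hx
        rw [hbar] at key
        rw [tilt]
        linarith
      lower := fun N hN hNS t₁ t₂ h1 h12 h2 A q' m c b κ τ hm hκ hinit hbdry x hx => by
        have key := barrier_le_of_viscSupersolution hsup hcont hN (hNS.trans hSΩ) h1 h12 h2
          (A := A + u 0 0) (q := q' + q) (b := b) (τ := τ) hm hκ
          (fun y hy => by
            have := hinit y hy
            rw [tilt] at this
            rw [hbar]
            linarith)
          (fun y hy hyi t ht => by
            have := hbdry y hy hyi t ht
            rw [tilt] at this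
            rw [hbar]
            linarith) x hx
        rw [hbar] at key
        rw [tilt]
        linarith }

/-- A local power bound on a bounded function extends to a global one. -/
lemma exists_global_bound {D : Set (E n)} {g : E n → ℝ} {B C ρ γ : ℝ} (hρ : 0 < ρ) (hγ : 0 < γ)
    (hC : 0 ≤ C) (hB : ∀ x ∈ D, |g x| ≤ B) (hloc : ∀ x ∈ D, ‖x‖ ≤ ρ → |g x| ≤ C * ‖x‖ ^ γ) :
    ∃ C', ∀ x ∈ D, |g x| ≤ C' * ‖x‖ ^ γ := by
  refine ⟨C + |B| / ρ ^ γ, fun x hx => ?_⟩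
  have h0 : 0 ≤ ‖x‖ ^ γ := by positivity
  rw [add_mul]
  rcases le_total ‖x‖ ρ with h | h
  · have : 0 ≤ |B| / ρ ^ γ * ‖x‖ ^ γ := by positivity
    linarith [hloc x hx h]
  · have h1 : ρ ^ γ ≤ ‖x‖ ^ γ := Real.rpow_le_rpow hρ.le h hγ.le
    have h2 : |B| ≤ |B| / ρ ^ γ * ‖x‖ ^ γ := by
      rw [div_mul_eq_mul_div, le_div_iff₀ (by positivity)]
      exact mul_le_mul_of_nonneg_left h1 (abs_nonneg _)
    have h3 : 0 ≤ C * ‖x‖ ^ γ := by positivity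
    linarith [hB x hx, le_abs_self B]

lemma exists_bound_sub_affine {Ω : Set (E n)} (hb : Bornology.IsBounded Ω) {w : E n → ℝ}
    (hw : ContinuousOn w (closure Ω)) (a : ℝ) (q : E n) :
    ∃ B, ∀ x ∈ Ω, |w x - (a + ⟪q, x⟫)| ≤ B := by
  obtain ⟨B, hB⟩ := hb.isCompact_closure.exists_bound_of_continuousOn
    (hw.sub (by fun_prop : Continuous fun x : E n => a + ⟪q, x⟫).continuousOn)
  exact ⟨B, fun x hx => hB x (subset_closure hx)⟩

/-- A convex function of one variable has a supporting line at an interior point. -/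
lemma exists_slope {φ : ℝ → ℝ} {r : ℝ} (hr : 0 < r) (hφ : ConvexOn ℝ (Icc (-r) r) φ)
    (h0 : φ 0 = 0) : ∃ q, ∀ s ∈ Icc (-r) r, 0 ≤ φ s - q * s := by
  have hslope : ∀ x ∈ Ioc 0 r, ∀ y ∈ Ioc 0 r, -φ (-y) / y ≤ φ x / x := by
    intro x hx y hy
    have hxy : 0 < x + y := add_pos hx.1 hy.1
    have hy0 := hy.1
    have hx0 := hx.1
    have h1 := hφ.2 (⟨by linarith, hx.2⟩ : x ∈ Icc (-r) r)
      (⟨by linarith [hy.2], by linarith⟩ : -y ∈ Icc (-r) r)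
      (by positivity : 0 ≤ y / (x + y)) (by positivity : 0 ≤ x / (x + y)) (by field_simp; ring)
    have h2 : (y / (x + y)) • x + (x / (x + y)) • -y = 0 := by
      simp only [smul_eq_mul]
      field_simp
      ring
    rw [h2, h0] at h1
    simp only [smul_eq_mul] at h1
    have h3 : y / (x + y) * φ x + x / (x + y) * φ (-y) = (y * φ x + x * φ (-y)) / (x + y) := by
      ring
    rw [h3, le_div_iff₀ hxy, zero_mul] at h1
    rw [div_le_div_iff₀ hy0 hx0]
    linarith
  have hne : ((fun s => φ s / s) '' Ioc 0 r).Nonempty := ⟨_, mem_image_of_mem _ ⟨hr, le_rfl⟩⟩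
  have hbdd : BddBelow ((fun s => φ s / s) '' Ioc 0 r) :=
    ⟨-φ (-r) / r, by rintro _ ⟨x, hx, rfl⟩; exact hslope x hx r ⟨hr, le_rfl⟩⟩
  refine ⟨sInf ((fun s => φ s / s) '' Ioc 0 r), fun s hs => ?_⟩
  rcases lt_trichotomy s 0 with h | h | h
  · have h1 : -φ (- -s) / -s ≤ sInf ((fun s => φ s / s) '' Ioc 0 r) := by
      refine le_csInf hne ?_
      rintro _ ⟨x, hx, rfl⟩
      exact hslope x hx (-s) ⟨by linarith, by linarith [hs.1]⟩
    rw [neg_neg, div_le_iff₀ (by linarith)] at h1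
    linarith
  · rw [h, h0, mul_zero, sub_zero]
  · have h1 := csInf_le hbdd (mem_image_of_mem (fun s => φ s / s) (⟨h, hs.2⟩ : s ∈ Ioc 0 r))
    rw [le_div_iff₀ h] at h1
    linarith

lemma convexOn_line {S : Set (E n)} {w : E n → ℝ} (hw : ConvexOn ℝ S w) {e : E n} {r : ℝ}
    (he : r • e ∈ S) (he' : -(r • e) ∈ S) : ConvexOn ℝ (Icc (-r) r) fun s => w (s • e) := by
  have h1 := hw.comp_linearMap (LinearMap.toSpanSingleton ℝ (E n) e)
  refine h1.subset (fun s hs => ?_) (convex_Icc _ _)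
  exact smul_dir_mem hw.1 he he' (abs_le.2 hs)

/-- A bound on symmetric sums yields a tangent line together with a one-sided bound. -/
lemma exists_slope_le {S : Set (E n)} {w : E n → ℝ} (hw : ConvexOn ℝ S w) (h0 : w 0 = 0)
    {e : E n} {r K γ : ℝ} (hr : 0 < r) (he : r • e ∈ S) (he' : -(r • e) ∈ S)
    (hK : ∀ s ∈ Icc 0 r, symSum w e s ≤ K * s ^ γ) :
    ∃ q, ∀ s, |s| ≤ r → 0 ≤ w (s • e) - q * s ∧ w (s • e) - q * s ≤ K * |s| ^ γ := by
  obtain ⟨q, hq⟩ := exists_slope hr (convexOn_line hw he he') (by simpa using h0)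
  refine ⟨q, fun s hs => ⟨hq s (abs_le.1 hs), ?_⟩⟩
  have h1 := hq (-s) (abs_le.1 (by rwa [abs_neg]))
  have h2 := hK |s| ⟨abs_nonneg s, hs⟩
  have h3 : symSum w e |s| = w (s • e) + w ((-s) • e) := by
    rcases abs_choice s with h | h <;> rw [h] <;> simp [symSum, add_comm]
  rw [h3] at h2
  linarith

lemma exists_smul_mem {S : Set (E n)} (h0 : (0 : E n) ∈ interior S) :
    ∃ r : ℝ, 0 < r ∧ ∀ e : E n, ‖e‖ = 1 → r • e ∈ S ∧ -(r • e) ∈ S := by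
  obtain ⟨ε, hε, hb⟩ := Metric.isOpen_iff.1 isOpen_interior 0 h0
  refine ⟨ε / 2, by linarith, fun e he => ?_⟩
  have h1 : ‖(ε / 2) • e‖ < ε := by
    rw [norm_smul, he, Real.norm_of_nonneg (by linarith)]
    linarith
  exact ⟨interior_subset (hb (mem_ball_zero_iff.2 h1)),
    interior_subset (hb (mem_ball_zero_iff.2 (by rwa [norm_neg])))⟩

/-- One-sided bounds along the coordinate axes for a convex function control it near `0`. -/
lemma exists_affine_of_axes {S : Set (E n)} {w : E n → ℝ} (hw : ConvexOn ℝ S w) (hn : 0 < n)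
    (h0 : w 0 = 0) {r γ : ℝ} (hr : 0 < r) (hγ : 0 < γ)
    (he : ∀ e : E n, ‖e‖ = 1 → r • e ∈ S ∧ -(r • e) ∈ S)
    (haxes : ∀ i : Fin n, ∃ q K : ℝ, ∀ s, |s| ≤ r →
      w (s • EuclideanSpace.single i (1 : ℝ)) - q * s ≤ K * |s| ^ γ) :
    ∃ ℓ : E n, ∃ C ρ : ℝ, 0 ≤ C ∧ 0 < ρ ∧ ∀ x, ‖x‖ ≤ ρ → |w x - ⟪ℓ, x⟫| ≤ C * ‖x‖ ^ γ := by
  choose q K hqK using haxes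
  have hn' : (0 : ℝ) < n := Nat.cast_pos.2 hn
  set C := ∑ i, (n : ℝ)⁻¹ * (|K i| * (n : ℝ) ^ γ) with hC
  have hnorm : ∀ i : Fin n, ‖EuclideanSpace.single i (1 : ℝ)‖ = 1 := fun i => by simp
  have main : ∀ x : E n, ‖x‖ ≤ r / n →
      x ∈ S ∧ w x - ⟪(WithLp.toLp 2 q : E n), x⟫ ≤ C * ‖x‖ ^ γ := by
    intro x hx
    have habs : ∀ i, |n * x i| ≤ n * ‖x‖ := fun i => by
      rw [abs_mul, Nat.abs_cast]
      exact mul_le_mul_of_nonneg_left (PiLp.norm_apply_le x i) hn'.le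
    have hle : ∀ i, |n * x i| ≤ r := fun i => by
      rw [le_div_iff₀ hn'] at hx
      linarith [habs i]
    set P : Fin n → E n := fun i => (n * x i) • EuclideanSpace.single i (1 : ℝ) with hP
    have hPS : ∀ i ∈ Finset.univ, P i ∈ S := fun i _ =>
      smul_dir_mem hw.1 (he _ (hnorm i)).1 (he _ (hnorm i)).2 (hle i)
    have hsum : ∑ _i : Fin n, (n : ℝ)⁻¹ = 1 := by
      simp [hn'.ne']
    have hw0 : ∀ i ∈ Finset.univ (α := Fin n), (0 : ℝ) ≤ (n : ℝ)⁻¹ := fun i _ => by positivity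
    have hx' : ∑ i, (n : ℝ)⁻¹ • P i = x := by
      ext j
      simp [hP, hn'.ne', Finset.sum_apply, Pi.single_apply]
    refine ⟨hx' ▸ hw.1.sum_mem hw0 hsum hPS, ?_⟩
    have h1 := hw.map_sum_le hw0 hsum hPS
    rw [hx'] at h1
    have h2 : ⟪(WithLp.toLp 2 q : E n), x⟫ = ∑ i, q i * x i := by
      simp [PiLp.inner_apply, mul_comm]
    rw [h2, hC, Finset.sum_mul, sub_le_iff_le_add, ← Finset.sum_add_distrib]
    refine h1.trans (Finset.sum_le_sum fun i _ => ?_)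
    have h3 := hqK i (n * x i) (hle i)
    have h4 : K i * |n * x i| ^ γ ≤ |K i| * ((n : ℝ) ^ γ * ‖x‖ ^ γ) := by
      rw [← Real.mul_rpow hn'.le (norm_nonneg x)]
      exact mul_le_mul (le_abs_self _) (Real.rpow_le_rpow (abs_nonneg _) (habs i) hγ.le)
        (by positivity) (abs_nonneg _)
    have h5 : w (P i) ≤ n * (q i * x i) + |K i| * ((n : ℝ) ^ γ * ‖x‖ ^ γ) := by
      simp only [hP]
      linarith
    calc (n : ℝ)⁻¹ • w (P i)
        ≤ (n : ℝ)⁻¹ * (n * (q i * x i) + |K i| * ((n : ℝ) ^ γ * ‖x‖ ^ γ)) :=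
          mul_le_mul_of_nonneg_left h5 (by positivity)
      _ = _ := by field_simp; ring
  refine ⟨WithLp.toLp 2 q, C, r / n, Finset.sum_nonneg fun i _ => by positivity, by positivity,
    fun x hx => abs_le.2 ⟨?_, (main x hx).2⟩⟩
  have h1 := main (-x) (by rwa [norm_neg])
  have h2 := hw.2 (main x hx).1 h1.1 (by norm_num : (0 : ℝ) ≤ 1 / 2)
    (by norm_num : (0 : ℝ) ≤ 1 / 2) (by norm_num)
  rw [smul_neg, add_neg_cancel, h0, norm_neg] at *
  rw [inner_neg_right] at h1
  simp only [smul_eq_mul] at h2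
  linarith [h1.2]

lemma init_of_dir {w : E n → ℝ} {e : E n} {r₀ β C A q : ℝ} {M : ℕ}
    (hβ : 0 < β) (hM : 1 + β⁻¹ ≤ M) (hA : A ≤ 0)
    (hdir : ∀ r ∈ Ioc 0 r₀, |w (r • e) - (A + q * r)| ≤ C * r ^ (1 + β) ∧
      |w (-(r • e)) - (A - q * r)| ≤ C * r ^ (1 + β)) :
    ∀ a₂ > 0, ∃ c₁ > 0, ∀ r ∈ Ioc 0 r₀, ∀ a ∈ Ioc 0 a₂,
      a * r ≤ 2 * symSum w e r → c₁ * a ^ M ≤ a * r := by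
  intro a₂ ha₂
  refine init_of_le_rpow hβ (by positivity : 0 < 2 * |C| + 1) ha₂ hM fun r hr => ?_
  obtain ⟨h1, h2⟩ := hdir r hr
  have h3 : 0 < r ^ (1 + β) := Real.rpow_pos_of_pos hr.1 _
  have h4 : C * r ^ (1 + β) ≤ |C| * r ^ (1 + β) :=
    mul_le_mul_of_nonneg_right (le_abs_self C) h3.le
  rw [symSum]
  linarith [(abs_le.1 h1).2, (abs_le.1 h2).2]

namespace NormalizedSolution

variable {lam Lam p d T h₀ : ℝ} {S : Set (E n)} {v : E n → ℝ → ℝ}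

lemma init_of_neg (H : NormalizedSolution lam Lam p d S T h₀ v) (h : v 0 (-T) < 0) :
    ∃ r₁ : ℝ, 0 < r₁ ∧ ∀ e : E n, ‖e‖ = 1 → r₁ • e ∈ S ∧ -(r₁ • e) ∈ S ∧
      ∀ r ∈ Ioc 0 r₁, symSum (fun x => v x (-T)) e r ≤ 0 := by
  have hT : -T ∈ Icc (-T) 0 := ⟨le_rfl, by linarith [H.T_pos]⟩
  have hopen : IsOpen {x ∈ interior S | v x (-T) < 0} :=
    ((H.continuousOn_slice hT).mono interior_subset).isOpen_inter_preimage isOpen_interior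
      isOpen_Iio
  obtain ⟨r₁, hr₁, hmem⟩ := exists_smul_mem (S := {x ∈ interior S | v x (-T) < 0})
    (by rw [hopen.interior_eq]; exact ⟨H.zero_mem, h⟩)
  refine ⟨r₁, hr₁, fun e he => ⟨interior_subset (hmem e he).1.1,
    interior_subset (hmem e he).2.1, fun r hr => ?_⟩⟩
  have hcv : Convex ℝ {x ∈ interior S | v x (-T) < 0} :=
    ((H.convexOn (-T) hT).subset interior_subset H.convex.interior).convex_lt 0
  have hrr : |r| ≤ r₁ := by rw [abs_of_pos hr.1]; exact hr.2
  have h1 := smul_dir_mem hcv (hmem e he).1 (hmem e he).2 hrr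
  have h2 := smul_dir_mem hcv (hmem e he).1 (hmem e he).2 (r := -r) (by rwa [abs_neg])
  rw [neg_smul] at h2
  exact add_nonpos h1.2.le h2.2.le

end NormalizedSolution

/-- The Hölder exponent attached to the order `M` of the initial detachment. -/
def holderExp (n M : ℕ) : ℝ := ((M * (n + 3) - 1 : ℕ) : ℝ)⁻¹

lemma holderExp_pos (n : ℕ) {M : ℕ} (hM : 8 ≤ M) : 0 < holderExp n M := by
  have h1 : 8 * 3 ≤ M * (n + 3) := Nat.mul_le_mul hM (by omega)
  exact inv_pos.2 (Nat.cast_pos.2 (by omega))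

section FinalRegularity

variable {p lam Lam d : ℝ}

theorem c1AlphaDirAt_final {M : ℕ} (hp : 0 < p) (hlam : 0 < lam) (hLam : 0 < Lam) (hd : 1 ≤ d)
    (hM : 8 ≤ M)
    (hMC : 2 * centerC n d p lam * growthC n ^ (2 * p) ≤ legC n p Lam * (M : ℝ) ^ (2 * p))
    {β : ℝ} (hβ : 0 < β) (hMβ : 1 + β⁻¹ ≤ M) {Ω : Set (E n)} {T h : ℝ} {u : E n → ℝ → ℝ}
    {q e : E n} (hb : Bornology.IsBounded Ω) (hu : ViscositySolution lam Lam p Ω (-T) 0 u)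
    (H : NormalizedSolution lam Lam p d {y ∈ Ω | u y 0 ≤ u 0 0 + ⟪q, y⟫ + h} T h (tilt u q))
    (he : ‖e‖ = 1) (hdir : C1AlphaDirAt (fun x => u x (-T)) Ω β 0 e) :
    C1AlphaDirAt (fun x => u x 0) Ω (holderExp n M) 0 e := by
  set S := {y ∈ Ω | u y 0 ≤ u 0 0 + ⟪q, y⟫ + h}
  obtain ⟨C, a, q', hC⟩ := hdir
  simp only [zero_add] at hC
  have hT0 : (0 : ℝ) ∈ Icc (-T) 0 := ⟨by linarith [H.T_pos], le_rfl⟩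
  have hT1 : -T ∈ Icc (-T) 0 := ⟨le_rfl, by linarith [H.T_pos]⟩
  have hS0 : (0 : E n) ∈ S := interior_subset H.zero_mem
  have ha : a = u 0 (-T) := by
    have := hC 0 (by simpa using hS0.1)
    rw [abs_zero, Real.zero_rpow (by linarith), mul_zero, zero_smul, mul_zero, add_zero] at this
    linarith [abs_nonpos_iff.1 this]
  have hA : a - u 0 0 ≤ 0 := by
    rw [ha]
    linarith [hu.1.mono 0 (subset_closure hS0.1) (-T) hT1 0 hT0 hT1.2]
  obtain ⟨r₀, hr₀, hmem⟩ := exists_smul_mem H.zero_mem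
  obtain ⟨he1, he2⟩ := hmem e he
  have hmem' : ∀ s, |s| ≤ r₀ → s • e ∈ S := fun s hs => smul_dir_mem H.convex he1 he2 hs
  have hinit := init_of_dir (w := fun x => tilt u q x (-T)) (e := e) (r₀ := r₀)
    (C := C) (q := q' - ⟪q, e⟫) hβ hMβ hA fun r hr => by
      have hrr : |r| ≤ r₀ := by rw [abs_of_pos hr.1]; exact hr.2
      have h1 := hC r (hmem' r hrr).1
      have h2 := hC (-r) (hmem' (-r) (by rwa [abs_neg])).1
      rw [abs_neg, neg_smul] at h2
      rw [abs_of_pos hr.1] at h1 h2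
      simp only [tilt, inner_neg_right, inner_smul_right]
      constructor
      · convert h1 using 2
        ring
      · convert h2 using 2
        ring
  have hne : e ≠ 0 := norm_ne_zero_iff.1 (by rw [he]; exact one_ne_zero)
  obtain ⟨K, hK0, hK⟩ := H.exists_symSum_le hp hlam hLam hd hne hr₀ he1 he2 hM hMC hinit
  obtain ⟨m, hm⟩ := exists_slope_le (H.convexOn 0 hT0) H.zero hr₀ he1 he2 hK
  have hγ : 0 < 1 + holderExp n M := by linarith [holderExp_pos n hM]
  obtain ⟨B, hB⟩ := exists_bound_sub_affine hb (w := fun x => u x 0)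
    (ContinuousOn.comp (g := fun z : E n × ℝ => u z.1 z.2) (f := fun x => (x, (0 : ℝ)))
      hu.1.cont (by fun_prop) fun x hx => ⟨hx, hT0⟩) (u 0 0) (m • e + q)
  have hline : ∀ s : ℝ, u 0 0 + ⟪m • e + q, s • e⟫ = u 0 0 + (m + ⟪q, e⟫) * s := fun s => by
    rw [inner_add_left, inner_smul_left, inner_smul_right, inner_smul_right,
      real_inner_self_eq_norm_sq, he]
    simp only [conj_trivial]
    ring
  have hnorm : ∀ s : ℝ, ‖s • e‖ = |s| := fun s => by rw [norm_smul, he, mul_one, Real.norm_eq_abs]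
  obtain ⟨C', hC'⟩ := exists_global_bound (D := {x | x ∈ Ω ∧ ∃ s : ℝ, x = s • e})
    (g := fun x => u x 0 - (u 0 0 + ⟪m • e + q, x⟫)) hr₀ hγ hK0 (fun x hx => hB x hx.1) <| by
      rintro x ⟨-, s, rfl⟩ hs
      rw [hnorm] at hs ⊢
      obtain ⟨h1, h2⟩ := hm s hs
      have h3 : u (s • e) 0 - (u 0 0 + ⟪m • e + q, s • e⟫) = tilt u q (s • e) 0 - m * s := by
        rw [hline, tilt, inner_smul_right]
        ring
      simp only [h3]
      rw [abs_of_nonneg h1]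
      exact h2
  refine ⟨C', u 0 0, m + ⟪q, e⟫, fun s hs => ?_⟩
  rw [zero_add] at hs ⊢
  have := hC' (s • e) ⟨hs, s, rfl⟩
  simp only [hline, hnorm] at this
  exact this

theorem c1AlphaAt_final {M : ℕ} (hp : 0 < p) (hlam : 0 < lam) (hLam : 0 < Lam) (hd : 1 ≤ d)
    (hM : 8 ≤ M)
    (hMC : 2 * centerC n d p lam * growthC n ^ (2 * p) ≤ legC n p Lam * (M : ℝ) ^ (2 * p))
    {Ω : Set (E n)} {T h : ℝ} {u : E n → ℝ → ℝ} {q : E n}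
    (hb : Bornology.IsBounded Ω) (hu : ViscositySolution lam Lam p Ω (-T) 0 u)
    (H : NormalizedSolution lam Lam p d {y ∈ Ω | u y 0 ≤ u 0 0 + ⟪q, y⟫ + h} T h (tilt u q))
    (hlt : u 0 (-T) < u 0 0) : C1AlphaAt (fun x => u x 0) Ω (holderExp n M) 0 := by
  have hγ : 0 < 1 + holderExp n M := by linarith [holderExp_pos n hM]
  rcases n.eq_zero_or_pos with rfl | hn
  · refine ⟨0, u 0 0, 0, fun x _ => ?_⟩
    simp [Subsingleton.elim x 0]
  have hT0 : (0 : ℝ) ∈ Icc (-T) 0 := ⟨by linarith [H.T_pos], le_rfl⟩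
  obtain ⟨r₁, hr₁, hdir⟩ := H.init_of_neg (by simpa [tilt] using hlt)
  obtain ⟨ℓ, K, ρ, hK0, hρ, hℓ⟩ := exists_affine_of_axes (H.convexOn 0 hT0) hn H.zero hr₁ hγ
    (fun e he => ⟨(hdir e he).1, (hdir e he).2.1⟩) fun i => by
      have he : ‖EuclideanSpace.single i (1 : ℝ)‖ = 1 := by simp
      obtain ⟨he1, he2, hneg⟩ := hdir _ he
      obtain ⟨K, -, hK⟩ := H.exists_symSum_le hp hlam hLam hd
        (norm_ne_zero_iff.1 (by rw [he]; exact one_ne_zero)) hr₁ he1 he2 hM hMC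
        fun a₂ _ => ⟨1, one_pos, fun r hr a ha hle =>
          absurd (mul_pos ha.1 hr.1) (by linarith [hneg r hr])⟩
      obtain ⟨m, hm⟩ := exists_slope_le (H.convexOn 0 hT0) H.zero hr₁ he1 he2 hK
      exact ⟨m, K, fun s hs => (hm s hs).2⟩
  obtain ⟨B, hB⟩ := exists_bound_sub_affine hb (w := fun x => u x 0)
    (ContinuousOn.comp (g := fun z : E n × ℝ => u z.1 z.2) (f := fun x => (x, (0 : ℝ)))
      hu.1.cont (by fun_prop) fun x hx => ⟨hx, hT0⟩) (u 0 0) (ℓ + q)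
  obtain ⟨C', hC'⟩ := exists_global_bound (g := fun x => u x 0 - (u 0 0 + ⟪ℓ + q, x⟫)) hρ hγ hK0
    hB fun x _ hx => by
      have h3 : u x 0 - (u 0 0 + ⟪ℓ + q, x⟫) = tilt u q x 0 - ⟪ℓ, x⟫ := by
        rw [inner_add_left, tilt]
        ring
      simp only [h3]
      exact hℓ x hx
  exact ⟨C', u 0 0, ℓ + q, fun x hx => by simpa using hC' x hx⟩

end FinalRegularity

/-- Theorem 7.1: pointwise `C^{1,α}` regularity at the origin. -/
theorem stmt8 (n : ℕ) (p lam Lam d : ℝ)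
    (hp : 0 < p) (hlam : 0 < lam) (hll : lam ≤ Lam) (hd : 1 ≤ d) :
    -- part (a)
    (∀ β : ℝ, 0 < β → ∃ α : ℝ, 0 < α ∧
      ∀ (Ω : Set (E n)) (T : ℝ) (u : E n → ℝ → ℝ) (h : ℝ) (q e : E n),
        IsOpen Ω → Convex ℝ Ω → Bornology.IsBounded Ω → 0 < T →
        ViscositySolution lam Lam p Ω (-T) 0 u →
        (0 : E n) ∈ Ω → 0 < h →
        IsCompact (closure {y ∈ Ω | u y 0 ≤ u 0 0 + ⟪q, y⟫ + h}) →
        closure {y ∈ Ω | u y 0 ≤ u 0 0 + ⟪q, y⟫ + h} ⊆ Ω →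
        DBalanced d {y ∈ Ω | u y 0 ≤ u 0 0 + ⟪q, y⟫ + h} 0 →
        ‖e‖ = 1 →
        C1AlphaDirAt (fun x => u x (-T)) Ω β 0 e →
        C1AlphaDirAt (fun x => u x 0) Ω α 0 e) ∧
    -- part (b)
    (∃ α : ℝ, 0 < α ∧
      ∀ (Ω : Set (E n)) (T : ℝ) (u : E n → ℝ → ℝ) (h : ℝ) (q : E n),
        IsOpen Ω → Convex ℝ Ω → Bornology.IsBounded Ω → 0 < T →
        ViscositySolution lam Lam p Ω (-T) 0 u →
        (0 : E n) ∈ Ω → 0 < h →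
        IsCompact (closure {y ∈ Ω | u y 0 ≤ u 0 0 + ⟪q, y⟫ + h}) →
        closure {y ∈ Ω | u y 0 ≤ u 0 0 + ⟪q, y⟫ + h} ⊆ Ω →
        DBalanced d {y ∈ Ω | u y 0 ≤ u 0 0 + ⟪q, y⟫ + h} 0 →
        u 0 (-T) < u 0 0 →
        C1AlphaAt (fun x => u x 0) Ω α 0) := by
  have hLam : 0 < Lam := hlam.trans_le hll
  refine ⟨fun β hβ => ?_, ?_⟩
  · obtain ⟨M, hM, hMβ, hMC⟩ := exists_index (legC_pos n p hLam) hp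
      (2 * centerC n d p lam * growthC n ^ (2 * p)) (1 + β⁻¹)
    exact ⟨holderExp n M, holderExp_pos n hM,
      fun Ω T u h q e hΩ hΩc hb hT hu h0 hh hK hKΩ hbal he hdir =>
        c1AlphaDirAt_final hp hlam hLam hd hM hMC hβ hMβ hb hu
          (normalizedSolution_tilt hd hΩ hΩc hT hu h0 hh hK hKΩ hbal) he hdir⟩
  · obtain ⟨M, hM, -, hMC⟩ := exists_index (legC_pos n p hLam) hp
      (2 * centerC n d p lam * growthC n ^ (2 * p)) 0
    exact ⟨holderExp n M, holderExp_pos n hM,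
      fun Ω T u h q hΩ hΩc hb hT hu h0 hh hK hKΩ hbal hlt =>
        c1AlphaAt_final hp hlam hLam hd hM hMC hb hu
          (normalizedSolution_tilt hd hΩ hΩc hT hu h0 hh hK hKΩ hbal) hlt⟩
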